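/- Let U be a bounded nonconvex plane domain with smooth boundary. Then U is not uniquely determined in the class of all bounded plane domains with smooth boundaries by the condition of local isometry of boundaries in the relative metrics: there exists a bounded plane domain V with smooth boundary such that ∂U and ∂V are locally isometric in the relative metrics of the boundaries, yet there is no Euclidean isometry J: ℝ² → ℝ² with J(U) = V. -/

import Mathlib

open Set Filter Metric Topology ENNReal

noncomputable section

/-- A domain in `ℝⁿ`: a nonempty open connected set. -/
def IsDomainSet {n : ℕ} (U : Set (EuclideanSpace ℝ (Fin n))) : Prop :=
  IsOpen U ∧ IsConnected U

/-- The infimum of lengths of smooth paths joining `a` and `b` inside `U`. -/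
def smoothPathInf {n : ℕ} (U : Set (EuclideanSpace ℝ (Fin n)))
    (a b : EuclideanSpace ℝ (Fin n)) : ℝ≥0∞ :=
  ⨅ (γ : ℝ → EuclideanSpace ℝ (Fin n)) (_ : ContDiff ℝ 1 γ) (_ : γ 0 = a)
    (_ : γ 1 = b) (_ : ∀ t ∈ Icc (0:ℝ) 1, γ t ∈ U), eVariationOn γ (Icc 0 1)

/-- The relative metric `ρ_{∂U,U}`:
`ρ(x,y) = liminf_{x'→x, y'→y; x',y'∈U} inf{length γ : γ smooth path joining x',y' in U}`. -/
def relDist {n : ℕ} (U : Set (EuclideanSpace ℝ (Fin n)))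
    (x y : EuclideanSpace ℝ (Fin n)) : ℝ≥0∞ :=
  Filter.liminf (fun p : EuclideanSpace ℝ (Fin n) × EuclideanSpace ℝ (Fin n) =>
    smoothPathInf U p.1 p.2) ((𝓝[U] x) ×ˢ (𝓝[U] y))

/-- `f` is a bijection of `∂U` onto `∂V` which is a local isometry
in the relative metrics of the boundaries. -/
def IsBoundaryLocalIsometry {n : ℕ} (U V : Set (EuclideanSpace ℝ (Fin n)))
    (f : EuclideanSpace ℝ (Fin n) → EuclideanSpace ℝ (Fin n)) : Prop :=
  Set.BijOn f (frontier U) (frontier V) ∧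
  ∀ y ∈ frontier U, ∃ ε : ℝ≥0∞, 0 < ε ∧ ∀ a ∈ frontier U, ∀ b ∈ frontier U,
    relDist U a y < ε → relDist U b y < ε →
      relDist U a b = relDist V (f a) (f b)

/-- `U` has smooth boundary: `∂U` is an `(n-1)`-dimensional submanifold of
class `C¹` without boundary, i.e. near each of its points the frontier can be
mapped by a `C¹` diffeomorphism onto an open piece of a hyperplane. -/
def HasC1Boundary {n : ℕ} (U : Set (EuclideanSpace ℝ (Fin n))) : Prop :=
  ∀ x ∈ frontier U, ∃ (W W' : Set (EuclideanSpace ℝ (Fin n)))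
    (φ ψ : EuclideanSpace ℝ (Fin n) → EuclideanSpace ℝ (Fin n))
    (ℓ : EuclideanSpace ℝ (Fin n) →L[ℝ] ℝ),
    IsOpen W ∧ x ∈ W ∧ IsOpen W' ∧ ℓ ≠ 0 ∧
    ContDiffOn ℝ 1 φ W ∧ ContDiffOn ℝ 1 ψ W' ∧
    Set.MapsTo φ W W' ∧ Set.MapsTo ψ W' W ∧
    (∀ z ∈ W, ψ (φ z) = z) ∧ (∀ z ∈ W', φ (ψ z) = z) ∧
    φ '' (W ∩ frontier U) = W' ∩ {y | ℓ y = 0}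

/-- The intrinsic distance inside a set `S`: the infimum of lengths of
(continuous) paths joining `a` and `b` inside `S`. -/
def intrinsicDist {n : ℕ} (S : Set (EuclideanSpace ℝ (Fin n)))
    (a b : EuclideanSpace ℝ (Fin n)) : ℝ≥0∞ :=
  ⨅ (γ : ℝ → EuclideanSpace ℝ (Fin n)) (_ : ContinuousOn γ (Icc (0:ℝ) 1))
    (_ : γ 0 = a) (_ : γ 1 = b) (_ : ∀ t ∈ Icc (0:ℝ) 1, γ t ∈ S),
    eVariationOn γ (Icc 0 1)

section RelativeMetric

variable {X Y : Type*} [NormedAddCommGroup X] [NormedSpace ℝ X]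
  [NormedAddCommGroup Y] [NormedSpace ℝ Y]

/-- The infimum of lengths of smooth paths inside `U`, in any normed space. -/
def pathInf (U : Set X) (a b : X) : ℝ≥0∞ :=
  ⨅ (γ : ℝ → X) (_ : ContDiff ℝ 1 γ) (_ : γ 0 = a)
    (_ : γ 1 = b) (_ : ∀ t ∈ Icc (0:ℝ) 1, γ t ∈ U), eVariationOn γ (Icc 0 1)

/-- The relative metric of the boundary, in any normed space. -/
def bdryDist (U : Set X) (x y : X) : ℝ≥0∞ :=
  Filter.liminf (fun p : X × X => pathInf U p.1 p.2) ((𝓝[U] x) ×ˢ (𝓝[U] y))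

theorem relDist_eq_bdryDist {n : ℕ} (U : Set (EuclideanSpace ℝ (Fin n)))
    (x y : EuclideanSpace ℝ (Fin n)) : relDist U x y = bdryDist U x y := rfl

theorem pathInf_le {U : Set X} {a b : X} {γ : ℝ → X} (h : ContDiff ℝ 1 γ) (h0 : γ 0 = a)
    (h1 : γ 1 = b) (hU : ∀ t ∈ Icc (0:ℝ) 1, γ t ∈ U) :
    pathInf U a b ≤ eVariationOn γ (Icc 0 1) :=
  iInf_le_of_le γ <| iInf_le_of_le h <| iInf_le_of_le h0 <| iInf_le_of_le h1 <| iInf_le _ hU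

theorem exists_path_of_pathInf_lt {U : Set X} {a b : X} {L : ℝ≥0∞} (h : pathInf U a b < L) :
    ∃ γ : ℝ → X, ContDiff ℝ 1 γ ∧ γ 0 = a ∧ γ 1 = b ∧ (∀ t ∈ Icc (0:ℝ) 1, γ t ∈ U) ∧
      eVariationOn γ (Icc 0 1) < L := by
  simp only [pathInf, iInf_lt_iff] at h
  obtain ⟨γ, h1, h2, h3, h4, h5⟩ := h
  exact ⟨γ, h1, h2, h3, h4, h5⟩

theorem edist_le_pathInf (U : Set X) (a b : X) : edist a b ≤ pathInf U a b := by
  refine le_iInf fun γ => le_iInf fun _ => le_iInf fun h0 => le_iInf fun h1 => le_iInf fun _ => ?_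
  rw [← h0, ← h1]
  exact eVariationOn.edist_le γ (by simp) (by simp)

theorem pathInf_le_of_segment {U : Set X} {a b : X} (h : segment ℝ a b ⊆ U) :
    pathInf U a b ≤ edist a b := by
  have hs : ContDiff ℝ 1 Real.smoothTransition := Real.smoothTransition.contDiff (n := 1)
  refine (pathInf_le (γ := fun t => AffineMap.lineMap a b (Real.smoothTransition t)) ?_ ?_ ?_ ?_).trans ?_
  · simp only [AffineMap.lineMap_apply_module']
    fun_prop
  · simp
  · simp
  · intro t _
    apply h
    rw [segment_eq_image_lineMap]
    exact ⟨_, ⟨Real.smoothTransition.nonneg t, Real.smoothTransition.le_one t⟩, rfl⟩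
  · have hl : LipschitzWith (nndist a b) (AffineMap.lineMap a b : ℝ → X) :=
      lipschitzWith_lineMap a b
    refine (hl.lipschitzOnWith (s := univ)).comp_eVariationOn_le (mapsTo_univ _ _) |>.trans ?_
    have := (Real.smoothTransition.monotone.monotoneOn (Icc 0 1)).eVariationOn_eq
      (a := 0) (b := 1) (by simp) (by simp)
    simp only [inter_self, Real.smoothTransition.one, Real.smoothTransition.zero, sub_zero,
      ENNReal.ofReal_one] at this
    calc _ ≤ (nndist a b : ℝ≥0∞) * 1 := by gcongr; exact this.le
      _ = _ := by rw [mul_one, edist_nndist]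

theorem pathInf_triangle (U : Set X) (a b c : X) :
    pathInf U a c ≤ pathInf U a b + pathInf U b c := by
  refine ENNReal.le_of_forall_pos_le_add fun ε hε hfin => ?_
  have hε' : (0:ℝ≥0∞) < ε / 2 := by simpa using hε.ne'
  obtain ⟨γ, g1, g2, g3, g4, g5⟩ := exists_path_of_pathInf_lt
    (ENNReal.lt_add_right (ENNReal.add_lt_top.1 hfin).1.ne hε'.ne')
  obtain ⟨δ, d1, d2, d3, d4, d5⟩ := exists_path_of_pathInf_lt
    (ENNReal.lt_add_right (ENNReal.add_lt_top.1 hfin).2.ne hε'.ne')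
  have hs : ContDiff ℝ 1 Real.smoothTransition := Real.smoothTransition.contDiff (n := 1)
  have hmem : ∀ t, Real.smoothTransition t ∈ Icc (0:ℝ) 1 := fun t =>
    ⟨Real.smoothTransition.nonneg t, Real.smoothTransition.le_one t⟩
  set p : ℝ → X := fun t => γ (Real.smoothTransition (2 * t)) with hp
  set q : ℝ → X := fun t => δ (Real.smoothTransition (2 * t - 1)) with hq
  have e1 : EqOn (fun t => p t + (q t - b)) p (Icc 0 (1/2)) := fun t ht => by
    simp only [hq]
    rw [Real.smoothTransition.zero_of_nonpos (by linarith [ht.2]), d2]; simp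
  have e2 : EqOn (fun t => p t + (q t - b)) q (Icc (1/2) 1) := fun t ht => by
    simp only [hp]
    rw [Real.smoothTransition.one_of_one_le (by linarith [ht.1]), g3]; simp
  have := pathInf_le (U := U) (a := a) (b := c) (γ := fun t => p t + (q t - b)) (by fun_prop)
    ((e1 (by norm_num)).trans (by simp [hp, g2]))
    ((e2 (by norm_num)).trans (by simp only [hq]; norm_num [d3]))
    (fun t ht => by
      rcases le_total t (1/2) with h | h
      · rw [show p t + (q t - b) = p t from e1 ⟨ht.1, h⟩]; exact g4 _ (hmem _)
      · rw [show p t + (q t - b) = q t from e2 ⟨h, ht.2⟩]; exact d4 _ (hmem _))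
  refine this.trans ?_
  have hadd := eVariationOn.Icc_add_Icc (fun t => p t + (q t - b)) (s := univ)
    (a := 0) (b := (1/2:ℝ)) (c := 1) (by norm_num) (by norm_num) (mem_univ _)
  simp only [univ_inter] at hadd
  rw [← hadd, eVariationOn.eq_of_eqOn e1, eVariationOn.eq_of_eqOn e2]
  have b1 : eVariationOn p (Icc 0 (1/2)) ≤ eVariationOn γ (Icc 0 1) :=
    eVariationOn.comp_le_of_monotoneOn γ _
      ((Real.smoothTransition.monotone.comp (fun x y h => by simpa using h)).monotoneOn _)
      (fun t _ => hmem _)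
  have b2 : eVariationOn q (Icc (1/2) 1) ≤ eVariationOn δ (Icc 0 1) :=
    eVariationOn.comp_le_of_monotoneOn δ _
      ((Real.smoothTransition.monotone.comp (fun x y h => by simpa using h)).monotoneOn _)
      (fun t _ => hmem _)
  calc _ ≤ (pathInf U a b + ε/2) + (pathInf U b c + ε/2) :=
        add_le_add (b1.trans g5.le) (b2.trans d5.le)
    _ = pathInf U a b + pathInf U b c + (ε/2 + ε/2) := by ring
    _ = _ := by rw [ENNReal.add_halves]

theorem pathInf_polygon_le {U : Set X} {p : ℕ → X} (n : ℕ) (h0 : p 0 ∈ U)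
    (h : ∀ i < n, segment ℝ (p i) (p (i+1)) ⊆ U) :
    pathInf U (p 0) (p n) ≤ ∑ i ∈ Finset.range n, edist (p i) (p (i+1)) := by
  induction n with
  | zero => simpa using pathInf_le_of_segment (a := p 0) (b := p 0) (U := U) (by simpa using h0)
  | succ n ih =>
    rw [Finset.sum_range_succ]
    exact (pathInf_triangle U _ (p n) _).trans (add_le_add (ih fun i hi => h i (by omega))
      (pathInf_le_of_segment (h n (by omega))))

theorem IsometryEquiv.contDiff_real (T : X ≃ᵢ Y) : ContDiff ℝ 1 T :=
  T.toRealAffineIsometryEquiv.toAffineIsometry.toContinuousAffineMap.contDiff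

theorem pathInf_image_le (T : X ≃ᵢ Y) (U : Set X) (a b : X) :
    pathInf (T '' U) (T a) (T b) ≤ pathInf U a b := by
  refine le_of_forall_gt fun L hL => ?_
  obtain ⟨γ, h, h0, h1, hU, hL⟩ := exists_path_of_pathInf_lt hL
  have hc : eVariationOn (T ∘ γ) (Icc 0 1) ≤ (1 : NNReal) * eVariationOn γ (Icc 0 1) :=
    (T.isometry.lipschitz.lipschitzOnWith (s := univ)).comp_eVariationOn_le (mapsTo_univ _ _)
  rw [ENNReal.coe_one, one_mul] at hc
  have hs : ContDiff ℝ 1 (T ∘ γ) := (IsometryEquiv.contDiff_real T).comp h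
  refine ((pathInf_le hs (congrArg T h0) (congrArg T h1) fun t ht => ?_).trans hc).trans_lt hL
  exact ⟨γ t, hU t ht, rfl⟩

theorem pathInf_image (T : X ≃ᵢ Y) (U : Set X) (a b : X) :
    pathInf (T '' U) (T a) (T b) = pathInf U a b := by
  refine le_antisymm (pathInf_image_le T U a b) ?_
  have := pathInf_image_le T.symm (T '' U) (T a) (T b)
  simpa [image_image] using this

theorem exists_pathInf_lt_of_bdryDist_lt {U : Set X} {x y : X} {L : ℝ≥0∞}
    (h : bdryDist U x y < L) {r : ℝ} (hr : 0 < r) :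
    ∃ a ∈ U ∩ ball x r, ∃ b ∈ U ∩ ball y r, pathInf U a b < L := by
  have h1 := frequently_lt_of_liminf_lt (by isBoundedDefault) h
  have h2 : ∀ᶠ p in (𝓝[U] x) ×ˢ (𝓝[U] y), p.1 ∈ U ∩ ball x r ∧ p.2 ∈ U ∩ ball y r :=
    ((eventually_mem_nhdsWithin.and (eventually_nhdsWithin_of_eventually_nhds
      (ball_mem_nhds x hr))).prod_inl _).and ((eventually_mem_nhdsWithin.and
        (eventually_nhdsWithin_of_eventually_nhds (ball_mem_nhds y hr))).prod_inr _)
  obtain ⟨p, hp, hp1, hp2⟩ := (h1.and_eventually h2).exists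
  exact ⟨p.1, hp1, p.2, hp2, hp⟩

theorem bdryDist_le_of_forall {U : Set X} {x y : X} {L : ℝ≥0∞}
    (h : ∀ r > 0, ∃ a ∈ U ∩ ball x r, ∃ b ∈ U ∩ ball y r, pathInf U a b ≤ L) :
    bdryDist U x y ≤ L := by
  apply liminf_le_of_frequently_le'
  have hb := (nhdsWithin_hasBasis (nhds_basis_ball (x := x)) U).prod
    (nhdsWithin_hasBasis (nhds_basis_ball (x := y)) U)
  rw [hb.frequently_iff]
  rintro ⟨r, s⟩ ⟨hr, hs⟩
  obtain ⟨a, ha, b, hb, hab⟩ := h (min r s) (lt_min hr hs)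
  exact ⟨(a, b), ⟨⟨ball_subset_ball (min_le_left _ _) ha.2, ha.1⟩,
    ⟨ball_subset_ball (min_le_right _ _) hb.2, hb.1⟩⟩, hab⟩

theorem bdryDist_image_le (T : X ≃ᵢ Y) (U : Set X) (x y : X) :
    bdryDist (T '' U) (T x) (T y) ≤ bdryDist U x y := by
  refine le_of_forall_gt fun L hL => ?_
  obtain ⟨L', h1, h2⟩ := exists_between hL
  refine lt_of_le_of_lt (bdryDist_le_of_forall fun r hr => ?_) h2
  obtain ⟨a, ha, b, hb, hab⟩ := exists_pathInf_lt_of_bdryDist_lt h1 hr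
  refine ⟨T a, ⟨mem_image_of_mem _ ha.1, ?_⟩, T b, ⟨mem_image_of_mem _ hb.1, ?_⟩,
    (pathInf_image T U a b).le.trans hab.le⟩
  · simpa [T.dist_eq] using ha.2
  · simpa [T.dist_eq] using hb.2

theorem bdryDist_image (T : X ≃ᵢ Y) (U : Set X) (x y : X) :
    bdryDist (T '' U) (T x) (T y) = bdryDist U x y := by
  refine le_antisymm (bdryDist_image_le T U x y) ?_
  have := bdryDist_image_le T.symm (T '' U) (T x) (T y)
  simpa [image_image] using this

theorem edist_le_bdryDist (U : Set X) (x y : X) : edist x y ≤ bdryDist U x y := by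
  refine le_of_forall_gt_imp_ge_of_dense fun L hL => ?_
  refine ENNReal.le_of_forall_pos_le_add fun ε hε _ => ?_
  obtain ⟨a, ha, b, hb, hab⟩ := exists_pathInf_lt_of_bdryDist_lt hL
    (r := ε / 2) (by positivity)
  have h1 : edist x a ≤ ENNReal.ofReal (ε / 2) := by
    rw [edist_comm, edist_dist]; exact ENNReal.ofReal_le_ofReal (mem_ball.1 ha.2).le
  have h2 : edist b y ≤ ENNReal.ofReal (ε / 2) := by
    rw [edist_dist]; exact ENNReal.ofReal_le_ofReal (mem_ball.1 hb.2).le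
  calc edist x y ≤ edist x a + edist a b + edist b y := edist_triangle4 _ _ _ _
    _ ≤ ENNReal.ofReal (ε / 2) + L + ENNReal.ofReal (ε / 2) := by
        gcongr
        exact (edist_le_pathInf U a b).trans hab.le
    _ = L + (ENNReal.ofReal (ε / 2) + ENNReal.ofReal (ε / 2)) := by ring
    _ = L + ε := by
        rw [← ENNReal.ofReal_add (by positivity) (by positivity), add_halves,
          ENNReal.ofReal_coe_nnreal]

/-- The relative metric is determined locally, up to isometries of the ambient space. -/
theorem bdryDist_le_of_local (T : X ≃ᵢ Y) {U : Set X} {V : Set Y} {y : X} {r : ℝ}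
    (h : T '' (U ∩ ball y r) ⊆ V) {a b : X} (ha : dist a y < r / 3)
    (hab : bdryDist U a b < ENNReal.ofReal (r / 3)) :
    bdryDist V (T a) (T b) ≤ bdryDist U a b := by
  have hr : 0 < r := by linarith [dist_nonneg (x := a) (y := y)]
  refine le_of_forall_gt fun L hL => ?_
  obtain ⟨L', h1, h2⟩ := exists_between (lt_min hL hab)
  refine lt_of_le_of_lt (bdryDist_le_of_forall fun s hs => ?_) (h2.trans_le (min_le_left _ _))
  obtain ⟨p, hp, q, hq, hpq⟩ := exists_pathInf_lt_of_bdryDist_lt h1 (lt_min hs (by positivity : 0 < r/3))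
  obtain ⟨γ, g1, g2, g3, g4, g5⟩ := exists_path_of_pathInf_lt hpq
  have hpath : ∀ t ∈ Icc (0:ℝ) 1, γ t ∈ U ∩ ball y r := fun t ht => by
    refine ⟨g4 t ht, ?_⟩
    have d1 : edist (γ t) p < ENNReal.ofReal (r/3) := by
      rw [← g2]
      exact (eVariationOn.edist_le γ ht (by simp)).trans_lt
        (g5.trans (h2.trans_le (min_le_right _ _)))
    rw [edist_lt_ofReal] at d1
    have d2 : dist p a < r/3 := (mem_ball.1 hp.2).trans_le (min_le_right _ _)
    rw [mem_ball]
    linarith [dist_triangle4 (γ t) p a y]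
  have hsub : T '' (U ∩ ball y r) ⊆ V := h
  have key : pathInf V (T p) (T q) ≤ L' := by
    have : pathInf (U ∩ ball y r) p q ≤ L' := (pathInf_le g1 g2 g3 hpath).trans g5.le
    rw [← pathInf_image T] at this
    refine le_trans ?_ this
    refine le_iInf fun γ => le_iInf fun h => le_iInf fun h0 => le_iInf fun h1 =>
      le_iInf fun hU => ?_
    exact pathInf_le h h0 h1 (fun t ht => hsub (hU t ht))
  have hpm := hpath 0 (by simp)
  have hqm := hpath 1 (by simp)
  rw [g2] at hpm
  rw [g3] at hqm
  refine ⟨T p, ⟨hsub (mem_image_of_mem _ hpm), ?_⟩, T q, ⟨hsub (mem_image_of_mem _ hqm), ?_⟩, key⟩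
  · simpa [T.dist_eq] using (mem_ball.1 hp.2).trans_le (min_le_left _ _)
  · simpa [T.dist_eq] using (mem_ball.1 hq.2).trans_le (min_le_left _ _)

end RelativeMetric

section SmoothBoundary

variable {X Y Z : Type*} [NormedAddCommGroup X] [NormedSpace ℝ X]
  [NormedAddCommGroup Y] [NormedSpace ℝ Y] [NormedAddCommGroup Z] [NormedSpace ℝ Z]

/-- The boundary of `U` is a `C¹` hypersurface, with charts in the model space `Z`. -/
def HasSmoothBdry (Z : Type*) [NormedAddCommGroup Z] [NormedSpace ℝ Z] (U : Set X) : Prop :=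
  ∀ x ∈ frontier U, ∃ (W : Set X) (W' : Set Z) (φ : X → Z) (ψ : Z → X) (ℓ : Z →L[ℝ] ℝ),
    IsOpen W ∧ x ∈ W ∧ IsOpen W' ∧ ℓ ≠ 0 ∧
    ContDiffOn ℝ 1 φ W ∧ ContDiffOn ℝ 1 ψ W' ∧
    Set.MapsTo φ W W' ∧ Set.MapsTo ψ W' W ∧
    (∀ z ∈ W, ψ (φ z) = z) ∧ (∀ z ∈ W', φ (ψ z) = z) ∧
    φ '' (W ∩ frontier U) = W' ∩ {y | ℓ y = 0}

theorem hasC1Boundary_iff {n : ℕ} (U : Set (EuclideanSpace ℝ (Fin n))) :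
    HasC1Boundary U ↔ HasSmoothBdry (EuclideanSpace ℝ (Fin n)) U := Iff.rfl

theorem HasSmoothBdry.image {U : Set X} (h : HasSmoothBdry Z U) (Φ : X ≃ₜ Y)
    (h1 : ContDiff ℝ 1 Φ) (h2 : ContDiff ℝ 1 Φ.symm) : HasSmoothBdry Z (Φ '' U) := by
  intro y hy
  rw [← Φ.image_frontier] at hy ⊢
  obtain ⟨x, hx, rfl⟩ := hy
  obtain ⟨W, W', φ, ψ, ℓ, a1, a2, a3, a4, a5, a6, a7, a8, a9, a10, a11⟩ := h x hx
  refine ⟨Φ '' W, W', φ ∘ Φ.symm, Φ ∘ ψ, ℓ, Φ.isOpenMap _ a1, mem_image_of_mem _ a2, a3, a4,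
    ?_, h1.comp_contDiffOn a6, ?_, ?_, ?_, ?_, ?_⟩
  · refine a5.comp h2.contDiffOn ?_
    rintro _ ⟨z, hz, rfl⟩
    simpa using hz
  · rintro _ ⟨z, hz, rfl⟩
    simpa using a7 hz
  · exact fun z hz => mem_image_of_mem _ (a8 hz)
  · rintro _ ⟨z, hz, rfl⟩
    simp [a9 z hz]
  · intro z hz
    simp [a10 z hz]
  · rw [← image_inter Φ.injective, ← a11, image_comp, ← image_comp Φ.symm]
    simp

theorem HasSmoothBdry.image_isometry {U : Set X} (h : HasSmoothBdry Z U) (T : X ≃ᵢ Y) :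
    HasSmoothBdry Z (T '' U) :=
  h.image T.toHomeomorph T.contDiff_real T.symm.contDiff_real

theorem HasSmoothBdry.exists_defining {U : Set X} (h : HasSmoothBdry Z U) {x : X}
    (hx : x ∈ frontier U) : ∃ (G : X → ℝ) (L : X →L[ℝ] ℝ), ContDiffAt ℝ 1 G x ∧
      HasFDerivAt G L x ∧ L ≠ 0 ∧ ∀ᶠ z in 𝓝 x, z ∈ frontier U ↔ G z = 0 := by
  obtain ⟨W, W', φ, ψ, ℓ, a1, a2, a3, a4, a5, a6, a7, a8, a9, a10, a11⟩ := h x hx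
  have hW : W ∈ 𝓝 x := a1.mem_nhds a2
  have hW' : W' ∈ 𝓝 (φ x) := a3.mem_nhds (a7 a2)
  have hφ := a5.contDiffAt hW
  have hψ := a6.contDiffAt hW'
  have hφd := (hφ.differentiableAt one_ne_zero).hasFDerivAt
  have hψd := (hψ.differentiableAt one_ne_zero).hasFDerivAt
  refine ⟨fun z => ℓ (φ z), ℓ.comp (fderiv ℝ φ x), ℓ.contDiff.contDiffAt.comp x hφ,
    ℓ.hasFDerivAt.comp x hφd, fun h0 => a4 ?_, ?_⟩
  · have hid : HasFDerivAt (φ ∘ ψ) ((fderiv ℝ φ x).comp (fderiv ℝ ψ (φ x))) (φ x) := by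
      refine HasFDerivAt.comp _ ?_ hψd
      rwa [a9 x a2]
    have hid' : HasFDerivAt (φ ∘ ψ) (ContinuousLinearMap.id ℝ Z) (φ x) :=
      (hasFDerivAt_id _).congr_of_eventuallyEq (by
        filter_upwards [hW'] with z hz using a10 z hz)
    have e := hid.unique hid'
    calc ℓ = ℓ.comp (ContinuousLinearMap.id ℝ Z) := by simp
      _ = (ℓ.comp (fderiv ℝ φ x)).comp (fderiv ℝ ψ (φ x)) := by
          rw [← e, ContinuousLinearMap.comp_assoc]
      _ = 0 := by rw [h0, ContinuousLinearMap.zero_comp]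
  · filter_upwards [hW] with z hz
    constructor
    · intro hzf
      have : φ z ∈ φ '' (W ∩ frontier U) := mem_image_of_mem _ ⟨hz, hzf⟩
      rw [a11] at this
      exact this.2
    · intro hz0
      have : φ z ∈ φ '' (W ∩ frontier U) := a11 ▸ ⟨a7 hz, hz0⟩
      obtain ⟨w, hw, hwz⟩ := this
      rw [← a9 z hz, ← hwz, a9 w hw.1]
      exact hw.2

end SmoothBoundary

section Graph

/-- Any nonzero real functional on the plane is a positive multiple of the imaginary part
after a rotation. -/
theorem exists_rotation_functional (L : ℂ →L[ℝ] ℝ) (hL : L ≠ 0) :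
    ∃ (u : Circle) (c : ℝ), 0 < c ∧ ∀ z : ℂ, L ((u : ℂ) * z) = c * z.im := by
  set v : ℂ := ⟨L 1, L Complex.I⟩ with hv
  have hLz : ∀ z : ℂ, L z = z.re * v.re + z.im * v.im := fun z => by
    conv_lhs => rw [← Complex.re_add_im z]
    have h1 : ((z.re : ℂ)) = z.re • (1 : ℂ) := by simp
    have h2 : ((z.im : ℂ)) * Complex.I = z.im • Complex.I := by simp
    rw [h1, h2, map_add, map_smul, map_smul]; simp [hv]
  have hv0 : v ≠ 0 := fun h => hL (by ext; simp [hLz, h])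
  have hn : (0:ℝ) < ‖v‖ := norm_pos_iff.2 hv0
  have hn' : (‖v‖ : ℂ) ≠ 0 := by exact_mod_cast hn.ne'
  have hu : -Complex.I * (v / ‖v‖) ∈ Submonoid.unitSphere ℂ := by
    simp [Submonoid.unitSphere, hn.ne']
  refine ⟨⟨_, hu⟩, ‖v‖, hn, fun z => ?_⟩
  have hsq : ‖v‖ * ‖v‖ = v.re * v.re + v.im * v.im := by
    rw [← Complex.normSq_apply, Complex.normSq_eq_norm_sq, sq]
  rw [hLz]
  have e : (-Complex.I * (v / ‖v‖)) = ⟨v.im / ‖v‖, -v.re / ‖v‖⟩ := by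
    apply Complex.ext <;> simp
    ring
  simp only [e, Complex.mul_re, Complex.mul_im]
  field_simp
  linear_combination (-z.im) * hsq

/-- Local straightening: the zero set of a `C¹` function with vertical gradient is a graph. -/
theorem exists_graph_of_defining {H : ℂ → ℝ} {c : ℝ} (hc : 0 < c) (hH : ContDiffAt ℝ 1 H 0)
    (hd : HasFDerivAt H (c • Complex.imCLM) 0) (h0 : H 0 = 0) :
    ∃ g : ℝ → ℝ, ContDiffAt ℝ 1 g 0 ∧ g 0 = 0 ∧ deriv g 0 = 0 ∧
      ∀ᶠ z in 𝓝 (0:ℂ), H z = 0 ↔ z.im = g z.re := by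
  set F : ℂ → ℂ := fun z => (z.re : ℂ) + (H z : ℂ) * Complex.I with hF
  set e : ℂ ≃L[ℝ] ℂ := ContinuousLinearEquiv.equivOfInverse
    (Complex.ofRealCLM.comp Complex.reCLM + (c • Complex.imCLM).smulRight Complex.I)
    (Complex.ofRealCLM.comp Complex.reCLM + (c⁻¹ • Complex.imCLM).smulRight Complex.I)
    (fun z => by apply Complex.ext <;> simp [hc.ne'])
    (fun z => by apply Complex.ext <;> simp [hc.ne']) with he
  have hFs : ContDiffAt ℝ 1 F 0 :=
    (Complex.ofRealCLM.contDiff.comp Complex.reCLM.contDiff).contDiffAt.add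
      ((Complex.ofRealCLM.contDiff.contDiffAt.comp (0:ℂ) hH).mul contDiffAt_const)
  have hFd : HasFDerivAt F (e : ℂ →L[ℝ] ℂ) 0 := by
    have h1 : HasFDerivAt (fun z : ℂ => (z.re : ℂ)) (Complex.ofRealCLM.comp Complex.reCLM) 0 :=
      (Complex.ofRealCLM.comp Complex.reCLM).hasFDerivAt
    have h2 := hd.smul_const Complex.I
    refine (h1.add h2).congr_of_eventuallyEq (Eventually.of_forall fun z => ?_)
    simp [hF]
  have hF0 : F 0 = 0 := by simp [hF, h0]
  set P := hFs.toOpenPartialHomeomorph F hFd one_ne_zero with hP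
  have hPc : (P : ℂ → ℂ) = F := hFs.toOpenPartialHomeomorph_coe hFd one_ne_zero
  have hsrc : (0:ℂ) ∈ P.source := hFs.mem_toOpenPartialHomeomorph_source hFd one_ne_zero
  have hP0 : P 0 = 0 := by rw [hPc, hF0]
  have htgt : (0:ℂ) ∈ P.target := by
    have := P.map_source hsrc
    rwa [hP0] at this
  have hs0 : P.symm 0 = 0 := by
    have := P.left_inv hsrc
    rwa [hP0] at this
  have hsym : ContDiffAt ℝ 1 P.symm 0 := by
    have := hFs.to_localInverse hFd one_ne_zero
    rwa [hF0] at this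
  set g : ℝ → ℝ := fun t => (P.symm (t : ℂ)).im with hg
  have hgs : ContDiffAt ℝ 1 g 0 := by
    refine Complex.imCLM.contDiff.contDiffAt.comp (0:ℝ) ?_
    refine ContDiffAt.comp (0:ℝ) ?_ Complex.ofRealCLM.contDiff.contDiffAt
    simpa using hsym
  have hg0 : g 0 = 0 := by simp [hg, hs0]
  have hcont : ContinuousAt (fun t : ℝ => P.symm (t : ℂ)) 0 := by
    have : ContinuousAt P.symm ((0:ℝ):ℂ) := by simpa using hsym.continuousAt
    exact this.comp Complex.continuous_ofReal.continuousAt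
  have hev : ∀ᶠ t : ℝ in 𝓝 0, P.symm (t : ℂ) = ⟨t, g t⟩ ∧ H ⟨t, g t⟩ = 0 := by
    have : ∀ᶠ t : ℝ in 𝓝 0, (t : ℂ) ∈ P.target :=
      Complex.continuous_ofReal.continuousAt.eventually (by
        simpa using P.open_target.mem_nhds htgt)
    filter_upwards [this] with t ht
    have h3 : F (P.symm t) = t := by rw [← hPc]; exact P.right_inv ht
    have hre := congrArg Complex.re h3
    have him := congrArg Complex.im h3
    simp only [hF, Complex.add_re, Complex.ofReal_re, Complex.mul_re, Complex.I_re, mul_zero,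
      Complex.ofReal_im, Complex.I_im, zero_mul, sub_zero, add_zero] at hre
    simp only [hF, Complex.add_im, Complex.ofReal_im, Complex.mul_im, Complex.ofReal_re,
      Complex.I_im, mul_one, Complex.I_re, mul_zero, add_zero, zero_add] at him
    have h4 : P.symm (t : ℂ) = ⟨t, g t⟩ := Complex.ext hre rfl
    exact ⟨h4, by rw [← h4]; exact him⟩
  refine ⟨g, hgs, hg0, ?_, ?_⟩
  · have hgd := (hgs.differentiableAt one_ne_zero).hasDerivAt
    have hcurve : HasDerivAt (fun t : ℝ => (t : ℂ) + (g t : ℂ) * Complex.I)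
        (1 + ((deriv g 0 : ℝ) : ℂ) * Complex.I) 0 :=
      Complex.ofRealCLM.hasDerivAt.add (hgd.ofReal_comp.mul_const Complex.I)
    have hd' : HasFDerivAt H (c • Complex.imCLM) ((0:ℝ) + (g 0 : ℂ) * Complex.I) := by
      simpa [hg0] using hd
    have hcomp := hd'.comp_hasDerivAt (0:ℝ) hcurve
    have hz : HasDerivAt (H ∘ fun t : ℝ => (t : ℂ) + (g t : ℂ) * Complex.I) 0 0 := by
      refine (hasDerivAt_const (0:ℝ) (0:ℝ)).congr_of_eventuallyEq ?_
      filter_upwards [hev] with t ht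
      have : (t : ℂ) + (g t : ℂ) * Complex.I = ⟨t, g t⟩ := by apply Complex.ext <;> simp
      simp [this, ht.2]
    have := hcomp.unique hz
    simpa [hc.ne'] using this
  · have h5 : ∀ᶠ z : ℂ in 𝓝 0, z ∈ P.source := P.open_source.mem_nhds hsrc
    have h6 : Tendsto (fun z : ℂ => z.re) (𝓝 0) (𝓝 0) := by
      simpa using Complex.continuous_re.tendsto (0:ℂ)
    filter_upwards [h5, h6.eventually hev] with z hz hz'
    constructor
    · intro hHz
      have : P z = (z.re : ℂ) := by rw [hPc]; simp [hF, hHz]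
      have h7 : P.symm (z.re : ℂ) = z := by rw [← this, P.left_inv hz]
      exact congrArg Complex.im h7.symm
    · intro hzg
      have : z = ⟨z.re, g z.re⟩ := Complex.ext rfl hzg
      rw [this]
      exact hz'.2

theorem exists_global_graph {g : ℝ → ℝ} (hg : ContDiffAt ℝ 1 g 0) (h0 : g 0 = 0)
    (h1 : deriv g 0 = 0) {κ : ℝ} (hκ : 0 < κ) : ∃ f : ℝ → ℝ, ContDiff ℝ 1 f ∧ f 0 = 0 ∧
      (∀ t, |deriv f t| ≤ κ) ∧ ∀ᶠ t in 𝓝 0, f t = g t := by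
  have hev : ∀ᶠ t in 𝓝 (0:ℝ), ContDiffAt ℝ 1 g t := hg.eventually (by simp)
  have hdc : ∀ t, ContDiffAt ℝ 1 g t → ContinuousAt (deriv g) t := fun t ht => by
    have := (ht.fderiv_right (m := 0) (by norm_num)).continuousAt
    exact this.clm_apply continuousAt_const
  have hsm : ∀ᶠ t in 𝓝 (0:ℝ), |deriv g t| < κ := by
    have := (hdc 0 hg).abs
    refine this.eventually (gt_mem_nhds ?_)
    simpa [h1] using hκ
  obtain ⟨r, hr, hball⟩ := Metric.nhds_basis_closedBall.eventually_iff.1 (hev.and hsm)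
  have hle : -r ≤ r := by linarith
  have hmem : ∀ s : Icc (-r) r, (s:ℝ) ∈ closedBall (0:ℝ) r := fun s => by
    rw [Real.closedBall_eq_Icc]; simp
  set d : ℝ → ℝ := IccExtend hle (fun s => deriv g s) with hd
  have hdcont : Continuous d := by
    refine Continuous.Icc_extend' ?_
    rw [continuous_iff_continuousAt]
    intro s
    exact ContinuousAt.comp (hdc s (hball (hmem s)).1) continuous_subtype_val.continuousAt
  have hder : ∀ t, HasDerivAt (fun t => ∫ s in (0:ℝ)..t, d s) (d t) t := fun t =>
    intervalIntegral.integral_hasDerivAt_right (hdcont.intervalIntegrable _ _)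
      hdcont.stronglyMeasurable.stronglyMeasurableAtFilter hdcont.continuousAt
  refine ⟨fun t => ∫ s in (0:ℝ)..t, d s, ?_, by simp, ?_, ?_⟩
  · rw [contDiff_one_iff_deriv]
    refine ⟨fun t => (hder t).differentiableAt, ?_⟩
    rwa [show deriv (fun t => ∫ s in (0:ℝ)..t, d s) = d from funext fun t => (hder t).deriv]
  · intro t
    rw [(hder t).deriv]
    exact (hball (hmem _)).2.le
  · filter_upwards [Metric.closedBall_mem_nhds (0:ℝ) hr] with t ht
    have hsub : uIcc 0 t ⊆ closedBall (0:ℝ) r := by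
      rw [Real.closedBall_eq_Icc] at ht ⊢
      exact uIcc_subset_Icc (by simpa using hr.le) ht
    have e : ∫ s in (0:ℝ)..t, d s = g t - g 0 := by
      refine intervalIntegral.integral_eq_sub_of_hasDerivAt (fun x hx => ?_)
        (hdcont.intervalIntegrable _ _)
      have hx' := hsub hx
      have hxI : x ∈ Icc (-r) r := by
        rw [Real.closedBall_eq_Icc] at hx'; simpa using hx'
      rw [hd, IccExtend_of_mem hle _ hxI]
      exact ((hball hx').1.differentiableAt one_ne_zero).hasDerivAt
    rw [e, h0, sub_zero]

end Graph

section LocalGraph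

/-- In the square of half-side `a` around the origin, the boundary of `V` is the graph of the
`C¹` function `g` with slope at most `κ`, and `V` contains everything above the graph. -/
structure LocalGraph (κ : ℝ) (V : Set ℂ) (g : ℝ → ℝ) (a : ℝ) : Prop where
  pos : 0 < a
  smooth : ContDiff ℝ 1 g
  zero : g 0 = 0
  deriv_le : ∀ t, |deriv g t| ≤ κ
  frontier_iff : ∀ z : ℂ, |z.re| < a → |z.im| < a → (z ∈ frontier V ↔ z.im = g z.re)
  above : ∀ z : ℂ, |z.re| < a → |z.im| < a → g z.re < z.im → z ∈ V
  below : (∀ z : ℂ, |z.re| < a → |z.im| < a → z.im < g z.re → z ∈ V) ∨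
    (∀ z : ℂ, |z.re| < a → |z.im| < a → z.im < g z.re → z ∉ V)

theorem abs_sub_le_of_deriv_le {g : ℝ → ℝ} (hg : ContDiff ℝ 1 g) {κ : ℝ}
    (h : ∀ t, |deriv g t| ≤ κ) (s t : ℝ) : |g s - g t| ≤ κ * |s - t| := by
  have := Convex.norm_image_sub_le_of_norm_deriv_le (f := g) (s := univ) (C := κ) (x := t) (y := s)
    (fun x _ => (hg.differentiable one_ne_zero) x) (fun x _ => h x) convex_univ trivial trivial
  simpa [Real.norm_eq_abs] using this

theorem LocalGraph.abs_le {κ a : ℝ} {V : Set ℂ} {g : ℝ → ℝ} (h : LocalGraph κ V g a) (t : ℝ) :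
    |g t| ≤ κ * |t| := by
  simpa [h.zero] using abs_sub_le_of_deriv_le h.smooth h.deriv_le t 0

/-- A preconnected set missing the boundary is inside or outside. -/
theorem subset_or_disjoint_of_frontier {V S : Set ℂ} (hS : IsPreconnected S)
    (h : S ∩ frontier V = ∅) : S ⊆ V ∨ ∀ z ∈ S, z ∉ V := by
  by_contra! hc
  obtain ⟨h1, z, hz, hzV⟩ := hc
  obtain ⟨w, hw, hwV⟩ := not_subset.1 h1
  have hdis : ∀ p ∈ S, p ∈ closure V → p ∈ interior V := fun p hp hc => by
    by_contra hi
    exact (h ▸ (⟨hp, hc, hi⟩ : p ∈ S ∩ frontier V) : p ∈ (∅ : Set ℂ))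
  obtain ⟨p, -, hp1, hp2⟩ := hS (interior V) (closure V)ᶜ isOpen_interior isClosed_closure.isOpen_compl
    (fun p hp => by
      by_cases hc : p ∈ closure V
      · exact Or.inl (hdis p hp hc)
      · exact Or.inr hc)
    ⟨z, hz, hdis z hz (subset_closure hzV)⟩
    ⟨w, hw, fun hc => hwV (interior_subset (hdis w hw hc))⟩
  exact hp2 (subset_closure (interior_subset hp1))

theorem isPreconnected_above {g : ℝ → ℝ} (hg : Continuous g) {a : ℝ}
    (hle : ∀ t, |t| < a → |g t| < a) :
    IsPreconnected {z : ℂ | |z.re| < a ∧ |z.im| < a ∧ g z.re < z.im} := by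
  have hpre : IsPreconnected (Ioo (-a) a ×ˢ Ioo (0:ℝ) 1) := isPreconnected_Ioo.prod isPreconnected_Ioo
  have hc : Continuous fun p : ℝ × ℝ => ((p.1 : ℂ) + (((1 - p.2) * g p.1 + p.2 * a : ℝ) : ℂ) * Complex.I) := by
    fun_prop
  convert hpre.image _ hc.continuousOn using 1
  ext z
  simp only [mem_ofPred_eq, mem_image, mem_prod, Prod.exists, mem_Ioo]
  constructor
  · rintro ⟨h1, h2, h3⟩
    have h4 := abs_lt.1 (hle _ h1)
    have h5 := abs_lt.1 h2
    have hpos : 0 < a - g z.re := by linarith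
    refine ⟨z.re, (z.im - g z.re) / (a - g z.re), ⟨abs_lt.1 h1, by apply div_pos <;> linarith,
      by rw [div_lt_one hpos]; linarith⟩, ?_⟩
    apply Complex.ext
    · simp only [Complex.add_re, Complex.ofReal_re, Complex.mul_re, Complex.I_re, mul_zero,
        Complex.ofReal_im, Complex.I_im, mul_one, sub_self, add_zero]
    · simp only [Complex.add_im, Complex.ofReal_im, Complex.mul_im, Complex.ofReal_re,
        Complex.I_im, mul_one, Complex.I_re, mul_zero, add_zero, zero_add]
      field_simp
      ring
  · rintro ⟨x, s, ⟨h1, h2, h3⟩, rfl⟩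
    have h4 := abs_lt.1 (hle x (abs_lt.2 h1))
    simp only [Complex.add_re, Complex.ofReal_re, Complex.mul_re, Complex.I_re, mul_zero,
      Complex.ofReal_im, Complex.I_im, mul_one, sub_self, add_zero, Complex.add_im, Complex.mul_im,
      zero_add]
    exact ⟨abs_lt.2 h1, abs_lt.2 ⟨by nlinarith, by nlinarith⟩, by nlinarith⟩

/-- complex conjugation as an isometry. -/
def conjIso : ℂ ≃ᵢ ℂ := Complex.conjLIE.toIsometryEquiv

@[simp] theorem conjIso_apply (z : ℂ) : conjIso z = (starRingEnd ℂ) z := rfl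
@[simp] theorem conjIso_symm_apply (z : ℂ) : conjIso.symm z = (starRingEnd ℂ) z := rfl

theorem mem_conjIso_image {V : Set ℂ} {z : ℂ} : z ∈ conjIso '' V ↔ (starRingEnd ℂ) z ∈ V := by
  rw [← conjIso_symm_apply]
  exact ⟨by rintro ⟨w, hw, rfl⟩; simpa using hw, fun h => ⟨_, h, by simp⟩⟩

theorem frontier_image_isometry (T : ℂ ≃ᵢ ℂ) (V : Set ℂ) :
    frontier (T '' V) = T '' frontier V :=
  (T.toHomeomorph.image_frontier V).symm

/-- Near any point a smooth boundary is a graph, in suitable Euclidean coordinates. -/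
theorem exists_localGraph {Z : Type*} [NormedAddCommGroup Z] [NormedSpace ℝ Z] {U : Set ℂ}
    (hU : IsOpen U) (hb : HasSmoothBdry Z U) {x : ℂ} (hx : x ∈ frontier U) {κ : ℝ} (hκ : 0 < κ)
    (hκ' : κ < 1) : ∃ (T : ℂ ≃ᵢ ℂ) (g : ℝ → ℝ) (a : ℝ), T x = 0 ∧ LocalGraph κ (T '' U) g a := by
  obtain ⟨G, L, hG, hGL, hL, hGz⟩ := hb.exists_defining hx
  obtain ⟨u, c, hc, hLu⟩ := exists_rotation_functional L hL
  set S : ℂ ≃ᵢ ℂ := (rotation u).toIsometryEquiv.trans (IsometryEquiv.addRight x) with hS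
  have hSz : ∀ z, S z = (u : ℂ) * z + x := fun z => by simp [hS, rotation_apply]
  have hS0 : S 0 = x := by simp [hSz]
  have hSd : HasFDerivAt S (((u : ℂ) • ContinuousLinearMap.id ℝ ℂ)) 0 := by
    have : HasFDerivAt (fun z : ℂ => (u : ℂ) • z + x) ((u : ℂ) • ContinuousLinearMap.id ℝ ℂ) 0 :=
      ((hasFDerivAt_id (𝕜 := ℝ) (0:ℂ)).const_smul (u : ℂ)).add_const x
    exact this.congr_of_eventuallyEq (Eventually.of_forall fun z => by simp [hSz])
  have hH : ContDiffAt ℝ 1 (G ∘ S) 0 :=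
    ContDiffAt.comp 0 (by rwa [hS0]) S.contDiff_real.contDiffAt
  have hHd : HasFDerivAt (G ∘ S) (c • Complex.imCLM) 0 := by
    have h1 : HasFDerivAt G L (S 0) := by rwa [hS0]
    have := h1.comp 0 hSd
    have e : c • Complex.imCLM = L ∘SL ((u : ℂ) • ContinuousLinearMap.id ℝ ℂ) := by
      ext z
      simp [hLu]
    rw [e]
    exact this
  have hx0 : G x = 0 := (hGz.self_of_nhds).1 hx
  obtain ⟨g₀, h1, h2, h3, h4⟩ := exists_graph_of_defining hc hH hHd (by simp [hS0, hx0])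
  obtain ⟨g, k1, k2, k3, k4⟩ := exists_global_graph h1 h2 h3 hκ
  have hre : Tendsto (fun z : ℂ => z.re) (𝓝 0) (𝓝 0) := by
    simpa using Complex.continuous_re.tendsto (0:ℂ)
  have hST : Tendsto S (𝓝 0) (𝓝 x) := by
    have := S.continuous.tendsto 0
    rwa [hS0] at this
  have hev : ∀ᶠ z in 𝓝 (0:ℂ), S z ∈ frontier U ↔ z.im = g z.re := by
    filter_upwards [h4, hre.eventually k4, hST.eventually hGz] with z e1 e2 e3
    rw [e3, e2]; exact e1
  obtain ⟨r, hr, hball⟩ := Metric.nhds_basis_ball.eventually_iff.1 hev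
  set V := S.symm '' U with hV
  have hVo : IsOpen V := S.symm.toHomeomorph.isOpenMap _ hU
  have hVf : ∀ z, z ∈ frontier V ↔ S z ∈ frontier U := fun z => by
    rw [hV, frontier_image_isometry]
    exact ⟨by rintro ⟨w, hw, rfl⟩; simpa using hw, fun h => ⟨_, h, by simp⟩⟩
  set a := r / 2 with ha
  have ha0 : 0 < a := by positivity
  have hfr : ∀ z : ℂ, |z.re| < a → |z.im| < a → (z ∈ frontier V ↔ z.im = g z.re) := by
    intro z hz1 hz2
    rw [hVf]
    refine hball ?_
    rw [mem_ball_zero_iff]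
    linarith [Complex.norm_le_abs_re_add_abs_im z]
  have hgle : ∀ t, |g t| ≤ κ * |t| := fun t => by
    simpa [k2] using abs_sub_le_of_deriv_le k1 k3 t 0
  have hga : ∀ t, |t| < a → |g t| < a := fun t ht => by
    have := hgle t
    nlinarith [abs_nonneg t]
  have hA := isPreconnected_above k1.continuous hga
  have hB := (isPreconnected_above (g := fun t => -g t) k1.continuous.neg (a := a)
    (by simpa using hga)).image conjIso conjIso.continuous.continuousOn
  have hB' : conjIso '' {z : ℂ | |z.re| < a ∧ |z.im| < a ∧ -g z.re < z.im} =
      {z : ℂ | |z.re| < a ∧ |z.im| < a ∧ z.im < g z.re} := by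
    ext z
    rw [mem_conjIso_image]
    simp
  rw [hB'] at hB
  have hA' := subset_or_disjoint_of_frontier (V := V) hA (by
    ext z
    simp only [mem_inter_iff, mem_ofPred_eq, mem_empty_iff_false, iff_false]
    rintro ⟨⟨z1, z2, z3⟩, z4⟩
    exact z3.ne' ((hfr z z1 z2).1 z4))
  have hB'' := subset_or_disjoint_of_frontier (V := V) hB (by
    ext z
    simp only [mem_inter_iff, mem_ofPred_eq, mem_empty_iff_false, iff_false]
    rintro ⟨⟨z1, z2, z3⟩, z4⟩
    exact z3.ne ((hfr z z1 z2).1 z4))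
  have h0V : (0:ℂ) ∈ frontier V := by rw [hVf, hS0]; exact hx
  by_cases hAV : {z : ℂ | |z.re| < a ∧ |z.im| < a ∧ g z.re < z.im} ⊆ V
  · refine ⟨S.symm, g, a, by rw [← hS0]; simp, ha0, k1, k2, k3, hfr,
      fun z z1 z2 z3 => hAV ⟨z1, z2, z3⟩, ?_⟩
    exact hB''.imp (fun h z z1 z2 z3 => h ⟨z1, z2, z3⟩) (fun h z z1 z2 z3 => h z ⟨z1, z2, z3⟩)
  · have hAn := hA'.resolve_left hAV
    have hBV : {z : ℂ | |z.re| < a ∧ |z.im| < a ∧ z.im < g z.re} ⊆ V := by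
      refine hB''.resolve_right fun hBn => ?_
      have h0c : (0:ℂ) ∈ closure V := frontier_subset_closure h0V
      obtain ⟨z, hzV, hz⟩ := Metric.mem_closure_iff.1 h0c a ha0
      rw [dist_zero_left] at hz
      have z1 := (Complex.abs_re_le_norm z).trans_lt hz
      have z2 := (Complex.abs_im_le_norm z).trans_lt hz
      rcases lt_trichotomy z.im (g z.re) with h | h | h
      · exact hBn z ⟨z1, z2, h⟩ hzV
      · have := (hfr z z1 z2).2 h
        rw [hVo.frontier_eq] at this
        exact this.2 hzV
      · exact hAn z ⟨z1, z2, h⟩ hzV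
    have himg : (S.symm.trans conjIso) '' U = conjIso '' V := by
      rw [hV, image_image]; rfl
    refine ⟨S.symm.trans conjIso, fun t => -g t, a, ?_, ha0, k1.neg, by simp [k2],
      fun t => by simpa [deriv.fun_neg] using k3 t, ?_, ?_, Or.inr ?_⟩
    · have : S.symm x = 0 := by rw [← hS0]; simp
      simp [this]
    · intro z z1 z2
      rw [himg, frontier_image_isometry, mem_conjIso_image, hfr _ (by simpa) (by simpa)]
      simp [neg_eq_iff_eq_neg]
    · intro z z1 z2 z3
      rw [himg, mem_conjIso_image]
      exact hBV ⟨by simpa, by simpa, by simp; linarith⟩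
    · intro z z1 z2 z3
      rw [himg, mem_conjIso_image]
      exact hAn _ ⟨by simpa, by simpa, by simp; linarith⟩

end LocalGraph

section Smallness

theorem segment_subset_reProdIm {s t : Set ℝ} (hs : Convex ℝ s) (ht : Convex ℝ t) {p q : ℂ}
    (h1 : p.re ∈ s) (h2 : q.re ∈ s) (h3 : p.im ∈ t) (h4 : q.im ∈ t) {z : ℂ}
    (hz : z ∈ segment ℝ p q) : z.re ∈ s ∧ z.im ∈ t :=
  ((hs.linear_preimage Complex.reLm).inter (ht.linear_preimage Complex.imLm)).segment_subset
    (x := p) (y := q) ⟨h1, h3⟩ ⟨h2, h4⟩ hz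

theorem edist_mk_le (x y x' y' : ℝ) :
    edist (⟨x, y⟩ : ℂ) ⟨x', y'⟩ ≤ ENNReal.ofReal (|x - x'| + |y - y'|) := by
  rw [edist_dist, Complex.dist_eq]
  refine ENNReal.ofReal_le_ofReal ?_
  simpa using Complex.norm_le_abs_re_add_abs_im ((⟨x, y⟩ : ℂ) - ⟨x', y'⟩)

theorem LocalGraph.bdryDist_le {κ a : ℝ} {V : Set ℂ} {g : ℝ → ℝ} (h : LocalGraph κ V g a)
    (hκ : κ < 1) {r : ℝ} (hr : 0 < r) (hra : r ≤ a / 2) {x x' : ℝ} (hx : |x| < r) (hx' : |x'| < r) :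
    bdryDist V ⟨x, g x⟩ ⟨x', g x'⟩ ≤ ENNReal.ofReal (6 * r) := by
  refine bdryDist_le_of_forall fun s hs => ?_
  set δ := min s r / 2 with hδ
  have hδ0 : 0 < δ := by positivity
  have hδs : δ < s := by have := min_le_left s r; linarith
  have hδr : δ < r := by have := min_le_right s r; linarith
  have hgr : ∀ t, |t| < r → |g t| < r := fun t ht => by
    have := h.abs_le t
    nlinarith [abs_nonneg t]
  have g1 := abs_lt.1 (hgr x hx)
  have g2 := abs_lt.1 (hgr x' hx')
  have x1 := abs_lt.1 hx
  have x2 := abs_lt.1 hx'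
  have hvert : ∀ t, |t| < r → segment ℝ (⟨t, g t + δ⟩ : ℂ) ⟨t, r⟩ ⊆ V := by
    intro t ht z hz
    have t1 := abs_lt.1 ht
    have t2 := abs_lt.1 (hgr t ht)
    obtain ⟨z1, z2, z3⟩ := segment_subset_reProdIm (convex_singleton t) (convex_Ioo (g t) a)
      (p := ⟨t, g t + δ⟩) (q := ⟨t, r⟩) (mem_singleton _) (mem_singleton _) ⟨by simpa, by simp only; linarith⟩
      ⟨t2.2, by simp only; linarith⟩ hz
    rw [mem_singleton_iff] at z1
    refine h.above z ?_ ?_ ?_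
    · rw [z1]; linarith
    · exact abs_lt.2 ⟨by linarith, z3⟩
    · rw [z1]; exact z2
  have hhor : segment ℝ (⟨x, r⟩ : ℂ) ⟨x', r⟩ ⊆ V := by
    intro z hz
    obtain ⟨⟨z1, z1'⟩, z2⟩ := segment_subset_reProdIm (convex_Ioo (-r) r) (convex_singleton r)
      (p := ⟨x, r⟩) (q := ⟨x', r⟩) ⟨x1.1, x1.2⟩ ⟨x2.1, x2.2⟩ (mem_singleton _) (mem_singleton _) hz
    rw [mem_singleton_iff] at z2
    refine h.above z (abs_lt.2 ⟨by linarith, by linarith⟩)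
      (abs_lt.2 ⟨by linarith, by linarith⟩) ?_
    rw [z2]
    exact (abs_lt.1 (hgr _ (abs_lt.2 ⟨z1, z1'⟩))).2
  have hd : ∀ t, dist (⟨t, g t + δ⟩ : ℂ) ⟨t, g t⟩ < s := fun t => by
    rw [← edist_lt_ofReal]
    refine (edist_mk_le _ _ _ _).trans_lt ?_
    rw [ENNReal.ofReal_lt_ofReal_iff hs]
    simpa [abs_of_pos hδ0] using hδs
  refine ⟨⟨x, g x + δ⟩, ⟨hvert x hx (left_mem_segment _ _ _), hd x⟩, ⟨x', g x' + δ⟩,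
    ⟨hvert x' hx' (left_mem_segment _ _ _), hd x'⟩, ?_⟩
  have t1 := pathInf_triangle V (⟨x, g x + δ⟩ : ℂ) ⟨x, r⟩ ⟨x', g x' + δ⟩
  have t2 := pathInf_triangle V (⟨x, r⟩ : ℂ) ⟨x', r⟩ ⟨x', g x' + δ⟩
  have s1 := pathInf_le_of_segment (hvert x hx)
  have s2 := pathInf_le_of_segment hhor
  have s3 := pathInf_le_of_segment ((segment_symm ℝ _ _).trans_subset (hvert x' hx'))
  have e1 := edist_mk_le x (g x + δ) x r
  have e2 := edist_mk_le x r x' r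
  have e3 := edist_mk_le x' r x' (g x' + δ)
  have t3 := t1.trans (add_le_add (s1.trans e1)
    (t2.trans (add_le_add (s2.trans e2) (s3.trans e3))))
  refine t3.trans ?_
  have n1 : ∀ u v : ℝ, 0 ≤ |u| + |v| := fun u v => by positivity
  rw [← ENNReal.ofReal_add (n1 _ _) (n1 _ _), ← ENNReal.ofReal_add (n1 _ _) (add_nonneg (n1 _ _) (n1 _ _))]
  refine ENNReal.ofReal_le_ofReal ?_
  have a1 : |g x + δ - r| ≤ 2 * r := _root_.abs_le.2 ⟨by linarith, by linarith⟩
  have a2 : |x - x'| ≤ 2 * r := _root_.abs_le.2 ⟨by linarith, by linarith⟩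
  have a3 : |r - (g x' + δ)| ≤ 2 * r := _root_.abs_le.2 ⟨by linarith, by linarith⟩
  simp only [sub_self, abs_zero]
  linarith

theorem exists_bdryDist_lt {Z : Type*} [NormedAddCommGroup Z] [NormedSpace ℝ Z] {U : Set ℂ}
    (hU : IsOpen U) (hb : HasSmoothBdry Z U) {y : ℂ} (hy : y ∈ frontier U) {ε : ℝ} (hε : 0 < ε) :
    ∃ r > 0, ∀ p ∈ frontier U, ∀ q ∈ frontier U, dist p y < r → dist q y < r →
      bdryDist U p q < ENNReal.ofReal ε := by
  obtain ⟨T, g, a, hT, h⟩ := exists_localGraph hU hb hy (κ := 1/2) (by norm_num) (by norm_num)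
  set r := min (a / 2) (ε / 7) with hr
  have ha := h.pos
  have hr0 : 0 < r := by positivity
  have hra : r ≤ a / 2 := min_le_left _ _
  have hrε : 6 * r < ε := by have := min_le_right (a / 2) (ε / 7); linarith
  refine ⟨r, hr0, fun p hp q hq hpy hqy => ?_⟩
  have key : ∀ p ∈ frontier U, dist p y < r → |(T p).re| < r ∧ T p = ⟨(T p).re, g (T p).re⟩ := by
    intro p hp hpy
    have h0 : ‖T p‖ < r := by
      rw [← T.dist_eq, hT, dist_zero_right] at hpy; exact hpy
    have h1 := (Complex.abs_re_le_norm _).trans_lt h0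
    have h2 := (Complex.abs_im_le_norm _).trans_lt h0
    have h3 : T p ∈ frontier (T '' U) := by
      rw [frontier_image_isometry]; exact mem_image_of_mem _ hp
    exact ⟨h1, Complex.ext rfl ((h.frontier_iff _ (by linarith) (by linarith)).1 h3)⟩
  obtain ⟨p1, p2⟩ := key p hp hpy
  obtain ⟨q1, q2⟩ := key q hq hqy
  rw [← bdryDist_image T, p2, q2]
  refine (h.bdryDist_le (by norm_num) hr0 hra p1 q1).trans_lt ?_
  exact (ENNReal.ofReal_lt_ofReal_iff hε).2 hrε

end Smallness

section Assembly

variable {Z : Type*} [NormedAddCommGroup Z] [NormedSpace ℝ Z]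

/-- Near `y` the map `f` preserves the relative distances between close boundary points. -/
def PreservesNear (U V : Set ℂ) (f : ℂ → ℂ) (y : ℂ) : Prop :=
  ∃ r > 0, ∀ p ∈ frontier U, ∀ q ∈ frontier U, dist p y < r → dist q y < r →
    (bdryDist U p q < ENNReal.ofReal r → bdryDist V (f p) (f q) ≤ bdryDist U p q) ∧
    (bdryDist V (f p) (f q) < ENNReal.ofReal r → bdryDist U p q ≤ bdryDist V (f p) (f q))

theorem PreservesNear.exists_eq {U V : Set ℂ} (hU : IsOpen U) (hUb : HasSmoothBdry Z U)
    (hV : IsOpen V) (hVb : HasSmoothBdry Z V) {f : ℂ → ℂ} (hf : MapsTo f (frontier U) (frontier V))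
    (hc : ContinuousOn f (frontier U)) {y : ℂ} (hy : y ∈ frontier U) (h : PreservesNear U V f y) :
    ∃ ε : ℝ≥0∞, 0 < ε ∧ ∀ a ∈ frontier U, ∀ b ∈ frontier U,
      bdryDist U a y < ε → bdryDist U b y < ε → bdryDist U a b = bdryDist V (f a) (f b) := by
  obtain ⟨r, hr, h⟩ := h
  obtain ⟨r1, hr1, h1⟩ := exists_bdryDist_lt hU hUb hy hr
  obtain ⟨r2, hr2, h2⟩ := exists_bdryDist_lt hV hVb (hf hy) hr
  obtain ⟨r3, hr3, h3⟩ := Metric.continuousOn_iff.1 hc y hy r2 hr2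
  have hm : 0 < min (min r r1) r3 := by positivity
  refine ⟨ENNReal.ofReal (min (min r r1) r3), by simpa using hm, fun a ha b hb hay hby => ?_⟩
  have key : ∀ a, bdryDist U a y < ENNReal.ofReal (min (min r r1) r3) →
      dist a y < r ∧ dist a y < r1 ∧ dist a y < r3 := fun a hay => by
    have := (edist_le_bdryDist U a y).trans_lt hay
    rw [edist_lt_ofReal] at this
    simpa [and_assoc] using this
  obtain ⟨a1, a2, a3⟩ := key a hay
  obtain ⟨b1, b2, b3⟩ := key b hby
  obtain ⟨k1, k2⟩ := h a ha b hb a1 b1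
  exact le_antisymm (k2 (h2 _ (hf ha) _ (hf hb) (h3 a ha a3) (h3 b hb b3)))
    (k1 (h1 a ha b hb a2 b2))

theorem preservesNear_of_isometry (T : ℂ ≃ᵢ ℂ) {U V : Set ℂ} {f : ℂ → ℂ} {y : ℂ} {s : ℝ}
    (hs : 0 < s) (h1 : ∀ z ∈ ball y s, z ∈ U → T z ∈ V)
    (h2 : ∀ z ∈ ball (T y) s, z ∈ V → T.symm z ∈ U) (hf : ∀ z ∈ ball y s, f z = T z) :
    PreservesNear U V f y := by
  refine ⟨s / 3, by positivity, fun p _ q _ hp hq => ?_⟩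
  rw [hf p (by rw [mem_ball]; linarith), hf q (by rw [mem_ball]; linarith)]
  refine ⟨fun h => bdryDist_le_of_local T (y := y) ?_ hp h, fun h => ?_⟩
  · rintro _ ⟨z, ⟨hz, hzb⟩, rfl⟩
    exact h1 z hzb hz
  · have := bdryDist_le_of_local T.symm (U := V) (V := U) (y := T y) (r := s) (a := T p) (b := T q)
      (by rintro _ ⟨z, ⟨hz, hzb⟩, rfl⟩; exact h2 z hzb hz) (by rwa [T.dist_eq]) h
    simpa using this

/-- A `C¹` map close to the identity is a global diffeomorphism of the plane. -/
theorem exists_diffeo_of_perturbation {N : ℂ → ℂ} (hN : ContDiff ℝ 1 N)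
    (h : ∀ z, ‖fderiv ℝ N z‖ ≤ 1 / 2) : ∃ Φ : ℂ ≃ₜ ℂ, (∀ z, Φ z = z + N z) ∧
      ContDiff ℝ 1 Φ ∧ ContDiff ℝ 1 Φ.symm := by
  have hd : ∀ z, HasFDerivAt N (fderiv ℝ N z) z := fun z =>
    ((hN.differentiable one_ne_zero) z).hasFDerivAt
  have happ : ApproximatesLinearOn (fun z => z + N z)
      ((ContinuousLinearEquiv.refl ℝ ℂ : ℂ ≃L[ℝ] ℂ) : ℂ →L[ℝ] ℂ) univ (1/2) := by
    intro x _ y _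
    have := Convex.norm_image_sub_le_of_norm_fderiv_le (𝕜 := ℝ) (f := N) (s := univ) (C := 1/2)
      (fun x _ => (hN.differentiable one_ne_zero) x) (fun x _ => h x) convex_univ
      (mem_univ y) (mem_univ x)
    have e : x + N x - (y + N y) - ((ContinuousLinearEquiv.refl ℝ ℂ : ℂ ≃L[ℝ] ℂ) : ℂ →L[ℝ] ℂ) (x - y)
        = N x - N y := by simp; ring
    simp only [e]
    simpa using this
  have hlt : Subsingleton ℂ ∨ (1/2 : NNReal) <
      ‖((ContinuousLinearEquiv.refl ℝ ℂ).symm : ℂ →L[ℝ] ℂ)‖₊⁻¹ := by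
    right
    have : ((ContinuousLinearEquiv.refl ℝ ℂ).symm : ℂ →L[ℝ] ℂ) = ContinuousLinearMap.id ℝ ℂ := rfl
    rw [this]
    have : ‖ContinuousLinearMap.id ℝ ℂ‖₊ = 1 := by
      ext; simp
    rw [this]
    norm_num
  set Φ := happ.toHomeomorph _ hlt with hΦ
  have hΦz : ∀ z, Φ z = z + N z := fun z => rfl
  have hΦc : ContDiff ℝ 1 Φ := by
    have : ContDiff ℝ 1 fun z => z + N z := contDiff_id.add hN
    exact this
  refine ⟨Φ, hΦz, hΦc, ?_⟩
  have hlt' : ∀ z, ‖-fderiv ℝ N z‖ < 1 := fun z => by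
    rw [norm_neg]; linarith [h z]
  refine Φ.contDiff_symm (f₀' := fun z => ContinuousLinearEquiv.ofUnit (Units.oneSub _ (hlt' z)))
    (fun z => ?_) hΦc
  have := (hasFDerivAt_id (𝕜 := ℝ) z).add (hd z)
  have e : ((ContinuousLinearEquiv.ofUnit (Units.oneSub _ (hlt' z)) : ℂ ≃L[ℝ] ℂ) : ℂ →L[ℝ] ℂ) =
      ContinuousLinearMap.id ℝ ℂ + fderiv ℝ N z := by
    ext w
    change (1 - -fderiv ℝ N z) w = _
    simp
  rw [e]
  exact this

theorem diffeo_image {U : Set ℂ} (hU : IsOpen U) (hc : IsConnected U)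
    (hbd : Bornology.IsBounded U) (hb : HasSmoothBdry Z U) (Φ : ℂ ≃ₜ ℂ)
    (h1 : ContDiff ℝ 1 Φ) (h2 : ContDiff ℝ 1 Φ.symm) :
    IsOpen (Φ '' U) ∧ IsConnected (Φ '' U) ∧ Bornology.IsBounded (Φ '' U) ∧
      HasSmoothBdry Z (Φ '' U) ∧ BijOn Φ (frontier U) (frontier (Φ '' U)) := by
  refine ⟨Φ.isOpenMap _ hU, hc.image _ Φ.continuous.continuousOn, ?_, hb.image Φ h1 h2, ?_⟩
  · exact ((hbd.isCompact_closure).image Φ.continuous).isBounded.subset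
      (image_mono subset_closure)
  · rw [← Φ.image_frontier]
    exact Φ.injective.injOn.bijOn_image

end Assembly

section Deformation

variable {Z : Type*} [NormedAddCommGroup Z] [NormedSpace ℝ Z]

/-- There is a diffeomorphism of the plane that preserves the relative metric of the boundary of
`U` locally, but whose image of `U` is not congruent to `U`. -/
def HasDeformation (U : Set ℂ) : Prop :=
  ∃ Φ : ℂ ≃ₜ ℂ, ContDiff ℝ 1 Φ ∧ ContDiff ℝ 1 Φ.symm ∧
    (∀ y ∈ frontier U, PreservesNear U (Φ '' U) Φ y) ∧ ¬ ∃ J : ℂ ≃ᵢ ℂ, J '' U = Φ '' U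

theorem HasDeformation.of_image {U : Set ℂ} (T : ℂ ≃ᵢ ℂ) (h : HasDeformation (T '' U)) :
    HasDeformation U := by
  obtain ⟨Φ, h1, h2, h3, h4⟩ := h
  set Ψ : ℂ ≃ₜ ℂ := (T.toHomeomorph.trans Φ).trans T.symm.toHomeomorph with hΨ
  have hΨz : ∀ z, Ψ z = T.symm (Φ (T z)) := fun z => rfl
  have himg : Ψ '' U = T.symm '' (Φ '' (T '' U)) := by
    simp only [image_image]; rfl
  refine ⟨Ψ, ?_, ?_, fun y hy => ?_, ?_⟩
  · exact (T.symm.contDiff_real.comp h1).comp T.contDiff_real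
  · exact (T.symm.contDiff_real.comp h2).comp T.contDiff_real
  · obtain ⟨r, hr, h⟩ := h3 (T y) (by rw [frontier_image_isometry]; exact mem_image_of_mem _ hy)
    refine ⟨r, hr, fun p hp q hq hpy hqy => ?_⟩
    have := h (T p) (by rw [frontier_image_isometry]; exact mem_image_of_mem _ hp)
      (T q) (by rw [frontier_image_isometry]; exact mem_image_of_mem _ hq)
      (by rwa [T.dist_eq]) (by rwa [T.dist_eq])
    rw [bdryDist_image] at this
    rwa [himg, hΨz, hΨz, bdryDist_image]
  · rintro ⟨J, hJ⟩
    refine h4 ⟨(T.symm.trans J).trans T, ?_⟩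
    have e : ((T.symm.trans J).trans T) '' (T '' U) = T '' (J '' U) := by
      simp only [image_image]
      exact image_congr fun z _ => by simp
    rw [e, hJ, himg]
    simp [image_image]

theorem exists_cutoff {K L : Set ℂ} (hK : IsCompact K) (hL : IsClosed L) (hd : Disjoint K L) :
    ∃ χ : ℂ → ℝ, ContDiff ℝ 1 χ ∧ (∀ x ∈ K, ∀ᶠ z in 𝓝 x, χ z = 1) ∧
      (∀ x ∈ L, ∀ᶠ z in 𝓝 x, χ z = 0) ∧ ∃ C, ∀ z, ‖fderiv ℝ χ z‖ ≤ C := by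
  obtain ⟨R, hR⟩ := hK.isBounded.subset_ball (0:ℂ)
  have hcl : IsClosed (L ∪ (ball (0:ℂ) R)ᶜ) := hL.union isOpen_ball.isClosed_compl
  obtain ⟨χ, c0, c1, -⟩ := exists_contMDiffMap_zero_one_nhds_of_isClosed (n := 1)
    (modelWithCornersSelf ℝ ℂ) hcl hK.isClosed (by
      rw [disjoint_union_left]
      exact ⟨hd.symm, disjoint_left.2 fun x hx hxK => hx (hR hxK)⟩)
  have hχ : ContDiff ℝ 1 χ := χ.contMDiff.contDiff
  refine ⟨χ, hχ, fun x hx => c1.filter_mono (nhds_le_nhdsSet hx),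
    fun x hx => c0.filter_mono (nhds_le_nhdsSet (mem_union_left _ hx)), ?_⟩
  have hsupp : HasCompactSupport (fderiv ℝ χ) := by
    refine HasCompactSupport.intro (isCompact_closedBall (0:ℂ) R) fun x hx => ?_
    have : ∀ᶠ z in 𝓝 x, χ z = 0 := c0.filter_mono (nhds_le_nhdsSet
      (mem_union_right L (show x ∈ (ball (0:ℂ) R)ᶜ from
        fun h => hx (ball_subset_closedBall h))))
    rw [Filter.EventuallyEq.fderiv_eq (f := fun _ => (0:ℝ)) this]
    simp
  exact (hχ.continuous_fderiv one_ne_zero).bounded_above_of_compact_support hsupp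

/-- The two-sided part of the boundary. -/
def innerBdry (U : Set ℂ) : Set ℂ := frontier U ∩ interior (closure U)

/-- The one-sided part of the boundary. -/
def outerBdry (U : Set ℂ) : Set ℂ := frontier U \ interior (closure U)

theorem innerBdry_image (Φ : ℂ ≃ₜ ℂ) (U : Set ℂ) : innerBdry (Φ '' U) = Φ '' innerBdry U := by
  simp only [innerBdry, ← Φ.image_frontier, ← Φ.image_closure, ← Φ.image_interior,
    image_inter Φ.injective]

theorem outerBdry_image (Φ : ℂ ≃ₜ ℂ) (U : Set ℂ) : outerBdry (Φ '' U) = Φ '' outerBdry U := by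
  simp only [outerBdry, ← Φ.image_frontier, ← Φ.image_closure, ← Φ.image_interior,
    image_sdiff Φ.injective]

theorem LocalGraph.subset_closure {κ a : ℝ} {V : Set ℂ} {g : ℝ → ℝ} (h : LocalGraph κ V g a)
    (hb : ∀ z : ℂ, |z.re| < a → |z.im| < a → z.im < g z.re → z ∈ V) :
    {z : ℂ | |z.re| < a ∧ |z.im| < a} ⊆ closure V := by
  rintro z ⟨z1, z2⟩
  rcases lt_trichotomy z.im (g z.re) with h' | h' | h'
  · exact _root_.subset_closure (hb z z1 z2 h')
  · exact frontier_subset_closure ((h.frontier_iff z z1 z2).2 h')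
  · exact _root_.subset_closure (h.above z z1 z2 h')

theorem isOpen_square (a : ℝ) : IsOpen {z : ℂ | |z.re| < a ∧ |z.im| < a} :=
  (isOpen_lt (f := fun z : ℂ => |z.re|) (g := fun _ => a) (by fun_prop) (by fun_prop)).inter
    (isOpen_lt (f := fun z : ℂ => |z.im|) (g := fun _ => a) (by fun_prop) (by fun_prop))

theorem isClosed_innerBdry {U : Set ℂ} (hU : IsOpen U) (hb : HasSmoothBdry Z U) :
    IsClosed (innerBdry U) := by
  refine isClosed_of_closure_subset fun y hy => ?_
  have hyf : y ∈ frontier U := closure_minimal inter_subset_left isClosed_frontier hy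
  obtain ⟨T, g, a, hT, h⟩ := exists_localGraph hU hb hyf (κ := 1/2) (by norm_num) (by norm_num)
  have hT0 : (0:ℂ) ∈ closure (innerBdry (T '' U)) := by
    have := innerBdry_image T.toHomeomorph U
    rw [show innerBdry (T '' U) = T '' innerBdry U from this, ← hT]
    exact mem_closure_image T.continuous.continuousAt hy
  have ha := h.pos
  set Q := {z : ℂ | |z.re| < a ∧ |z.im| < a} with hQ
  have h0Q : (0:ℂ) ∈ Q := by simp [hQ, ha]
  have hin : (0:ℂ) ∈ interior (closure (T '' U)) := by
    rcases h.below with hbl | hbl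
    · exact mem_interior.2 ⟨Q, h.subset_closure hbl, isOpen_square a, h0Q⟩
    · exfalso
      obtain ⟨z, hzQ, hz1, hz2⟩ := mem_closure_iff.1 hT0 Q (isOpen_square a) h0Q
      have hzg := (h.frontier_iff z hzQ.1 hzQ.2).1 hz1
      have hcont : Tendsto (fun t : ℝ => z - (t : ℂ) * Complex.I) (𝓝[>] 0) (𝓝 z) := by
        have : Continuous fun t : ℝ => z - (t : ℂ) * Complex.I := by fun_prop
        have := (this.tendsto 0).mono_left (nhdsWithin_le_nhds (s := Ioi 0))
        simpa using this
      have ev1 := hcont.eventually (isOpen_interior.mem_nhds hz2)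
      have ev2 := hcont.eventually ((isOpen_square a).mem_nhds hzQ)
      have ev3 : ∀ᶠ t : ℝ in 𝓝[>] 0, 0 < t := eventually_mem_nhdsWithin
      obtain ⟨t, t1, t2, t3⟩ := (ev1.and (ev2.and ev3)).exists
      have hlt : (z - (t : ℂ) * Complex.I).im < g (z - (t : ℂ) * Complex.I).re := by
        simp [← hzg, t3]
      have hnV := hbl _ t2.1 t2.2 hlt
      have hnF : z - (t : ℂ) * Complex.I ∉ frontier (T '' U) := fun hf =>
        hlt.ne ((h.frontier_iff _ t2.1 t2.2).1 hf)
      have := interior_subset t1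
      rw [closure_eq_self_union_frontier] at this
      exact this.elim hnV hnF
  refine ⟨hyf, ?_⟩
  have h1 : interior (closure (T '' U)) = T '' interior (closure U) := by
    have := T.toHomeomorph.image_interior (closure U)
    rw [T.toHomeomorph.image_closure] at this
    exact this.symm
  rw [h1, ← hT] at hin
  obtain ⟨w, hw, hwy⟩ := hin
  rwa [← T.injective hwy]

theorem hasDeformation_of_innerBdry {U : Set ℂ} (hU : IsOpen U) (hne : U.Nonempty)
    (hbd : Bornology.IsBounded U) (hb : HasSmoothBdry Z U) (hin : (innerBdry U).Nonempty) :
    HasDeformation U := by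
  have hFc : IsCompact (frontier U) :=
    hbd.isCompact_closure.of_isClosed_subset isClosed_frontier frontier_subset_closure
  have hIc : IsCompact (innerBdry U) :=
    hFc.of_isClosed_subset (isClosed_innerBdry hU hb) inter_subset_left
  have hOc : IsCompact (outerBdry U) :=
    hFc.of_isClosed_subset (isClosed_frontier.sdiff isOpen_interior) sdiff_subset
  have hdisj : Disjoint (innerBdry U) (outerBdry U) :=
    disjoint_left.2 fun x hx hx' => hx'.2 hx.2
  have hOne : (outerBdry U).Nonempty := by
    have hne' : closure U ≠ univ := fun h => by
      have := hbd.isCompact_closure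
      rw [h] at this
      exact noncompact_univ ℂ this
    obtain ⟨x, hx⟩ := nonempty_frontier_iff.2 ⟨hne.closure, hne'⟩
    refine ⟨x, frontier_closure_subset hx, ?_⟩
    rw [frontier, closure_closure] at hx
    exact hx.2
  obtain ⟨⟨p, q⟩, ⟨hp, hq⟩, hmin⟩ := (hIc.prod hOc).exists_isMinOn (hin.prod hOne)
    (continuous_dist.continuousOn (s := innerBdry U ×ˢ outerBdry U))
  have hpq : 0 < dist p q := dist_pos.2 fun h => hdisj.ne_of_mem hp hq h
  obtain ⟨χ, hχ, hχ1, hχ0, C, hC⟩ := exists_cutoff hIc hOc.isClosed hdisj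
  have hC0 : 0 ≤ C := (norm_nonneg _).trans (hC 0)
  set w := q - p with hw
  have hwn : ‖w‖ = dist p q := by rw [hw, dist_comm, dist_eq_norm]
  set ε : ℝ := 1 / (2 * (1 + C * ‖w‖)) with hε
  have hε0 : 0 < ε := by positivity
  have hε1 : ε * (C * ‖w‖) ≤ 1 / 2 := by
    rw [hε, div_mul_eq_mul_div, div_le_div_iff₀ (by positivity) (by norm_num)]
    nlinarith [mul_nonneg hC0 (norm_nonneg w)]
  have hε2 : ε ≤ 1 / 2 := by
    rw [hε, div_le_div_iff₀ (by positivity) (by norm_num)]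
    nlinarith [mul_nonneg hC0 (norm_nonneg w)]
  have hN : ContDiff ℝ 1 fun z => χ z • (ε • w) := hχ.smul contDiff_const
  obtain ⟨Φ, hΦ, hΦ1, hΦ2⟩ := exists_diffeo_of_perturbation hN fun z => by
    have : HasFDerivAt (fun z => χ z • (ε • w)) ((fderiv ℝ χ z).smulRight (ε • w)) z :=
      (((hχ.differentiable one_ne_zero) z).hasFDerivAt).smul_const _
    rw [this.fderiv, ContinuousLinearMap.norm_smulRight_apply, norm_smul, Real.norm_eq_abs,
      abs_of_pos hε0]
    calc _ ≤ C * (ε * ‖w‖) := by gcongr; exact hC z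
      _ ≤ _ := by linarith
  refine ⟨Φ, hΦ1, hΦ2, fun y hy => ?_, ?_⟩
  · by_cases hyi : y ∈ interior (closure U)
    · obtain ⟨s, hs, hball⟩ := Metric.eventually_nhds_iff_ball.1 (hχ1 y ⟨hy, hyi⟩)
      have hT : ∀ z ∈ ball y s, Φ z = IsometryEquiv.addRight (ε • w) z := fun z hz => by
        rw [hΦ, hball z hz]; simp
      refine preservesNear_of_isometry (IsometryEquiv.addRight (ε • w)) hs
        (fun z hz hzU => ⟨z, hzU, hT z hz⟩) (fun z hz hzV => ?_) hT
      set T := IsometryEquiv.addRight (ε • w) with hTd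
      obtain ⟨u, hu, rfl⟩ := hzV
      have h1 : T.symm (Φ u) ∈ ball y s := by
        rw [mem_ball, ← T.dist_eq]; simpa using hz
      have h2 := hT _ h1
      rw [T.apply_symm_apply] at h2
      rwa [Φ.injective h2]
    · obtain ⟨s, hs, hball⟩ := Metric.eventually_nhds_iff_ball.1 (hχ0 y ⟨hy, hyi⟩)
      have hT : ∀ z ∈ ball y s, Φ z = IsometryEquiv.refl ℂ z := fun z hz => by
        rw [hΦ, hball z hz, zero_smul, add_zero]; rfl
      refine preservesNear_of_isometry (IsometryEquiv.refl ℂ) hs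
        (fun z hz hzU => ⟨z, hzU, hT z hz⟩) (fun z hz hzV => ?_) hT
      obtain ⟨u, hu, rfl⟩ := hzV
      have h2 := hT _ hz
      change Φ (Φ u) = Φ u at h2
      change Φ u ∈ U
      rwa [Φ.injective h2]
  · rintro ⟨J, hJ⟩
    have e1 : J '' innerBdry U = Φ '' innerBdry U := by
      rw [← innerBdry_image, ← hJ]; exact (innerBdry_image J.toHomeomorph U).symm
    have e2 : J '' outerBdry U = Φ '' outerBdry U := by
      rw [← outerBdry_image, ← hJ]; exact (outerBdry_image J.toHomeomorph U).symm
    have hp' : Φ p ∈ J '' innerBdry U := e1 ▸ mem_image_of_mem _ hp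
    have hq' : Φ q ∈ J '' outerBdry U := e2 ▸ mem_image_of_mem _ hq
    obtain ⟨p', hp1, hp2⟩ := hp'
    obtain ⟨q', hq1, hq2⟩ := hq'
    have hle : dist p q ≤ dist p' q' := hmin (show (p', q') ∈ _ from ⟨hp1, hq1⟩)
    rw [← J.dist_eq p' q', hp2, hq2, hΦ, hΦ, (hχ1 p hp).self_of_nhds, (hχ0 q hq).self_of_nhds,
      dist_eq_norm (p + _)] at hle
    have : p + (1:ℝ) • ε • w - (q + (0:ℝ) • ε • w) = (ε - 1) • w := by
      rw [hw]; simp only [one_smul, zero_smul]; module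
    rw [this, norm_smul, hwn, Real.norm_eq_abs, abs_of_nonpos (by linarith)] at hle
    nlinarith

end Deformation

section LocalConvexity

/-- A segment in the closure of a locally convex open set, with endpoints in the set, lies in the
set. -/
theorem segment_subset_of_locally_convex {U : Set ℂ} (hU : IsOpen U)
    (h : ∀ q ∈ frontier U, ∃ r > 0, Convex ℝ (U ∩ ball q r)) {x y : ℂ} (hx : x ∈ U) (hy : y ∈ U)
    (hcl : segment ℝ x y ⊆ closure U) : segment ℝ x y ⊆ U := by
  set z : ℝ → ℂ := fun t => AffineMap.lineMap x y t with hz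
  have hzc : Continuous z := AffineMap.lineMap_continuous
  set F : Set ℝ := Icc 0 1 ∩ z ⁻¹' (frontier U) with hF
  have hseg : segment ℝ x y = z '' Icc 0 1 := segment_eq_image_lineMap ℝ x y
  have hmem : ∀ t ∈ Icc (0:ℝ) 1, t ∉ F → z t ∈ U := fun t ht htF => by
    have h1 : z t ∈ closure U := hcl (hseg ▸ mem_image_of_mem _ ht)
    rw [closure_eq_self_union_frontier] at h1
    exact h1.resolve_right fun hf => htF ⟨ht, hf⟩
  rcases F.eq_empty_or_nonempty with hE | hne
  · rw [hseg]
    rintro _ ⟨t, ht, rfl⟩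
    exact hmem t ht (by simp [hE])
  exfalso
  have hFc : IsCompact F := isCompact_Icc.inter_right (isClosed_frontier.preimage hzc)
  obtain ⟨t, ⟨ht, htf⟩, hmin⟩ := hFc.exists_isLeast hne
  have hnU : z t ∉ U := fun hu => (hU.frontier_eq ▸ htf : z t ∈ closure U \ U).2 hu
  have ht0 : 0 < t := lt_of_le_of_ne ht.1 fun h0 => hnU (by simpa [← h0, hz] using hx)
  have ht1 : t < 1 := lt_of_le_of_ne ht.2 fun h1 => hnU (by simpa [h1, hz] using hy)
  obtain ⟨r, hr, hconv⟩ := h _ htf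
  obtain ⟨f, hf⟩ := geometric_hahn_banach_open_point hconv (hU.inter isOpen_ball)
    (fun hu => hnU hu.1)
  have hfle : ∀ w ∈ closure U, w ∈ ball (z t) r → f w ≤ f (z t) := fun w hw hwb => by
    have h1 : w ∈ closure (U ∩ ball (z t) r) := by
      rw [inter_comm]; exact isOpen_ball.inter_closure ⟨hwb, hw⟩
    exact closure_minimal (fun u hu => (hf u hu).le) (isClosed_le f.continuous continuous_const) h1
  have hball : ∀ᶠ s in 𝓝 (0:ℝ), z (t + s) ∈ ball (z t) r ∧ z (t - s) ∈ ball (z t) r := by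
    have c1 : Tendsto (fun s => z (t + s)) (𝓝 0) (𝓝 (z t)) := by
      have : Continuous fun s => z (t + s) := by fun_prop
      simpa using this.tendsto 0
    have c2 : Tendsto (fun s => z (t - s)) (𝓝 0) (𝓝 (z t)) := by
      have : Continuous fun s => z (t - s) := by fun_prop
      simpa using this.tendsto 0
    exact (c1.eventually (ball_mem_nhds _ hr)).and (c2.eventually (ball_mem_nhds _ hr))
  have hsm : ∀ᶠ s in 𝓝 (0:ℝ), s < min t (1 - t) := gt_mem_nhds (lt_min ht0 (by linarith))
  have hpos : ∀ᶠ s in 𝓝[>] (0:ℝ), 0 < s := eventually_mem_nhdsWithin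
  obtain ⟨s, ⟨⟨hb1, hb2⟩, hs⟩, hs0⟩ :=
    (((hball.and hsm).filter_mono (nhdsWithin_le_nhds (s := Ioi 0))).and hpos).exists
  have hs1 := hs.trans_le (min_le_left _ _)
  have hs2 := hs.trans_le (min_le_right _ _)
  have k1 : f (z (t - s)) < f (z t) := by
    refine hf _ ⟨hmem _ ⟨by linarith, by linarith⟩ fun hF' => ?_, hb2⟩
    have := hmin hF'
    linarith
  have k2 : f (z (t + s)) ≤ f (z t) :=
    hfle _ (hcl (hseg ▸ mem_image_of_mem _ ⟨by linarith, by linarith⟩)) hb1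
  have k3 : f (z (t + s)) + f (z (t - s)) = 2 * f (z t) := by
    rw [← map_add, ← smul_eq_mul, ← map_smul]
    congr 1
    simp only [hz, AffineMap.lineMap_apply_module']
    module
  linarith

/-- A connected open set whose boundary is locally convex is convex. -/
theorem convex_of_locally_convex {U : Set ℂ} (hU : IsOpen U) (hc : IsPreconnected U)
    (h : ∀ q ∈ frontier U, ∃ r > 0, Convex ℝ (U ∩ ball q r)) : Convex ℝ U := by
  refine convex_iff_segment_subset.2 fun x hx => ?_
  set S := {y | segment ℝ x y ⊆ U} with hS
  have hzero : ∀ {y y' : ℂ} {t : ℝ}, t ∈ Icc (0:ℝ) 1 →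
      dist (AffineMap.lineMap x y t : ℂ) (AffineMap.lineMap x y' t) ≤ dist y y' := by
    intro y y' t ht
    rw [dist_eq_norm, dist_eq_norm]
    have : (AffineMap.lineMap x y t : ℂ) - AffineMap.lineMap x y' t = t • (y - y') := by
      simp only [AffineMap.lineMap_apply_module']
      module
    rw [this, norm_smul, Real.norm_eq_abs, abs_of_nonneg ht.1]
    exact mul_le_of_le_one_left (norm_nonneg _) ht.2
  have hSo : IsOpen S := by
    rw [Metric.isOpen_iff]
    intro y hy
    have hK : IsCompact (segment ℝ x y) := by
      rw [segment_eq_image_lineMap]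
      exact isCompact_Icc.image AffineMap.lineMap_continuous
    obtain ⟨δ, hδ, hth⟩ := hK.exists_thickening_subset_open hU hy
    refine ⟨δ, hδ, fun y' hy' => ?_⟩
    rw [hS, mem_ofPred_eq, segment_eq_image_lineMap]
    rintro _ ⟨t, ht, rfl⟩
    refine hth (mem_thickening_iff.2 ⟨AffineMap.lineMap x y t, ?_, ?_⟩)
    · rw [segment_eq_image_lineMap]; exact mem_image_of_mem _ ht
    · exact (hzero ht).trans_lt hy'
  have hsub : U ⊆ S := by
    refine hc.subset_of_closure_inter_subset hSo ⟨x, hx, by simpa [hS] using hx⟩ ?_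
    rintro y ⟨hyS, hyU⟩
    refine segment_subset_of_locally_convex hU h hx hyU ?_
    rw [segment_eq_image_lineMap]
    rintro _ ⟨t, ht, rfl⟩
    refine Metric.mem_closure_iff.2 fun ε hε => ?_
    obtain ⟨y', hy', hd⟩ := Metric.mem_closure_iff.1 hyS ε hε
    refine ⟨AffineMap.lineMap x y' t, hy' ?_, (hzero ht).trans_lt hd⟩
    rw [segment_eq_image_lineMap]; exact mem_image_of_mem _ ht
  exact fun y hy => hsub hy

end LocalConvexity

section Envelope

/-- A supporting line of slope `m` of the graph of `g` over `[x₀, x₁]`, minimal at `x` among the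
slopes in `[-κ, κ]`, touches the graph on both sides of `x`. -/
theorem exists_contact_of_minimal_slope {g : ℝ → ℝ} (hg : Continuous g) {κ x₀ x₁ x m c : ℝ}
    (hx : x ∈ Ioo x₀ x₁) (hm : m ∈ Icc (-κ) κ)
    (hκ : ∀ t ∈ Icc x₀ x₁, g t - κ * t ≤ g x₀ - κ * x₀)
    (hmin : ∀ m' ∈ Icc (-κ) κ, ∀ c', (∀ t ∈ Icc x₀ x₁, g t ≤ m' * t + c') → m * x + c ≤ m' * x + c')
    (hsup : ∀ t ∈ Icc x₀ x₁, g t ≤ m * t + c) :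
    ∃ a ∈ Icc x₀ x, g a = m * a + c := by
  by_contra! hcon
  have hlt : ∀ t ∈ Icc x₀ x, g t < m * t + c := fun t ht =>
    lt_of_le_of_ne (hsup t ⟨ht.1, ht.2.trans hx.2.le⟩) (hcon t ht)
  have hmκ : m < κ := by
    refine lt_of_le_of_ne hm.2 fun h => ?_
    have := hmin m hm (g x₀ - κ * x₀) fun t ht => by rw [h]; linarith [hκ t ht]
    have := hlt x₀ ⟨le_rfl, hx.1.le⟩
    rw [h] at *
    linarith
  -- a strip to the right of `x` is also free of contact
  have hdc : Continuous fun t => m * t + c - g t := by fun_prop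
  obtain ⟨d, hd, hd1, hfree⟩ : ∃ d > 0, x + d ≤ x₁ ∧ ∀ t ∈ Icc x₀ (x + d), g t < m * t + c := by
    have h1 : ∀ᶠ t in 𝓝 x, 0 < m * t + c - g t :=
      hdc.continuousAt.eventually (lt_mem_nhds (by linarith [hlt x ⟨hx.1.le, le_rfl⟩]))
    obtain ⟨r, hr, hb⟩ := Metric.eventually_nhds_iff.1 h1
    refine ⟨min (r / 2) (x₁ - x), lt_min (by linarith) (by linarith [hx.2]),
      by linarith [min_le_right (r/2) (x₁ - x)], fun t ht => ?_⟩
    by_cases htx : t ≤ x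
    · exact hlt t ⟨ht.1, htx⟩
    · have := @hb t (by
        rw [Real.dist_eq, abs_of_pos (by linarith)]
        linarith [ht.2, min_le_left (r/2) (x₁ - x)])
      linarith
  obtain ⟨s, hs, hsmin⟩ := (isCompact_Icc (a := x₀) (b := x + d)).exists_isMinOn
    ⟨x₀, le_rfl, by linarith [hx.1]⟩ hdc.continuousOn
  set η := m * s + c - g s with hη
  have hηpos : 0 < η := by linarith [hfree s hs]
  have hw : 0 < x₁ - x₀ := by linarith [hx.1, hx.2]
  set ε := min (κ - m) (η / (2 * (x₁ - x₀))) with hε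
  have hεpos : 0 < ε := lt_min (by linarith) (by positivity)
  have hεη : ε * (x₁ - x₀) ≤ η / 2 := by
    have : ε ≤ η / (2 * (x₁ - x₀)) := min_le_right _ _
    calc ε * (x₁ - x₀) ≤ η / (2 * (x₁ - x₀)) * (x₁ - x₀) := by gcongr
      _ = η / 2 := by field_simp
  set δ := min (ε * d) (η / 2) with hδ
  have hδpos : 0 < δ := lt_min (by positivity) (by positivity)
  have key := hmin (m + ε) ⟨by linarith [hm.1], by linarith [min_le_left (κ - m) (η / (2 * (x₁ - x₀)))]⟩
    (c - ε * x - δ) fun t ht => by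
      by_cases htd : t ≤ x + d
      · have h1 : η ≤ m * t + c - g t := hsmin ⟨ht.1, htd⟩
        have h2 : ε * (x - t) ≤ η / 2 := by
          refine le_trans ?_ hεη
          gcongr
          · exact hx.2.le
          · exact ht.1
        have h3 : δ ≤ η / 2 := min_le_right _ _
        linarith
      · have h1 := hsup t ht
        have h2 : ε * d ≤ ε * (t - x) := by
          gcongr
          linarith
        have h3 : δ ≤ ε * d := min_le_left _ _
        linarith
  linarith

/-- Supporting lines of the concave envelope. -/
theorem exists_envelope_lines {g : ℝ → ℝ} {κ : ℝ} (hg : ContDiff ℝ 1 g)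
    (hκ : ∀ t, |deriv g t| ≤ κ) {x₀ x₁ : ℝ} (h01 : x₀ < x₁) :
    ∃ G : ℝ → ℝ, Continuous G ∧ (∀ x ∈ Icc x₀ x₁, g x ≤ G x) ∧ G x₀ = g x₀ ∧ G x₁ = g x₁ ∧
      ∀ x ∈ Ioo x₀ x₁, ∃ m ∈ Icc (-κ) κ, ∃ c, m * x + c = G x ∧ (∀ t, G t ≤ m * t + c) ∧
        (∃ a ∈ Icc x₀ x, g a = m * a + c) ∧ ∃ b ∈ Icc x x₁, g b = m * b + c := by
  have hκ0 : 0 ≤ κ := (abs_nonneg _).trans (hκ 0)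
  have hlip := abs_sub_le_of_deriv_le hg hκ
  set H : ℝ → ℝ := fun m => sSup ((fun t => g t - m * t) '' Icc x₀ x₁) with hH
  have hgc := hg.continuous
  have hHc : Continuous H := by
    refine isCompact_Icc.continuous_sSup (f := fun m t => g t - m * t) ?_
    simp only [Function.HasUncurry.uncurry, id]
    fun_prop
  have hHle : ∀ m c, (∀ t ∈ Icc x₀ x₁, g t ≤ m * t + c) → H m ≤ c := fun m c h => by
    refine csSup_le ((nonempty_Icc.2 h01.le).image _) ?_
    rintro _ ⟨t, ht, rfl⟩
    have := h t ht
    show g t - m * t ≤ c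
    linarith
  have hleH : ∀ m, ∀ t ∈ Icc x₀ x₁, g t ≤ m * t + H m := fun m t ht => by
    have : g t - m * t ≤ H m := le_csSup
      ((isCompact_Icc.image (by fun_prop : Continuous fun t => g t - m * t)).bddAbove)
      (mem_image_of_mem _ ht)
    linarith
  set G : ℝ → ℝ := fun x => sInf ((fun m => m * x + H m) '' Icc (-κ) κ) with hG
  have hne : (Icc (-κ) κ).Nonempty := nonempty_Icc.2 (by linarith)
  have hGc : Continuous G := by
    refine isCompact_Icc.continuous_sInf (f := fun x m => m * x + H m) ?_
    simp only [Function.HasUncurry.uncurry, id]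
    fun_prop
  have hcont : ∀ x, Continuous fun m => m * x + H m := fun x => by fun_prop
  have hGle : ∀ x, ∀ m ∈ Icc (-κ) κ, G x ≤ m * x + H m := fun x m hm =>
    csInf_le (isCompact_Icc.image (hcont x)).bddBelow (mem_image_of_mem _ hm)
  have hgG : ∀ x ∈ Icc x₀ x₁, g x ≤ G x := fun x hx => by
    refine le_csInf (hne.image _) ?_
    rintro _ ⟨m, -, rfl⟩
    exact hleH m x hx
  have hk1 : ∀ t ∈ Icc x₀ x₁, g t - κ * t ≤ g x₀ - κ * x₀ := fun t ht => by
    have := (_root_.abs_le.1 (hlip t x₀)).2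
    rw [abs_of_nonneg (by linarith [ht.1])] at this
    linarith
  have hk2 : ∀ t ∈ Icc x₀ x₁, g t + κ * t ≤ g x₁ + κ * x₁ := fun t ht => by
    have := (_root_.abs_le.1 (hlip t x₁)).2
    rw [abs_sub_comm, abs_of_nonneg (by linarith [ht.2])] at this
    linarith
  refine ⟨G, hGc, hgG, le_antisymm ?_ (hgG _ ⟨le_rfl, h01.le⟩),
    le_antisymm ?_ (hgG _ ⟨h01.le, le_rfl⟩), fun x hx => ?_⟩
  · have h1 := hGle x₀ κ ⟨by linarith, le_rfl⟩
    have h2 := hHle κ (g x₀ - κ * x₀) fun t ht => by linarith [hk1 t ht]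
    linarith
  · have h1 := hGle x₁ (-κ) ⟨le_rfl, by linarith⟩
    have h2 := hHle (-κ) (g x₁ + κ * x₁) fun t ht => by linarith [hk2 t ht]
    linarith
  · obtain ⟨m, hm, hmin, -⟩ := isCompact_Icc.exists_sInf_image_eq_and_le hne (hcont x).continuousOn
    have hmG : m * x + H m = G x := hmin.symm
    have hminimal : ∀ m' ∈ Icc (-κ) κ, ∀ c', (∀ t ∈ Icc x₀ x₁, g t ≤ m' * t + c') →
        m * x + H m ≤ m' * x + c' := fun m' hm' c' hc' => by
      rw [hmG]
      linarith [hGle x m' hm', hHle m' c' hc']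
    refine ⟨m, hm, H m, hmG, fun t => hGle t m hm, ?_, ?_⟩
    · exact exists_contact_of_minimal_slope hgc hx hm hk1 hminimal (hleH m)
    · obtain ⟨a, ha, hga⟩ := exists_contact_of_minimal_slope (g := fun t => g (-t)) (x₀ := -x₁)
        (x₁ := -x₀) (x := -x) (m := -m) (c := H m) (κ := κ) (by fun_prop)
        ⟨by linarith [hx.2], by linarith [hx.1]⟩ ⟨by linarith [hm.2], by linarith [hm.1]⟩
        (fun t ht => by
          have := hk2 (-t) ⟨by linarith [ht.2], by linarith [ht.1]⟩
          rw [neg_neg]; linarith)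
        (fun m' hm' c' hc' => by
          have := hminimal (-m') ⟨by linarith [hm'.2], by linarith [hm'.1]⟩ c' fun t ht => by
            have := hc' (-t) ⟨by linarith [ht.2], by linarith [ht.1]⟩
            simp only [neg_neg] at this
            linarith
          linarith)
        (fun t ht => by
          have := hleH m (-t) ⟨by linarith [ht.2], by linarith [ht.1]⟩
          linarith)
      exact ⟨-a, ⟨by linarith [ha.2], by linarith [ha.1]⟩, by simpa using hga⟩

/-- The concave envelope of a `C¹` function that is not convex is a `C¹` function whose derivative
is antitone, locally constant off the contact set, and not constant. -/
theorem exists_concave_envelope {g : ℝ → ℝ} {κ : ℝ} (hg : ContDiff ℝ 1 g)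
    (hκ : ∀ t, |deriv g t| ≤ κ) {x₀ z x₁ : ℝ} (h0 : x₀ < z) (h1 : z < x₁)
    (hz : (g x₁ - g z) * (z - x₀) < (g z - g x₀) * (x₁ - z)) :
    ∃ (xL xR : ℝ) (G m : ℝ → ℝ), x₀ < xL ∧ xL < xR ∧ xR < x₁ ∧
      (∀ x ∈ Ioo x₀ x₁, HasDerivAt G (m x) x) ∧ (∀ x ∈ Ioo x₀ x₁, g x ≤ G x) ∧
      (∀ x ∈ Ioo x₀ x₁, |m x| ≤ κ) ∧
      AntitoneOn m (Ioo x₀ x₁) ∧ ContinuousOn m (Ioo x₀ x₁) ∧ m xR < m xL ∧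
      ∀ x ∈ Ioo x₀ x₁, ∀ x' ∈ Ioo x₀ x₁, x ≤ x' → (∀ t ∈ Icc x x', g t < G t) → m x = m x' := by
  obtain ⟨G, hGc, hgG, hG0, hG1, hlines⟩ := exists_envelope_lines hg hκ (h0.trans h1)
  choose! m hm c hmc hle hA hB using hlines
  choose! a ha hga using hA
  choose! b hb hgb using hB
  have hGa : ∀ x ∈ Ioo x₀ x₁, G (a x) = m x * a x + c x := fun x hx =>
    le_antisymm (hle x hx _) (hga x hx ▸ hgG _ ⟨(ha x hx).1, (ha x hx).2.trans hx.2.le⟩)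
  have hGb : ∀ x ∈ Ioo x₀ x₁, G (b x) = m x * b x + c x := fun x hx =>
    le_antisymm (hle x hx _) (hgb x hx ▸ hgG _ ⟨hx.1.le.trans (hb x hx).1, (hb x hx).2⟩)
  have hsupp : ∀ x ∈ Ioo x₀ x₁, ∀ t, G t ≤ G x + m x * (t - x) := fun x hx t => by
    have := hle x hx t
    have := hmc x hx
    linarith
  have hopen : IsOpen (Ioo x₀ x₁) := isOpen_Ioo
  -- the envelope is affine between the contact points
  have haff : ∀ x ∈ Ioo x₀ x₁, ∀ t ∈ Ioo (a x) (b x), G t = m x * t + c x := by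
    intro x hx t ht
    have htm : t ∈ Ioo x₀ x₁ := ⟨(ha x hx).1.trans_lt ht.1, ht.2.trans_le (hb x hx).2⟩
    refine le_antisymm (hle x hx t) ?_
    have e1 := hsupp t htm (a x)
    have e2 := hsupp t htm (b x)
    rw [hGa x hx] at e1
    rw [hGb x hx] at e2
    by_contra! hlt
    nlinarith [mul_pos (sub_pos.2 ht.1) (sub_pos.2 ht.2), mul_le_mul_of_nonneg_right e1
      (sub_pos.2 ht.2).le, mul_le_mul_of_nonneg_right e2 (sub_pos.2 ht.1).le,
      mul_lt_mul_of_pos_right hlt (sub_pos.2 (ht.1.trans ht.2))]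
  have hderiv : ∀ x ∈ Ioo x₀ x₁, HasDerivAt G (m x) x := by
    intro x hx
    have hline : HasDerivAt (fun t => m x * t + c x) (m x) x := by
      simpa using ((hasDerivAt_id x).const_mul (m x)).add_const (c x)
    by_cases hcon : g x = G x
    · have hgd : HasDerivAt g (deriv g x) x :=
        ((hg.differentiable one_ne_zero) x).hasDerivAt
      have hmax : IsLocalMax (fun t => g t - (m x * t + c x)) x := by
        filter_upwards [hopen.mem_nhds hx] with t ht
        have h1 := hle x hx t
        have h2 := hgG t ⟨ht.1.le, ht.2.le⟩
        have h3 := hmc x hx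
        linarith
      have hgm : deriv g x = m x := by
        have := hmax.hasDerivAt_eq_zero (hgd.sub hline)
        linarith
      rw [hgm] at hgd
      rw [hasDerivAt_iff_isLittleO] at hgd hline ⊢
      refine Asymptotics.IsLittleO.of_bound fun ε hε => ?_
      filter_upwards [hgd.bound hε, hopen.mem_nhds hx] with t h1 ht
      refine le_trans ?_ h1
      simp only [smul_eq_mul, Real.norm_eq_abs]
      have h1 := hsupp x hx t
      have h2 := hgG t ⟨ht.1.le, ht.2.le⟩
      rw [hcon, abs_of_nonpos (by linarith), abs_of_nonpos (by linarith)]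
      linarith
    · have hax : a x < x := lt_of_le_of_ne (ha x hx).2 fun h => hcon (by
        rw [← hmc x hx]; have := hga x hx; rwa [h] at this)
      have hbx : x < b x := lt_of_le_of_ne (hb x hx).1 fun h => hcon (by
        rw [← hmc x hx]; have := hgb x hx; rwa [← h] at this)
      refine hline.congr_of_eventuallyEq ?_
      filter_upwards [Ioo_mem_nhds hax hbx] with t ht
      exact haff x hx t ht
  have hanti : AntitoneOn m (Ioo x₀ x₁) := by
    intro x hx y hy hxy
    rcases hxy.eq_or_lt with rfl | hlt
    · exact le_rfl
    have e1 := hsupp x hx y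
    have e2 := hsupp y hy x
    nlinarith
  obtain ⟨xL, hxL, hdL⟩ := exists_hasDerivAt_eq_slope G m h0 hGc.continuousOn
    fun x hx => hderiv x ⟨hx.1, hx.2.trans h1⟩
  obtain ⟨xR, hxR, hdR⟩ := exists_hasDerivAt_eq_slope G m h1 hGc.continuousOn
    fun x hx => hderiv x ⟨h0.trans hx.1, hx.2⟩
  refine ⟨xL, xR, G, m, hxL.1, hxL.2.trans hxR.1, hxR.2, hderiv,
    fun x hx => hgG x ⟨hx.1.le, hx.2.le⟩, fun x hx => _root_.abs_le.2 (hm x hx), hanti, ?_, ?_, ?_⟩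
  · intro x hx
    refine ContinuousAt.continuousWithinAt ?_
    have hslope := (hasDerivAt_iff_tendsto_slope.1 (hderiv x hx))
    rw [ContinuousAt, tendsto_order]
    constructor
    · intro l hl
      have e1 : ∀ᶠ y in 𝓝[>] x, l < slope G x y ∧ y ∈ Ioo x₀ x₁ :=
        ((hslope.mono_left (nhdsWithin_mono _ fun y hy => ne_of_gt hy)).eventually
          (lt_mem_nhds hl)).and (mem_nhdsWithin_of_mem_nhds (hopen.mem_nhds hx))
      obtain ⟨y, ⟨hy1, hy2⟩, hy3⟩ := (e1.and eventually_mem_nhdsWithin).exists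
      have hxy : x < y := hy3
      have e2 : ∀ᶠ t in 𝓝 x, l < (G y - G t) / (y - t) := by
        have : ContinuousAt (fun t => (G y - G t) / (y - t)) x := by
          refine ContinuousAt.div (by fun_prop) (by fun_prop) (by linarith)
        refine this.eventually (lt_mem_nhds ?_)
        rwa [slope_def_field] at hy1
      filter_upwards [e2, hopen.mem_nhds hx, gt_mem_nhds hxy] with t ht1 ht2 ht3
      have := hsupp t ht2 y
      rw [lt_div_iff₀ (by linarith)] at ht1
      nlinarith
    · intro l hl
      have e1 : ∀ᶠ y in 𝓝[<] x, slope G x y < l ∧ y ∈ Ioo x₀ x₁ :=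
        ((hslope.mono_left (nhdsWithin_mono _ fun y hy => ne_of_lt hy)).eventually
          (gt_mem_nhds hl)).and (mem_nhdsWithin_of_mem_nhds (hopen.mem_nhds hx))
      obtain ⟨y, ⟨hy1, hy2⟩, hy3⟩ := (e1.and eventually_mem_nhdsWithin).exists
      have hxy : y < x := hy3
      have e2 : ∀ᶠ t in 𝓝 x, (G t - G y) / (t - y) < l := by
        have : ContinuousAt (fun t => (G t - G y) / (t - y)) x := by
          refine ContinuousAt.div (by fun_prop) (by fun_prop) (by linarith)
        refine this.eventually (gt_mem_nhds ?_)
        rw [slope_comm, slope_def_field] at hy1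
        exact hy1
      filter_upwards [e2, hopen.mem_nhds hx, lt_mem_nhds hxy] with t ht1 ht2 ht3
      have := hsupp t ht2 y
      rw [div_lt_iff₀ (by linarith)] at ht1
      nlinarith
  · rw [hdL, hdR, div_lt_div_iff₀ (by linarith) (by linarith), hG0, hG1]
    have := hgG z ⟨h0.le, h1.le⟩
    nlinarith
  · intro x hx x' hx' hxx hfree
    have hax : a x < x := lt_of_le_of_ne (ha x hx).2 fun h => by
      have e := hfree x ⟨le_rfl, hxx⟩
      have := hga x hx
      rw [h] at this
      linarith [hmc x hx]
    have hbx : x' < b x := by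
      by_contra! hcon
      have e := hfree (b x) ⟨(hb x hx).1, hcon⟩
      linarith [hgb x hx, hGb x hx]
    have e1 : HasDerivAt (fun t => m x * t + c x) (m x) x' := by
      simpa using ((hasDerivAt_id x').const_mul (m x)).add_const (c x)
    have e2 : HasDerivAt G (m x) x' := by
      refine e1.congr_of_eventuallyEq ?_
      filter_upwards [Ioo_mem_nhds (hax.trans_le hxx) hbx] with t ht
      exact haff x hx t ht
    exact e2.unique (hderiv x' hx')

end Envelope

section Projection

/-- Nearest-point projection onto a nonempty closed convex set. -/
theorem exists_nearest_projection {C : Set ℂ} (hne : C.Nonempty) (hcl : IsClosed C)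
    (hc : Convex ℝ C) : ∃ π : ℂ → ℂ, (∀ p, π p ∈ C) ∧ (∀ p, ∀ w ∈ C, ‖p - π p‖ ≤ ‖p - w‖) ∧
      ∀ p q, ‖π p - π q‖ ≤ ‖p - q‖ := by
  choose π hπ hmin using exists_norm_eq_iInf_of_complete_convex hne hcl.isComplete hc
  have hle : ∀ p, ∀ w ∈ C, inner ℝ (p - π p) (w - π p) ≤ 0 := fun p =>
    (norm_eq_iInf_iff_real_inner_le_zero hc (hπ p)).1 (hmin p)
  refine ⟨π, hπ, fun p w hw => ?_, fun p q => ?_⟩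
  · rw [hmin p]
    exact ciInf_le ⟨0, by rintro _ ⟨w, rfl⟩; exact norm_nonneg _⟩ (⟨w, hw⟩ : C)
  · have h1 := hle p _ (hπ q)
    have h2 := hle q _ (hπ p)
    have h3 : ‖π p - π q‖ ^ 2 ≤ inner ℝ (p - q) (π p - π q) := by
      rw [← real_inner_self_eq_norm_sq]
      have e : inner ℝ (p - q) (π p - π q) - inner ℝ (π p - π q) (π p - π q) =
          -inner ℝ (p - π p) (π q - π p) - inner ℝ (q - π q) (π p - π q) := by
        rw [show π q - π p = -(π p - π q) by ring, inner_neg_right, neg_neg, ← inner_sub_left,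
          ← inner_sub_left]
        congr 1
        ring
      linarith
    have h4 := real_inner_le_norm (p - q) (π p - π q)
    by_contra! hlt
    nlinarith [norm_nonneg (p - q), norm_nonneg (π p - π q)]

end Projection

section Rotation

/-- The unit complex number of argument `θ`. -/
def rot (θ : ℝ) : ℂ := Complex.exp (θ * Complex.I)

theorem norm_rot (θ : ℝ) : ‖rot θ‖ = 1 := Complex.norm_exp_ofReal_mul_I θ

theorem rot_re (θ : ℝ) : (rot θ).re = Real.cos θ := Complex.exp_ofReal_mul_I_re θ

theorem rot_im (θ : ℝ) : (rot θ).im = Real.sin θ := Complex.exp_ofReal_mul_I_im θ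

theorem rot_add (a b : ℝ) : rot (a + b) = rot a * rot b := by
  rw [rot, rot, rot, ← Complex.exp_add]; push_cast; ring_nf

theorem rot_zero : rot 0 = 1 := by simp [rot]

theorem hasDerivAt_rot (θ : ℝ) : HasDerivAt rot (rot θ * Complex.I) θ := by
  have h1 : HasDerivAt (fun t : ℝ => (t : ℂ) * Complex.I) Complex.I θ := by
    simpa using (Complex.ofRealCLM.hasDerivAt (x := θ)).mul_const Complex.I
  exact h1.cexp

theorem continuous_rot : Continuous rot :=
  continuous_iff_continuousAt.2 fun θ => (hasDerivAt_rot θ).continuousAt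

theorem norm_rot_sub_le (a b : ℝ) : ‖rot a - rot b‖ ≤ |a - b| := by
  have := Convex.norm_image_sub_le_of_norm_hasDerivWithin_le (f := rot) (s := univ) (C := 1)
    (x := b) (y := a) (fun x _ => (hasDerivAt_rot x).hasDerivWithinAt)
    (fun x _ => by rw [norm_mul, norm_rot, Complex.norm_I, one_mul]) convex_univ trivial trivial
  simpa using this

theorem rot_mul_conj (θ : ℝ) : rot θ * (starRingEnd ℂ) (rot θ) = 1 := by
  rw [Complex.mul_conj, Complex.normSq_eq_norm_sq, norm_rot]; simp

end Rotation

section BentCurve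

/-- A plane curve whose velocity is `1 + iσ` turned by the angle `α`, both small. -/
structure BentCurve (σ α : ℝ → ℝ) (c : ℝ → ℂ) : Prop where
  slope : ∀ x, |σ x| ≤ 1 / 10
  angle : ∀ x, |α x| ≤ 1 / 10
  deriv : ∀ x, HasDerivAt c (rot (α x) * (1 + σ x * Complex.I)) x

theorem norm_one_add_mul_I_le {s : ℝ} (hs : |s| ≤ 1 / 10) : ‖(1 : ℂ) + s * Complex.I‖ ≤ 11 / 10 := by
  refine (norm_add_le _ _).trans ?_
  rw [norm_mul, Complex.norm_I, Complex.norm_real, Real.norm_eq_abs, norm_one]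
  linarith

theorem velocity_bounds {a s : ℝ} (ha : |a| ≤ 1 / 10) (hs : |s| ≤ 1 / 10) :
    9 / 10 ≤ (rot a * (1 + s * Complex.I)).re ∧ |(rot a * (1 + s * Complex.I)).im| ≤ 1 / 4 ∧
      ‖rot a * (1 + s * Complex.I)‖ ≤ 6 / 5 := by
  have h1 : (rot a * (1 + s * Complex.I)).re = Real.cos a - Real.sin a * s := by
    simp [rot_re, rot_im]
  have h2 : (rot a * (1 + s * Complex.I)).im = Real.cos a * s + Real.sin a := by
    simp [rot_re, rot_im]
  have hcos := Real.one_sub_sq_div_two_le_cos (x := a)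
  have hcos1 := Real.cos_le_one a
  have hsin : |Real.sin a| ≤ 1 / 10 := Real.abs_sin_le_abs.trans ha
  have ha2 : a ^ 2 ≤ (1/10) ^ 2 := sq_le_sq' (by linarith [(_root_.abs_le.1 ha).1])
    (_root_.abs_le.1 ha).2
  have hss : |Real.sin a * s| ≤ 1 / 100 := by
    rw [abs_mul]
    nlinarith [abs_nonneg s, abs_nonneg (Real.sin a)]
  have hcs : |Real.cos a * s| ≤ 1 / 10 := by
    rw [abs_mul, abs_of_nonneg (by nlinarith : 0 ≤ Real.cos a)]
    nlinarith [abs_nonneg s]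
  refine ⟨?_, ?_, ?_⟩
  · rw [h1]
    linarith [(_root_.abs_le.1 hss).2]
  · rw [h2]
    refine (abs_add_le _ _).trans ?_
    linarith
  · rw [norm_mul, norm_rot, one_mul]
    linarith [norm_one_add_mul_I_le hs]

variable {σ α : ℝ → ℝ} {c : ℝ → ℂ}

theorem BentCurve.norm_sub_le (h : BentCurve σ α c) (x y : ℝ) : ‖c x - c y‖ ≤ 6 / 5 * |x - y| := by
  have := Convex.norm_image_sub_le_of_norm_hasDerivWithin_le (f := c) (s := univ) (C := 6/5)
    (x := y) (y := x) (fun x _ => (h.deriv x).hasDerivWithinAt)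
    (fun x _ => (velocity_bounds (h.angle x) (h.slope x)).2.2) convex_univ trivial trivial
  simpa using this

theorem BentCurve.hasDerivAt_re (h : BentCurve σ α c) (x : ℝ) :
    HasDerivAt (fun t => (c t).re) (rot (α x) * (1 + σ x * Complex.I)).re x :=
  Complex.reCLM.hasFDerivAt.comp_hasDerivAt x (h.deriv x)

theorem BentCurve.hasDerivAt_im (h : BentCurve σ α c) (x : ℝ) :
    HasDerivAt (fun t => (c t).im) (rot (α x) * (1 + σ x * Complex.I)).im x :=
  Complex.imCLM.hasFDerivAt.comp_hasDerivAt x (h.deriv x)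

theorem BentCurve.re_sub_ge (h : BentCurve σ α c) {x y : ℝ} (hxy : x ≤ y) :
    9 / 10 * (y - x) ≤ (c y).re - (c x).re :=
  mul_sub_le_image_sub_of_le_deriv (f := fun t => (c t).re)
    (fun t => (h.hasDerivAt_re t).differentiableAt)
    (fun t => by rw [(h.hasDerivAt_re t).deriv]; exact (velocity_bounds (h.angle t) (h.slope t)).1)
    hxy

theorem BentCurve.abs_re_sub_ge (h : BentCurve σ α c) (x y : ℝ) :
    9 / 10 * |y - x| ≤ |(c y).re - (c x).re| := by
  rcases le_total x y with hxy | hxy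
  · have := h.re_sub_ge hxy
    rw [abs_of_nonneg (by linarith : 0 ≤ y - x)]
    exact this.trans (le_abs_self _)
  · have := h.re_sub_ge hxy
    rw [abs_sub_comm, abs_of_nonneg (by linarith : 0 ≤ x - y), abs_sub_comm]
    exact this.trans (le_abs_self _)

theorem BentCurve.abs_im_sub_le (h : BentCurve σ α c) (x y : ℝ) :
    |(c x).im - (c y).im| ≤ 1 / 4 * |x - y| := by
  have := Convex.norm_image_sub_le_of_norm_hasDerivWithin_le (f := fun t => (c t).im) (s := univ)
    (C := 1/4) (x := y) (y := x) (fun x _ => (h.hasDerivAt_im x).hasDerivWithinAt)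
    (fun x _ => (velocity_bounds (h.angle x) (h.slope x)).2.1) convex_univ trivial trivial
  simpa using this

theorem BentCurve.continuous (h : BentCurve σ α c) : Continuous c :=
  continuous_iff_continuousAt.2 fun x => (h.deriv x).continuousAt

/-- A bent curve is a graph over the real axis: every abscissa is attained, at a parameter which is
a Lipschitz function of the abscissa. -/
theorem BentCurve.exists_param (h : BentCurve σ α c) : ∃ X : ℝ → ℝ, (∀ s, (c (X s)).re = s) ∧
    (∀ x, X (c x).re = x) ∧ ∀ s t, |X s - X t| ≤ 10 / 9 * |s - t| := by
  have hsurj : Function.Surjective fun t => (c t).re := by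
    refine (Complex.continuous_re.comp h.continuous).surjective ?_ ?_
    · refine tendsto_atTop_mono' (f₁ := fun t => (c 0).re + 9/10 * t) _ ?_ ?_
      · filter_upwards [eventually_ge_atTop 0] with t ht
        have := h.re_sub_ge ht
        simp only [Function.comp]
        linarith
      · exact tendsto_atTop_add_const_left _ _ (tendsto_id.const_mul_atTop (by norm_num))
    · refine tendsto_atBot_mono' (f₁ := fun t => (c 0).re + 9/10 * t) _ ?_ ?_
      · filter_upwards [eventually_le_atBot 0] with t ht
        have := h.re_sub_ge ht
        simp only [Function.comp]
        linarith
      · exact tendsto_atBot_add_const_left _ _ (tendsto_id.const_mul_atBot (by norm_num))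
  choose X hX using hsurj
  have hlip : ∀ s t, |X s - X t| ≤ 10 / 9 * |s - t| := fun s t => by
    have := h.abs_re_sub_ge (X t) (X s)
    have e1 : (c (X s)).re = s := hX s
    have e2 : (c (X t)).re = t := hX t
    rw [e1, e2] at this
    linarith
  refine ⟨X, hX, fun x => ?_, hlip⟩
  have := h.abs_re_sub_ge (X (c x).re) x
  have e1 : (c (X (c x).re)).re = (c x).re := hX _
  rw [e1, sub_self, abs_zero] at this
  have h0 : |x - X (c x).re| = 0 := le_antisymm (by linarith) (abs_nonneg _)
  linarith [abs_eq_zero.1 h0]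

/-- Height of a point above a curve, the curve being parametrised by `X` over the real axis. -/
def height (c : ℝ → ℂ) (X : ℝ → ℝ) (p : ℂ) : ℝ := p.im - (c (X p.re)).im

theorem eq_add_height {X : ℝ → ℝ} (hX : ∀ s, (c (X s)).re = s) (p : ℂ) :
    p = c (X p.re) + height c X p * Complex.I := by
  apply Complex.ext
  · simp [hX]
  · simp [height]

theorem BentCurve.abs_height_sub_le (h : BentCurve σ α c) {X : ℝ → ℝ}
    (hX : ∀ s t, |X s - X t| ≤ 10 / 9 * |s - t|) (p q : ℂ) :
    |height c X p - height c X q| ≤ 2 * ‖p - q‖ := by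
  have h1 := h.abs_im_sub_le (X p.re) (X q.re)
  have h2 := hX p.re q.re
  have h3 : |p.re - q.re| ≤ ‖p - q‖ := by simpa using Complex.abs_re_le_norm (p - q)
  have h4 : |p.im - q.im| ≤ ‖p - q‖ := by simpa using Complex.abs_im_le_norm (p - q)
  have e : height c X p - height c X q =
      (p.im - q.im) - ((c (X p.re)).im - (c (X q.re)).im) := by
    simp only [height]; ring
  rw [e]
  refine (abs_sub _ _).trans ?_
  linarith [norm_nonneg (p - q)]

theorem height_curve {X : ℝ → ℝ} (hX : ∀ x, X (c x).re = x) (x : ℝ) : height c X (c x) = 0 := by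
  simp [height, hX]

end BentCurve

section Transfer

variable {σ α β : ℝ → ℝ} {c cα cβ : ℝ → ℂ} {K : Set ℝ} {xL xR : ℝ}

theorem height_nonneg_of_cone (h : BentCurve σ α c) {X : ℝ → ℝ} (hXc : ∀ x, X (c x).re = x)
    (hX : ∀ s t, |X s - X t| ≤ 10 / 9 * |s - t|) (x : ℝ) {z : ℂ} (hz : |z.re| ≤ z.im) :
    0 ≤ height c X (c x + z) := by
  have h1 := h.abs_im_sub_le (X (c x + z).re) x
  have h2 := hX (c x + z).re (c x).re
  rw [hXc] at h2
  have h3 : (c x + z).re - (c x).re = z.re := by simp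
  rw [h3] at h2
  have h4 := (_root_.abs_le.1 h1).2
  have h5 : height c X (c x + z) = z.im - ((c (X (c x + z).re)).im - (c x).im) := by
    simp only [height, Complex.add_im]; ring
  have := abs_nonneg z.re
  rw [h5]
  linarith

/-- A nearest point to a point above a curve, in a set containing the curve, is not below the
curve. -/
theorem height_nearest_nonneg (h : BentCurve σ α c) {X : ℝ → ℝ}
    (hX : ∀ s t, |X s - X t| ≤ 10 / 9 * |s - t|) {C : Set ℂ} {p q : ℂ} (hp : 0 ≤ height c X p)
    (hq : ∀ w ∈ C, ‖p - q‖ ≤ ‖p - w‖) (hC : ∀ w ∈ segment ℝ p q, height c X w = 0 → w ∈ C) :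
    0 ≤ height c X q := by
  by_contra! hlt
  have hcont : Continuous (height c X) := by
    refine (LipschitzWith.of_dist_le_mul (K := 2) fun p q => ?_).continuous
    rw [Real.dist_eq, dist_eq_norm]
    exact h.abs_height_sub_le hX p q
  have hf : ContinuousOn (fun t : ℝ => height c X (AffineMap.lineMap p q t)) (Icc 0 1) :=
    (hcont.comp AffineMap.lineMap_continuous).continuousOn
  obtain ⟨t, ht, ht0⟩ := intermediate_value_Icc' zero_le_one hf
    (show (0:ℝ) ∈ Icc _ _ by simpa using ⟨hlt.le, hp⟩)
  have hw := hq _ (hC _ (segment_eq_image_lineMap ℝ p q ▸ mem_image_of_mem _ ht) ht0)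
  have e : p - AffineMap.lineMap p q t = t • (p - q) := by
    simp only [AffineMap.lineMap_apply_module']
    module
  rw [e, norm_smul, Real.norm_eq_abs, abs_of_nonneg ht.1] at hw
  have ht1 : t ≠ 1 := fun h1 => by
    simp only [h1, AffineMap.lineMap_apply_one] at ht0
    linarith
  have htlt : t < 1 := lt_of_le_of_ne ht.2 ht1
  have hpq : p - q ≠ 0 := fun h0 => by
    rw [sub_eq_zero.1 h0] at hp
    linarith
  nlinarith [norm_pos_iff.2 hpq]

/-- A bent curve lying below its tangents at the points of `K`, and bent rigidly off `K`. -/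
structure TightBend (σ : ℝ → ℝ) (K : Set ℝ) (xL xR : ℝ) (α : ℝ → ℝ) (c : ℝ → ℂ) : Prop
    extends BentCurve σ α c where
  unif : UniformContinuous α
  gap : ∀ x ∈ Icc xL xR, ∀ x' ∈ Icc xL xR, x ≤ x' → (∀ k ∈ K, k ∉ Icc x x') → α x = α x'
  supp : ∀ k ∈ K, ∀ x ∈ Icc xL xR,
    ((c x - c k) * (starRingEnd ℂ) (rot (α k) * (1 + σ k * Complex.I))).im ≤ 0

/-- The region below the tangents of a bent curve at the points of `K`. -/
def tangentHull (σ : ℝ → ℝ) (K : Set ℝ) (α : ℝ → ℝ) (c : ℝ → ℂ) : Set ℂ :=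
  {p | ∀ k ∈ K, ((p - c k) * (starRingEnd ℂ) (rot (α k) * (1 + σ k * Complex.I))).im ≤ 0}

theorem isClosed_tangentHull : IsClosed (tangentHull σ K α c) := by
  have : tangentHull σ K α c = ⋂ k ∈ K,
      {p | ((p - c k) * (starRingEnd ℂ) (rot (α k) * (1 + σ k * Complex.I))).im ≤ 0} := by
    ext p; simp [tangentHull]
  rw [this]
  refine isClosed_biInter fun k _ => isClosed_le ?_ continuous_const
  exact Complex.continuous_im.comp ((continuous_id.sub continuous_const).mul continuous_const)

theorem convex_tangentHull : Convex ℝ (tangentHull σ K α c) := by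
  intro p hp q hq a b ha hb hab k hk
  have h1 := hp k hk
  have h2 := hq k hk
  set τ := (starRingEnd ℂ) (rot (α k) * (1 + σ k * Complex.I))
  have e : (a • p + b • q - c k) * τ = a • ((p - c k) * τ) + b • ((q - c k) * τ) := by
    have : ((a:ℂ) + b) = 1 := by exact_mod_cast hab
    simp only [Complex.real_smul]
    linear_combination (c k * τ) * this
  rw [e, Complex.add_im, Complex.smul_im, Complex.smul_im, smul_eq_mul, smul_eq_mul]
  nlinarith

theorem TightBend.mem_tangentHull (h : TightBend σ K xL xR α c) {x : ℝ} (hx : x ∈ Icc xL xR) :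
    c x ∈ tangentHull σ K α c := fun k hk => h.supp k hk x hx

theorem BentCurve.height_le (h : BentCurve σ α c) {X : ℝ → ℝ} (hX : ∀ s, (c (X s)).re = s)
    {p : ℂ} (hp : p ∈ tangentHull σ K α c) {k : ℝ} (hk : k ∈ K) :
    height c X p ≤ 2 * |X p.re - k| := by
  have h1 := hp k hk
  set v := height c X p
  set w := rot (α k) * (1 + σ k * Complex.I)
  obtain ⟨b1, b2, b3⟩ := velocity_bounds (h.angle k) (h.slope k)
  have e : (p - c k) * (starRingEnd ℂ) w =
      (c (X p.re) - c k) * (starRingEnd ℂ) w + (v * Complex.I) * (starRingEnd ℂ) w := by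
    conv_lhs => rw [eq_add_height hX p]
    ring
  have e2 : ((v * Complex.I) * (starRingEnd ℂ) w).im = v * w.re := by simp
  rw [e, Complex.add_im, e2] at h1
  have h2 : |((c (X p.re) - c k) * (starRingEnd ℂ) w).im| ≤ 6/5 * |X p.re - k| * (6/5) := by
    refine (Complex.abs_im_le_norm _).trans ?_
    rw [norm_mul, RCLike.norm_conj]
    exact mul_le_mul (h.norm_sub_le _ _) b3 (norm_nonneg _) (by positivity)
  have h3 := (_root_.abs_le.1 h2).1
  have h4 : 0 ≤ |X p.re - k| := abs_nonneg _
  by_contra! hlt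
  nlinarith

/-- The map carrying one bent curve to another and rotating vertical segments accordingly. -/
def transfer (cα cβ : ℝ → ℂ) (α β X : ℝ → ℝ) (p : ℂ) : ℂ :=
  cβ (X p.re) + rot (β (X p.re) - α (X p.re)) * (height cα X p * Complex.I)

theorem norm_transfer_sub_le (hα : BentCurve σ α cα) (hβ : BentCurve σ β cβ) {X : ℝ → ℝ}
    (hX : ∀ s, (cα (X s)).re = s) {p q : ℂ} {ψ ω : ℝ}
    (hω : ∀ t ∈ uIcc (X p.re) (X q.re), |β t - α t - ψ| ≤ ω) (hp : 0 ≤ height cα X p)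
    (hq : 0 ≤ height cα X q) : ‖transfer cα cβ α β X p - transfer cα cβ α β X q‖ ≤
      ‖p - q‖ + ω * (11/10 * |X p.re - X q.re| + height cα X p + height cα X q) := by
  set x := X p.re with hx
  set y := X q.re with hy
  set v := height cα X p with hv
  set w := height cα X q with hw
  have hrot : ∀ t ∈ uIcc x y, ‖rot (β t - α t) - rot ψ‖ ≤ ω := fun t ht =>
    (norm_rot_sub_le _ _).trans (hω t ht)
  have hF : ‖(cβ x - rot ψ * cα x) - (cβ y - rot ψ * cα y)‖ ≤ ω * (11/10) * |x - y| := by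
    have := Convex.norm_image_sub_le_of_norm_hasDerivWithin_le
      (f := fun t => cβ t - rot ψ * cα t) (s := uIcc x y) (C := ω * (11/10)) (x := y) (y := x)
      (fun t _ => ((hβ.deriv t).sub ((hα.deriv t).const_mul (rot ψ))).hasDerivWithinAt)
      (fun t ht => ?_) (convex_uIcc x y) right_mem_uIcc left_mem_uIcc
    · simpa using this
    · have e : rot (β t) * (1 + σ t * Complex.I) - rot ψ * (rot (α t) * (1 + σ t * Complex.I)) =
          (rot (β t - α t) - rot ψ) * (rot (α t) * (1 + σ t * Complex.I)) := by
        have : rot (β t) = rot (β t - α t) * rot (α t) := by rw [← rot_add]; ring_nf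
        rw [this]; ring
      rw [e, norm_mul, norm_mul, norm_rot, one_mul]
      exact mul_le_mul (hrot t ht) (norm_one_add_mul_I_le (hα.slope t)) (norm_nonneg _)
        ((norm_nonneg _).trans (hrot t ht))
  have e : transfer cα cβ α β X p - transfer cα cβ α β X q =
      rot ψ * (p - q) + ((cβ x - rot ψ * cα x) - (cβ y - rot ψ * cα y)) +
        (rot (β x - α x) - rot ψ) * (v * Complex.I) -
        (rot (β y - α y) - rot ψ) * (w * Complex.I) := by
    conv_rhs => rw [eq_add_height hX p, eq_add_height hX q]
    simp only [transfer, ← hx, ← hy, ← hv, ← hw]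
    ring
  have n1 : ‖(rot (β x - α x) - rot ψ) * (v * Complex.I)‖ ≤ ω * v := by
    rw [norm_mul, norm_mul, Complex.norm_I, mul_one, Complex.norm_real, Real.norm_eq_abs,
      abs_of_nonneg hp]
    exact mul_le_mul_of_nonneg_right (hrot x left_mem_uIcc) hp
  have n2 : ‖(rot (β y - α y) - rot ψ) * (w * Complex.I)‖ ≤ ω * w := by
    rw [norm_mul, norm_mul, Complex.norm_I, mul_one, Complex.norm_real, Real.norm_eq_abs,
      abs_of_nonneg hq]
    exact mul_le_mul_of_nonneg_right (hrot y right_mem_uIcc) hq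
  have n3 : ‖rot ψ * (p - q)‖ = ‖p - q‖ := by rw [norm_mul, norm_rot, one_mul]
  rw [e]
  refine (_root_.norm_sub_le _ _).trans ?_
  have m1 := norm_add_le (rot ψ * (p - q) + ((cβ x - rot ψ * cα x) - (cβ y - rot ψ * cα y)))
    ((rot (β x - α x) - rot ψ) * (v * Complex.I))
  have m2 := norm_add_le (rot ψ * (p - q)) ((cβ x - rot ψ * cα x) - (cβ y - rot ψ * cα y))
  linarith

/-- Between the curve and its tangents the transfer map is infinitesimally nonexpanding. -/
theorem exists_transfer_bound (hα : TightBend σ K xL xR α cα) (hβ : TightBend σ K xL xR β cβ)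
    {X : ℝ → ℝ} (hX : ∀ s, (cα (X s)).re = s)
    (hXl : ∀ s t, |X s - X t| ≤ 10 / 9 * |s - t|) {η : ℝ} (hη : 0 < η) :
    ∃ ρ > 0, ∀ p ∈ tangentHull σ K α cα, ∀ q ∈ tangentHull σ K α cα, X p.re ∈ Icc xL xR →
      X q.re ∈ Icc xL xR → 0 ≤ height cα X p → 0 ≤ height cα X q → ‖p - q‖ < ρ →
      ‖transfer cα cβ α β X p - transfer cα cβ α β X q‖ ≤ (1 + η) * ‖p - q‖ := by
  have hu : UniformContinuous fun t => β t - α t := hβ.unif.sub hα.unif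
  obtain ⟨δ, hδ, hδu⟩ := Metric.uniformContinuous_iff.1 hu (η / 6) (by positivity)
  refine ⟨δ / 2, by positivity, ?_⟩
  have key : ∀ p ∈ tangentHull σ K α cα, ∀ q ∈ tangentHull σ K α cα, X p.re ∈ Icc xL xR →
      X q.re ∈ Icc xL xR → 0 ≤ height cα X p → 0 ≤ height cα X q → ‖p - q‖ < δ / 2 →
      X p.re ≤ X q.re →
      ‖transfer cα cβ α β X p - transfer cα cβ α β X q‖ ≤ (1 + η) * ‖p - q‖ := by
    intro p hp q hq hpI hqI hp0 hq0 hpq hle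
    have hxx : |X p.re - X q.re| ≤ 10 / 9 * ‖p - q‖ := by
      refine (hXl _ _).trans ?_
      gcongr
      simpa using Complex.abs_re_le_norm (p - q)
    by_cases hcon : ∃ k ∈ K, k ∈ Icc (X p.re) (X q.re)
    · obtain ⟨k, hk, hkI⟩ := hcon
      have habs : |X p.re - X q.re| = X q.re - X p.re := by
        rw [abs_sub_comm, abs_of_nonneg (by linarith)]
      have h1 := norm_transfer_sub_le hα.toBentCurve hβ.toBentCurve hX (p := p) (q := q)
        (ψ := β k - α k) (ω := η / 6) (fun t ht => by
          rw [uIcc_of_le hle] at ht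
          refine (hδu (a := t) (b := k) ?_).le
          rw [Real.dist_eq]
          refine (show |t - k| ≤ X q.re - X p.re from _root_.abs_le.2
            ⟨by linarith [ht.1, hkI.2], by linarith [ht.2, hkI.1]⟩).trans_lt ?_
          linarith) hp0 hq0
      have h2 := hα.height_le hX hp hk
      have h3 := hα.height_le hX hq hk
      rw [abs_of_nonpos (by linarith [hkI.1])] at h2
      rw [abs_of_nonneg (by linarith [hkI.2])] at h3
      refine h1.trans ?_
      have : η / 6 * (11/10 * |X p.re - X q.re| + height cα X p + height cα X q) ≤
          η / 6 * (6 * ‖p - q‖) := by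
        gcongr
        linarith [norm_nonneg (p - q)]
      linarith
    · push Not at hcon
      have h1 := norm_transfer_sub_le hα.toBentCurve hβ.toBentCurve hX (p := p) (q := q)
        (ψ := β (X p.re) - α (X p.re)) (ω := 0) (fun t ht => by
          rw [uIcc_of_le hle] at ht
          have htI : t ∈ Icc xL xR := ⟨hpI.1.trans ht.1, ht.2.trans hqI.2⟩
          have hno : ∀ k ∈ K, k ∉ Icc (X p.re) t := fun k hk hkt =>
            hcon k hk ⟨hkt.1, hkt.2.trans ht.2⟩
          rw [hα.gap _ hpI t htI ht.1 hno, hβ.gap _ hpI t htI ht.1 hno]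
          simp) hp0 hq0
      nlinarith [norm_nonneg (p - q)]
  intro p hp q hq hpI hqI hp0 hq0 hpq
  rcases le_total (X p.re) (X q.re) with hle | hle
  · exact key p hp q hq hpI hqI hp0 hq0 hpq hle
  · rw [norm_sub_rev, norm_sub_rev p q]
    exact key q hq p hp hqI hpI hq0 hp0 (by rwa [norm_sub_rev]) hle

theorem height_transfer_nonneg (hα : BentCurve σ α cα) (hβ : BentCurve σ β cβ) {X Y : ℝ → ℝ}
    (hY : ∀ x, Y (cβ x).re = x) (hYl : ∀ s t, |Y s - Y t| ≤ 10 / 9 * |s - t|) {p : ℂ}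
    (hp : 0 ≤ height cα X p) : 0 ≤ height cβ Y (transfer cα cβ α β X p) := by
  refine height_nonneg_of_cone hβ hY hYl _ ?_
  set ψ := β (X p.re) - α (X p.re) with hψ
  have h1 : |ψ| ≤ 1 / 5 := (abs_sub _ _).trans (by linarith [hα.angle (X p.re), hβ.angle (X p.re)])
  have h2 := Real.one_sub_sq_div_two_le_cos (x := ψ)
  have h3 : |Real.sin ψ| ≤ 1 / 5 := Real.abs_sin_le_abs.trans h1
  have h4 : ψ ^ 2 ≤ (1/5) ^ 2 := sq_le_sq' (by linarith [(_root_.abs_le.1 h1).1])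
    (_root_.abs_le.1 h1).2
  have e1 : (rot ψ * (height cα X p * Complex.I)).re = -(Real.sin ψ * height cα X p) := by
    simp [rot_im]
  have e2 : (rot ψ * (height cα X p * Complex.I)).im = Real.cos ψ * height cα X p := by
    simp [rot_re]
  rw [e1, e2, abs_neg, abs_mul, abs_of_nonneg hp]
  gcongr
  linarith

end Transfer

section Core

variable {σ α β : ℝ → ℝ} {c cα cβ : ℝ → ℂ} {K : Set ℝ} {xL xR : ℝ}

theorem near_param (h : BentCurve σ α c) {X : ℝ → ℝ} (hXc : ∀ x, X (c x).re = x)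
    (hX : ∀ s t, |X s - X t| ≤ 10 / 9 * |s - t|) (x : ℝ) (p : ℂ) :
    |X p.re - x| ≤ 10 / 9 * ‖p - c x‖ ∧ |height c X p| ≤ 2 * ‖p - c x‖ := by
  constructor
  · have := hX p.re (c x).re
    rw [hXc] at this
    refine this.trans ?_
    gcongr
    simpa using Complex.abs_re_le_norm (p - c x)
  · have := h.abs_height_sub_le hX p (c x)
    rwa [height_curve hXc, sub_zero] at this

theorem exists_fine_partition {γ : ℝ → ℂ} (hγ : Continuous γ) {ε : ℝ} (hε : 0 < ε) :
    ∃ (n : ℕ) (u : ℕ → ℝ), Monotone u ∧ (∀ i, u i ∈ Icc (0:ℝ) 1) ∧ u 0 = 0 ∧ u n = 1 ∧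
      ∀ i, ‖γ (u i) - γ (u (i+1))‖ < ε := by
  obtain ⟨δ, hδ, hδu⟩ := Metric.uniformContinuousOn_iff.1
    (isCompact_Icc.uniformContinuousOn_of_continuous hγ.continuousOn :
      UniformContinuousOn γ (Icc (0:ℝ) 1)) ε hε
  obtain ⟨n, hn⟩ := exists_nat_one_div_lt hδ
  have hN : (0:ℝ) < (n:ℝ) + 1 := by positivity
  set u : ℕ → ℝ := fun i => min ((i:ℝ) / (n + 1)) 1 with hu
  have hmem : ∀ i, u i ∈ Icc (0:ℝ) 1 := fun i =>
    ⟨le_min (by positivity) zero_le_one, min_le_right _ _⟩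
  refine ⟨n + 1, u, fun i j hij => ?_, hmem, by simp [hu], ?_, fun i => ?_⟩
  · have : (i:ℝ) ≤ j := by exact_mod_cast hij
    exact min_le_min (by gcongr) le_rfl
  · simp only [hu]
    push_cast
    rw [div_self hN.ne', min_self]
  · rw [← dist_eq_norm]
    refine hδu _ (hmem i) _ (hmem _) ?_
    rw [Real.dist_eq]
    refine lt_of_le_of_lt ?_ hn
    refine (abs_min_sub_min_le_max _ _ _ _).trans ?_
    rw [sub_self, abs_zero, max_eq_left (abs_nonneg _), ← sub_div, abs_div, abs_of_pos hN]
    simp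

/-- Boundary distances do not increase from one tight bending of a curve to another. -/
theorem bdryDist_le_of_tightBend (hα : TightBend σ K xL xR α cα) (hβ : TightBend σ K xL xR β cβ)
    {U V : Set ℂ} {x₀ r₀ : ℝ} (hx₀ : x₀ ∈ Ioo xL xR) (hr₀ : 0 < r₀)
    (hU : ∀ x ∈ Ioo xL xR, ∀ v : ℝ, |v| < r₀ → cα x + v * Complex.I ∈ U → 0 < v)
    (hV : ∀ x ∈ Ioo xL xR, ∀ v : ℝ, 0 < v → v < r₀ → cβ x + v * Complex.I ∈ V) :
    ∃ r > 0, ∀ a b, |a - x₀| < r → |b - x₀| < r →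
      bdryDist U (cα a) (cα b) < ENNReal.ofReal r →
      bdryDist V (cβ a) (cβ b) ≤ bdryDist U (cα a) (cα b) := by
  set d := min (x₀ - xL) (xR - x₀) with hd
  have hd0 : 0 < d := lt_min (by linarith [hx₀.1]) (by linarith [hx₀.2])
  have hdI : ∀ x, |x - x₀| < d → x ∈ Ioo xL xR := fun x hx => by
    have h1 := _root_.abs_lt.1 (hx.trans_le (min_le_left _ _))
    have h2 := _root_.abs_lt.1 (hx.trans_le (min_le_right _ _))
    exact ⟨by linarith [h1.1], by linarith [h2.2]⟩
  set r := min d r₀ / 100 with hr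
  have hr0 : 0 < r := by have := lt_min hd0 hr₀; positivity
  have hrd : 100 * r ≤ d := by rw [hr]; linarith [min_le_left d r₀]
  have hrr : 100 * r ≤ r₀ := by rw [hr]; linarith [min_le_right d r₀]
  refine ⟨r, hr0, fun a b ha hb hab => ?_⟩
  by_contra! hlt
  obtain ⟨l₁, hl₁0, hl₁, hl₁'⟩ := ENNReal.lt_iff_exists_real_btwn.1 (lt_min hlt hab)
  obtain ⟨l₂, hl₂0, hl₂, hl₂'⟩ := ENNReal.lt_iff_exists_real_btwn.1
    (hl₁'.trans_le (min_le_left _ _))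
  have hl₁r : l₁ < r := (ENNReal.ofReal_lt_ofReal_iff hr0).1 (hl₁'.trans_le (min_le_right _ _))
  have hl₁pos : 0 < l₁ := ENNReal.ofReal_pos.1 (bot_le.trans_lt hl₁)
  have hl₁₂ : l₁ < l₂ := (ENNReal.ofReal_lt_ofReal_iff_of_nonneg hl₁0).1 hl₂
  set η := l₂ / l₁ - 1 with hη
  have hη0 : 0 < η := by rw [hη, sub_pos, lt_div_iff₀ hl₁pos]; linarith
  have hηl : (1 + η) * l₁ = l₂ := by rw [hη]; field_simp; ring
  refine absurd (bdryDist_le_of_forall (L := ENNReal.ofReal l₂) fun ρ hρ => ?_) (not_le.2 hl₂')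
  obtain ⟨X, hX, hXc, hXl⟩ := hα.exists_param
  obtain ⟨Y, hY, hYc, hYl⟩ := hβ.exists_param
  obtain ⟨ρ₂, hρ₂, hM⟩ := exists_transfer_bound hα hβ hX hXl hη0
  set M := transfer cα cβ α β X with hMdef
  have haI : a ∈ Ioo xL xR := hdI a (by linarith)
  have hbI : b ∈ Ioo xL xR := hdI b (by linarith)
  obtain ⟨π, hπ, hπmin, hπlip⟩ := exists_nearest_projection
    ⟨cα x₀, hα.mem_tangentHull (Ioo_subset_Icc_self hx₀)⟩ isClosed_tangentHull convex_tangentHull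
    (C := tangentHull σ K α cα)
  have hπfix : ∀ w ∈ tangentHull σ K α cα, π w = w := fun w hw => by
    have := hπmin w w hw
    rw [sub_self, norm_zero] at this
    exact (sub_eq_zero.1 (norm_le_zero_iff.1 this)).symm
  set ρ₁ := min (min r (ρ₂ / 2)) (ρ / (4 * (1 + η))) with hρ₁
  have hρ₁0 : 0 < ρ₁ := by positivity
  have hρ₁r : ρ₁ ≤ r := (min_le_left _ _).trans (min_le_left _ _)
  have hρ₁ρ₂ : ρ₁ < ρ₂ := by
    linarith [(min_le_left _ _ : ρ₁ ≤ _).trans (min_le_right r (ρ₂ / 2))]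
  have hρ₁ρ : (1 + η) * ρ₁ ≤ ρ / 4 := by
    calc (1 + η) * ρ₁ ≤ (1 + η) * (ρ / (4 * (1 + η))) := by gcongr; exact min_le_right _ _
      _ = ρ / 4 := by field_simp
  have hρ₁ρ' : ρ₁ ≤ ρ / 4 := le_trans (by nlinarith) hρ₁ρ
  obtain ⟨a', ⟨ha'U, ha'⟩, b', ⟨hb'U, hb'⟩, hL⟩ := exists_pathInf_lt_of_bdryDist_lt hl₁ hρ₁0
  obtain ⟨γ, hγ, hγ0, hγ1, hγU, hγL⟩ := exists_path_of_pathInf_lt hL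
  rw [mem_ball, dist_eq_norm] at ha' hb'
  -- everything stays close to the base point
  have hγn : ∀ t ∈ Icc (0:ℝ) 1, ‖γ t - cα x₀‖ ≤ 4 * r := fun t ht => by
    have h1 : edist (γ t) (γ 0) < ENNReal.ofReal l₁ :=
      (eVariationOn.edist_le γ ht ⟨le_rfl, zero_le_one⟩).trans_lt hγL
    rw [edist_dist, ENNReal.ofReal_lt_ofReal_iff hl₁pos, hγ0, dist_eq_norm] at h1
    have h2 := hα.norm_sub_le a x₀
    have h3 := norm_add_le (γ t - a') (a' - cα a + (cα a - cα x₀))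
    have h4 := norm_add_le (a' - cα a) (cα a - cα x₀)
    have e : γ t - cα x₀ = γ t - a' + (a' - cα a + (cα a - cα x₀)) := by ring
    rw [e]
    linarith
  have hnear : ∀ p, ‖p - cα x₀‖ ≤ 4 * r → X p.re ∈ Ioo xL xR ∧ |height cα X p| < r₀ ∧
      |X p.re - x₀| ≤ 5 * r ∧ |height cα X p| ≤ 8 * r := fun p hp => by
    obtain ⟨h1, h2⟩ := near_param hα.toBentCurve hXc hXl x₀ p
    exact ⟨hdI _ (by linarith), by linarith, by linarith, by linarith⟩
  have hγh : ∀ t ∈ Icc (0:ℝ) 1, 0 < height cα X (γ t) := fun t ht => by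
    obtain ⟨h1, h2, -, -⟩ := hnear _ (hγn t ht)
    exact hU _ h1 _ h2 (by rw [← eq_add_height hX]; exact hγU t ht)
  have hπn : ∀ p, ‖p - cα x₀‖ ≤ 4 * r → ‖π p - cα x₀‖ ≤ 4 * r := fun p hp => by
    have := hπlip p (cα x₀)
    rw [hπfix _ (hα.mem_tangentHull (Ioo_subset_Icc_self hx₀))] at this
    exact this.trans hp
  have hπh : ∀ t ∈ Icc (0:ℝ) 1, 0 ≤ height cα X (π (γ t)) := fun t ht => by
    refine height_nearest_nonneg hα.toBentCurve hXl (hγh t ht).le (hπmin _) fun w hw hw0 => ?_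
    have hwn : ‖w - cα x₀‖ ≤ 4 * r := by
      have := (convex_closedBall (cα x₀) (4 * r)).segment_subset
        (mem_closedBall_iff_norm.2 (hγn t ht)) (mem_closedBall_iff_norm.2 (hπn _ (hγn t ht))) hw
      exact mem_closedBall_iff_norm.1 this
    have e := eq_add_height hX w
    rw [hw0, Complex.ofReal_zero, zero_mul, add_zero] at e
    rw [e]
    exact hα.mem_tangentHull (Ioo_subset_Icc_self (hnear w hwn).1)
  have hMn : ∀ t ∈ Icc (0:ℝ) 1, ‖M (π (γ t)) - cβ x₀‖ ≤ 14 * r := fun t ht => by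
    obtain ⟨-, -, h3, h4⟩ := hnear _ (hπn _ (hγn t ht))
    have h1 := hβ.norm_sub_le (X (π (γ t)).re) x₀
    have e : M (π (γ t)) - cβ x₀ = (cβ (X (π (γ t)).re) - cβ x₀) +
        rot (β (X (π (γ t)).re) - α (X (π (γ t)).re)) *
          (height cα X (π (γ t)) * Complex.I) := by
      rw [hMdef, transfer]; ring
    rw [e]
    refine (norm_add_le _ _).trans ?_
    rw [norm_mul, norm_rot, one_mul, norm_mul, Complex.norm_I, mul_one, Complex.norm_real,
      Real.norm_eq_abs]
    linarith
  have hMγ : ∀ s ∈ Icc (0:ℝ) 1, ∀ t ∈ Icc (0:ℝ) 1, ‖γ s - γ t‖ < ρ₂ →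
      ‖M (π (γ s)) - M (π (γ t))‖ ≤ (1 + η) * ‖γ s - γ t‖ := fun s hs t ht hst => by
    refine (hM _ (hπ _) _ (hπ _) (Ioo_subset_Icc_self (hnear _ (hπn _ (hγn s hs))).1)
      (Ioo_subset_Icc_self (hnear _ (hπn _ (hγn t ht))).1) (hπh s hs) (hπh t ht)
      ((hπlip _ _).trans_lt hst)).trans ?_
    gcongr
    exact hπlip _ _
  have hMend : ∀ x ∈ Ioo xL xR, ∀ t ∈ Icc (0:ℝ) 1, ‖γ t - cα x‖ < ρ₁ →
      ‖M (π (γ t)) + ρ₁ * Complex.I - cβ x‖ < ρ := fun x hx t ht hxt => by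
    have hx' := hα.mem_tangentHull (Ioo_subset_Icc_self hx)
    have h1 : ‖π (γ t) - cα x‖ < ρ₁ := by
      have := hπlip (γ t) (cα x)
      rw [hπfix _ hx'] at this
      exact this.trans_lt hxt
    have h2 := hM _ (hπ (γ t)) _ hx' (Ioo_subset_Icc_self (hnear _ (hπn _ (hγn t ht))).1)
      (by rw [hXc]; exact Ioo_subset_Icc_self hx) (hπh t ht) (by rw [height_curve hXc])
      (h1.trans hρ₁ρ₂)
    have h3 : M (cα x) = cβ x := by
      rw [hMdef]; simp [transfer, hXc, height_curve hXc]
    rw [h3] at h2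
    have h4 : (1 + η) * ‖π (γ t) - cα x‖ ≤ (1 + η) * ρ₁ := by gcongr
    have e : M (π (γ t)) + ρ₁ * Complex.I - cβ x = (M (π (γ t)) - cβ x) + ρ₁ * Complex.I := by ring
    rw [e]
    refine (norm_add_le _ _).trans_lt ?_
    rw [norm_mul, Complex.norm_I, mul_one, Complex.norm_real, Real.norm_eq_abs, abs_of_pos hρ₁0]
    linarith
  -- points well above the second curve belong to the second domain
  have hwV : ∀ t ∈ Icc (0:ℝ) 1, ∀ z, ‖z - (M (π (γ t)) + ρ₁ * Complex.I)‖ < ρ₁ / 2 → z ∈ V := by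
    intro t ht z hz
    have hn : ‖z - cβ x₀‖ ≤ 16 * r := by
      have e : z - cβ x₀ = (z - (M (π (γ t)) + ρ₁ * Complex.I)) + ((M (π (γ t)) - cβ x₀) +
          ρ₁ * Complex.I) := by ring
      have h1 := norm_add_le (z - (M (π (γ t)) + ρ₁ * Complex.I)) ((M (π (γ t)) - cβ x₀) +
          ρ₁ * Complex.I)
      have h2 := norm_add_le (M (π (γ t)) - cβ x₀) (ρ₁ * Complex.I)
      rw [norm_mul, Complex.norm_I, mul_one, Complex.norm_real, Real.norm_eq_abs,
        abs_of_pos hρ₁0] at h2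
      rw [e]
      linarith [hMn t ht]
    obtain ⟨h1, h2⟩ := near_param hβ.toBentCurve hYc hYl x₀ z
    have h3 : 0 ≤ height cβ Y (M (π (γ t))) :=
      height_transfer_nonneg hα.toBentCurve hβ.toBentCurve hYc hYl (hπh t ht)
    have h4 : height cβ Y (M (π (γ t)) + ρ₁ * Complex.I) = height cβ Y (M (π (γ t))) + ρ₁ := by
      simp [height]; ring
    have h5 := (_root_.abs_le.1 (hβ.abs_height_sub_le hYl z (M (π (γ t)) + ρ₁ * Complex.I))).1
    rw [eq_add_height hY z]
    exact hV _ (hdI _ (by linarith)) _ (by linarith)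
      ((le_abs_self _).trans_lt (by linarith))
  obtain ⟨n, u, hu, huI, hu0, hu1, hmesh⟩ := exists_fine_partition hγ.continuous
    (ε := min ρ₂ (ρ₁ / (2 * (1 + η)))) (by positivity)
  set w : ℕ → ℂ := fun i => M (π (γ (u i))) + ρ₁ * Complex.I with hw
  have hstep : ∀ i, ‖w (i+1) - w i‖ ≤ (1 + η) * ‖γ (u (i+1)) - γ (u i)‖ := fun i => by
    have e : w (i+1) - w i = M (π (γ (u (i+1)))) - M (π (γ (u i))) := by simp only [hw]; ring
    rw [e]
    refine hMγ _ (huI _) _ (huI _) ?_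
    rw [norm_sub_rev]
    exact (hmesh i).trans_le (min_le_left _ _)
  have hstep' : ∀ i, ‖w (i+1) - w i‖ < ρ₁ / 2 := fun i => by
    refine (hstep i).trans_lt ?_
    have h1 := (hmesh i).trans_le (min_le_right _ _)
    rw [norm_sub_rev] at h1
    calc (1 + η) * ‖γ (u (i+1)) - γ (u i)‖ < (1 + η) * (ρ₁ / (2 * (1 + η))) := by gcongr
      _ = ρ₁ / 2 := by field_simp
  have hw0 : w 0 ∈ V := hwV _ (huI 0) _ (by simpa [hw] using hρ₁0)
  have hwn : w n ∈ V := hwV _ (huI n) _ (by simpa [hw] using hρ₁0)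
  refine ⟨w 0, ⟨hw0, ?_⟩, w n, ⟨hwn, ?_⟩, ?_⟩
  · rw [mem_ball, dist_eq_norm]
    exact hMend a haI _ (huI 0) (by rw [hu0, hγ0]; exact ha')
  · rw [mem_ball, dist_eq_norm]
    exact hMend b hbI _ (huI n) (by rw [hu1, hγ1]; exact hb')
  · have hpoly := pathInf_polygon_le (U := V) (p := w) n hw0 fun i _ z hz => by
      refine hwV _ (huI i) z ?_
      have h1 := (convex_closedBall (w i) ‖w (i+1) - w i‖).segment_subset
        (mem_closedBall_self (norm_nonneg _)) (mem_closedBall_iff_norm.2 le_rfl) hz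
      exact (mem_closedBall_iff_norm.1 h1).trans_lt (hstep' i)
    refine hpoly.trans ?_
    have hsum : ∑ i ∈ Finset.range n, edist (w i) (w (i+1)) ≤
        ∑ i ∈ Finset.range n, ENNReal.ofReal (1 + η) * edist (γ (u (i+1))) (γ (u i)) := by
      refine Finset.sum_le_sum fun i _ => ?_
      rw [edist_comm, edist_dist, edist_dist, ← ENNReal.ofReal_mul (by linarith), dist_eq_norm,
        dist_eq_norm]
      exact ENNReal.ofReal_le_ofReal (hstep i)
    refine hsum.trans ?_
    rw [← Finset.mul_sum, ← hηl, ENNReal.ofReal_mul (by linarith)]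
    gcongr
    exact (eVariationOn.sum_le hu huI).trans hγL.le

end Core

section Bending

variable {g G m B : ℝ → ℝ} {xL xR : ℝ}

/-- A concave `C¹` majorant `G` of `g` over `[xL, xR]` with derivative `m`, affine off the contact
set. -/
structure Envelope (g G m : ℝ → ℝ) (xL xR : ℝ) : Prop where
  smooth : ContDiff ℝ 1 g
  slope : ∀ t, |deriv g t| ≤ 1 / 10
  lt : xL < xR
  hasDerivAt : ∀ x ∈ Icc xL xR, HasDerivAt G (m x) x
  le : ∀ x ∈ Icc xL xR, g x ≤ G x
  contact : ∀ x ∈ Icc xL xR, g x = G x → m x = deriv g x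
  bound : ∀ x, |m x| ≤ 1 / 10
  anti : Antitone m
  cont : Continuous m
  drop : m xR < m xL
  gap : ∀ x ∈ Icc xL xR, ∀ x' ∈ Icc xL xR, x ≤ x' → (∀ t ∈ Icc x x', g t < G t) → m x = m x'

theorem exists_envelope {κ : ℝ} (hg : ContDiff ℝ 1 g) (hκ : ∀ t, |deriv g t| ≤ κ) (hκ' : κ ≤ 1 / 10)
    {x₀ z x₁ : ℝ} (h0 : x₀ < z) (h1 : z < x₁)
    (hz : (g x₁ - g z) * (z - x₀) < (g z - g x₀) * (x₁ - z)) :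
    ∃ (xL xR : ℝ) (G m : ℝ → ℝ), x₀ < xL ∧ xR < x₁ ∧ Envelope g G m xL xR := by
  obtain ⟨xL, xR, G, m, hL, hLR, hR, hG, hgG, hm, hanti, hcont, hdrop, hgap⟩ :=
    exists_concave_envelope hg hκ h0 h1 hz
  have hI : ∀ x ∈ Icc xL xR, x ∈ Ioo x₀ x₁ := fun x hx =>
    ⟨hL.trans_le hx.1, hx.2.trans_lt hR⟩
  set p : ℝ → ℝ := fun x => max xL (min x xR) with hp
  have hpI : ∀ x, p x ∈ Icc xL xR := fun x =>
    ⟨le_max_left _ _, max_le hLR.le (min_le_right _ _)⟩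
  have hpid : ∀ x ∈ Icc xL xR, p x = x := fun x hx => by
    rw [hp]; simp only; rw [min_eq_left hx.2, max_eq_right hx.1]
  have hpc : Continuous p := by fun_prop
  refine ⟨xL, xR, G, m ∘ p, hL, hR, hg, fun t => (hκ t).trans hκ', hLR, fun x hx => ?_,
    fun x hx => hgG x (hI x hx), fun x hx hx' => ?_, fun x => (hm _ (hI _ (hpI x))).trans hκ',
    fun x y hxy => hanti (hI _ (hpI x)) (hI _ (hpI y)) (by simp only [hp]; gcongr),
    hcont.comp_continuous hpc fun x => hI _ (hpI x), ?_,
    fun x hx x' hx' hxx' h => ?_⟩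
  · rw [Function.comp, hpid x hx]; exact hG x (hI x hx)
  · rw [Function.comp, hpid x hx]
    have hd := (hG x (hI x hx)).sub ((hg.differentiable one_ne_zero) x).hasDerivAt
    have hmin : IsLocalMin (G - g) x := by
      filter_upwards [Ioo_mem_nhds (hI x hx).1 (hI x hx).2] with y hy
      have := hgG y hy
      simp only [Pi.sub_apply]
      linarith
    have := hmin.hasDerivAt_eq_zero hd
    linarith
  · rw [Function.comp, Function.comp, hpid xL ⟨le_rfl, hLR.le⟩, hpid xR ⟨hLR.le, le_rfl⟩]
    exact hdrop
  · rw [Function.comp, Function.comp, hpid x hx, hpid x' hx']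
    exact hgap x (hI x hx) x' (hI x' hx') hxx' h

/-- An admissible bending profile, giving the bending angle as a function of the tangent angle. -/
structure Profile (m : ℝ → ℝ) (xL xR : ℝ) (B : ℝ → ℝ) : Prop where
  cont : Continuous B
  mono : Monotone fun θ => θ + B θ
  abs_le : ∀ θ, |B θ| ≤ 1 / 10
  supp : ∃ tl tr, Real.arctan (m xR) < tl ∧ tr < Real.arctan (m xL) ∧ ∀ θ, θ < tl ∨ tr < θ → B θ = 0

/-- The bending angle. -/
def bendAngle (m B : ℝ → ℝ) (x : ℝ) : ℝ := B (Real.arctan (m x))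

/-- The displacement of the graph of `g` under bending. -/
def bendShift (g m B : ℝ → ℝ) (xL x : ℝ) : ℂ :=
  ∫ t in xL..x, (rot (bendAngle m B t) - 1) * (1 + (deriv g t : ℝ) * Complex.I)

/-- The bent graph. -/
def bendCurve (g m B : ℝ → ℝ) (xL x : ℝ) : ℂ := x + g x * Complex.I + bendShift g m B xL x

theorem continuous_bendAngle (hm : Continuous m) (hB : Continuous B) :
    Continuous (bendAngle m B) := hB.comp (Real.continuous_arctan.comp hm)

theorem hasDerivAt_bendShift (hg : ContDiff ℝ 1 g) (hm : Continuous m) (hB : Continuous B) (x : ℝ) :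
    HasDerivAt (bendShift g m B xL)
      ((rot (bendAngle m B x) - 1) * (1 + (deriv g x : ℝ) * Complex.I)) x := by
  have hg' : Continuous (deriv g) := hg.continuous_deriv le_rfl
  have h : Continuous fun t => (rot (bendAngle m B t) - 1) * (1 + (deriv g t : ℝ) * Complex.I) := by
    have := continuous_rot.comp (continuous_bendAngle hm hB)
    simp only [Function.comp_def] at this
    fun_prop
  exact intervalIntegral.integral_hasDerivAt_right (h.intervalIntegrable _ _)
    (h.stronglyMeasurableAtFilter _ _) h.continuousAt

theorem hasDerivAt_bendCurve (hg : ContDiff ℝ 1 g) (hm : Continuous m) (hB : Continuous B) (x : ℝ) :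
    HasDerivAt (bendCurve g m B xL)
      (rot (bendAngle m B x) * (1 + (deriv g x : ℝ) * Complex.I)) x := by
  have h1 : HasDerivAt (fun t : ℝ => (t : ℂ)) 1 x := Complex.ofRealCLM.hasDerivAt (x := x)
  have h2 : HasDerivAt (fun t : ℝ => (g t : ℂ)) (deriv g x : ℝ) x :=
    ((hg.differentiable one_ne_zero) x).hasDerivAt.ofReal_comp
  exact ((h1.add (h2.mul_const Complex.I)).add
    (hasDerivAt_bendShift (xL := xL) hg hm hB x)).congr_deriv (by ring)

theorem Envelope.mem_iff (h : Envelope g G m xL xR) (hB : Profile m xL xR B) :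
    ∃ xl xr, xL < xl ∧ xl ≤ xr ∧ xr < xR ∧ ∀ x, x ∉ Icc xl xr → bendAngle m B x = 0 := by
  obtain ⟨tl, tr, hl, hr, hBs⟩ := hB.supp
  have hΘ : Continuous fun x => Real.arctan (m x) := Real.continuous_arctan.comp h.cont
  obtain ⟨d₁, hd₁, h1⟩ := Metric.isOpen_iff.1 (isOpen_lt continuous_const hΘ :
    IsOpen {x | tr < Real.arctan (m x)}) xL hr
  obtain ⟨d₂, hd₂, h2⟩ := Metric.isOpen_iff.1 (isOpen_lt hΘ continuous_const :
    IsOpen {x | Real.arctan (m x) < tl}) xR hl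
  have hlt := h.lt
  set d := min (min (d₁ / 2) (d₂ / 2)) ((xR - xL) / 2) with hd
  have hd0 : 0 < d := lt_min (by positivity) (by linarith)
  have hdd1 : d ≤ d₁ / 2 := (min_le_left _ _).trans (min_le_left _ _)
  have hdd2 : d ≤ d₂ / 2 := (min_le_left _ _).trans (min_le_right _ _)
  have hdd3 : d ≤ (xR - xL) / 2 := min_le_right _ _
  refine ⟨xL + d, xR - d, by linarith, by linarith, by linarith, fun x hx => hBs _ ?_⟩
  rw [mem_Icc, not_and_or, not_le, not_le] at hx
  rcases hx with hx | hx
  · right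
    have e : tr < Real.arctan (m (xL + d)) :=
      h1 (by rw [mem_ball, Real.dist_eq, add_sub_cancel_left, abs_of_pos hd0]; linarith)
    exact e.trans_le (Real.arctan_mono (h.anti hx.le))
  · left
    have e : Real.arctan (m (xR - d)) < tl :=
      h2 (by rw [mem_ball, Real.dist_eq, sub_sub_cancel_left, abs_neg, abs_of_pos hd0]; linarith)
    exact (Real.arctan_mono (h.anti hx.le)).trans_lt e

theorem Envelope.hasDerivAt_upper (h : Envelope g G m xL xR) (hB : Profile m xL xR B) {x : ℝ}
    (hx : x ∈ Ioo xL xR) :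
    HasDerivAt (fun t => bendCurve g m B xL t + rot (bendAngle m B t) * ((G t - g t : ℝ) : ℂ) *
      Complex.I) (rot (bendAngle m B x) * (1 + m x * Complex.I)) x := by
  have hxI := Ioo_subset_Icc_self hx
  have hc := hasDerivAt_bendCurve (xL := xL) h.smooth h.cont hB.cont x
  have hh : HasDerivAt (fun t => G t - g t) (m x - deriv g x) x :=
    (h.hasDerivAt x hxI).sub ((h.smooth.differentiable one_ne_zero) x).hasDerivAt
  rcases (h.le x hxI).lt_or_eq with hlt | heq
  · -- the bending is rigid off the contact set
    have hconst : ∀ᶠ t in 𝓝 x, bendAngle m B t = bendAngle m B x := by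
      have hev : ∀ᶠ t in 𝓝 x, 0 < G t - g t :=
        hh.continuousAt.eventually (lt_mem_nhds (by linarith))
      obtain ⟨d, hd, hdb⟩ := Metric.eventually_nhds_iff.1
        (hev.and (Ioo_mem_nhds hx.1 hx.2))
      have hseg : ∀ t, |t - x| < d → ∀ s ∈ uIcc t x, |s - x| < d := fun t ht s hs =>
        (abs_sub_left_of_mem_uIcc (uIcc_comm t x ▸ hs)).trans_lt ht
      filter_upwards [Metric.ball_mem_nhds x hd] with t ht
      rw [mem_ball, Real.dist_eq] at ht
      have htI := Ioo_subset_Icc_self (hdb (y := t) (by rwa [Real.dist_eq])).2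
      unfold bendAngle
      congr 2
      rcases le_total t x with htx | htx
      · refine h.gap t htI x hxI htx fun s hs => ?_
        have := (hdb (y := s) (by
          rw [Real.dist_eq]; exact hseg t ht s (by rwa [uIcc_of_le htx]))).1
        linarith
      · refine (h.gap x hxI t htI htx fun s hs => ?_).symm
        have := (hdb (y := s) (by
          rw [Real.dist_eq]; exact hseg t ht s (by rwa [uIcc_of_ge htx]))).1
        linarith
    have hd : HasDerivAt (fun t => bendCurve g m B xL t + rot (bendAngle m B x) *
        ((G t - g t : ℝ) : ℂ) * Complex.I) (rot (bendAngle m B x) * (1 + m x * Complex.I)) x := by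
      exact (hc.add ((hh.ofReal_comp.const_mul (rot (bendAngle m B x))).mul_const
        Complex.I)).congr_deriv (by push_cast; ring)
    refine hd.congr_of_eventuallyEq ?_
    filter_upwards [hconst] with t ht
    rw [ht]
  · have hm := h.contact x hxI heq
    rw [hm, sub_self] at hh
    have h2 : HasDerivAt (fun t => rot (bendAngle m B t) * ((G t - g t : ℝ) : ℂ) * Complex.I) 0 x := by
      rw [hasDerivAt_iff_isLittleO] at hh ⊢
      refine (Asymptotics.isLittleO_iff.2 fun ε hε => ?_)
      filter_upwards [Asymptotics.isLittleO_iff.1 hh hε] with t ht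
      rw [← heq, sub_self, smul_zero, sub_zero, sub_zero] at ht
      rw [← heq, sub_self, Complex.ofReal_zero, mul_zero, zero_mul, smul_zero, sub_zero, sub_zero,
        norm_mul, norm_mul, norm_rot, one_mul, Complex.norm_I, mul_one, Complex.norm_real]
      exact ht
    rw [hm]
    exact (hc.add h2).congr_deriv (add_zero _)

theorem rot_mul_conj_rot (a b : ℝ) : rot a * (starRingEnd ℂ) (rot b) = rot (a - b) := by
  have h := rot_add (a - b) b
  rw [sub_add_cancel] at h
  rw [h, mul_assoc, rot_mul_conj, mul_one]

theorem im_tangent_mul_conj (a b s t : ℝ) :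
    (rot a * (1 + s * Complex.I) * (starRingEnd ℂ) (rot b * (1 + t * Complex.I))).im =
      Real.sqrt (1 + s ^ 2) * Real.sqrt (1 + t ^ 2) *
        Real.sin ((Real.arctan s + a) - (Real.arctan t + b)) := by
  have e : rot a * (1 + s * Complex.I) * (starRingEnd ℂ) (rot b * (1 + t * Complex.I)) =
      rot (a - b) * ((1 + s * t : ℝ) + (s - t : ℝ) * Complex.I) := by
    rw [← rot_mul_conj_rot, map_mul, map_add, map_mul, map_one, Complex.conj_I, Complex.conj_ofReal]
    push_cast
    linear_combination (-(s * t : ℂ)) * rot a * (starRingEnd ℂ) (rot b) * Complex.I_mul_I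
  have e2 : (Real.arctan s + a) - (Real.arctan t + b) = (a - b) + (Real.arctan s - Real.arctan t) := by
    ring
  have hs : 0 < 1 + s ^ 2 := by positivity
  have ht : 0 < 1 + t ^ 2 := by positivity
  have hs' := (Real.sqrt_pos.2 hs).ne'
  have ht' := (Real.sqrt_pos.2 ht).ne'
  rw [e, e2, Real.sin_add (a - b), Real.sin_sub (Real.arctan s),
    Real.cos_sub (Real.arctan s), Real.sin_arctan, Real.cos_arctan,
    Real.sin_arctan, Real.cos_arctan]
  simp only [Complex.mul_im, Complex.add_im, Complex.add_re, Complex.ofReal_re, Complex.ofReal_im,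
    Complex.mul_re, Complex.I_re, Complex.I_im, rot_re, rot_im]
  field_simp
  ring

theorem arctan_sub_arctan_bounds {s t : ℝ} (hs : |s| ≤ 1 / 10) (ht : |t| ≤ 1 / 10) :
    |Real.arctan s - Real.arctan t| ≤ Real.pi / 2 := by
  have key : ∀ s : ℝ, |s| ≤ 1 / 10 → |Real.arctan s| ≤ Real.pi / 4 := fun s hs => by
    have := _root_.abs_le.1 hs
    rw [← Real.arctan_one, _root_.abs_le, ← Real.arctan_neg]
    exact ⟨Real.arctan_mono (by linarith), Real.arctan_mono (by linarith)⟩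
  have := _root_.abs_sub (Real.arctan s) (Real.arctan t)
  linarith [key s hs, key t ht]

theorem Envelope.tightBend (h : Envelope g G m xL xR) (hB : Profile m xL xR B) :
    TightBend (deriv g) {k | k ∈ Icc xL xR ∧ g k = G k} xL xR (bendAngle m B)
      (bendCurve g m B xL) where
  slope := h.slope
  angle x := hB.abs_le _
  deriv := hasDerivAt_bendCurve h.smooth h.cont hB.cont
  unif := by
    obtain ⟨xl, xr, -, -, -, h0⟩ := h.mem_iff hB
    exact HasCompactSupport.uniformContinuous_of_continuous
      (HasCompactSupport.intro isCompact_Icc fun x hx => h0 x hx)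
      (continuous_bendAngle h.cont hB.cont)
  gap x hx x' hx' hxx' hk := by
    unfold bendAngle
    rw [h.gap x hx x' hx' hxx' fun t ht => ?_]
    have htI : t ∈ Icc xL xR := ⟨hx.1.trans ht.1, ht.2.trans hx'.2⟩
    exact (h.le t htI).lt_of_ne fun e => hk t ⟨htI, e⟩ ht
  supp := by
    rintro k ⟨hk, hgk⟩ x hx
    set τ := rot (bendAngle m B k) * (1 + (deriv g k : ℝ) * Complex.I) with hτ
    have hmk := h.contact k hk hgk
    set Γ : ℝ → ℂ := fun t => bendCurve g m B xL t + rot (bendAngle m B t) * ((G t - g t : ℝ) : ℂ) *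
      Complex.I with hΓ
    set F : ℝ → ℝ := fun t => ((Γ t - Γ k) * (starRingEnd ℂ) τ).im with hF
    have hΓc : ContinuousOn Γ (Icc xL xR) := by
      have h1 : ContinuousOn G (Icc xL xR) := fun t ht =>
        (h.hasDerivAt t ht).continuousAt.continuousWithinAt
      have h2 : Continuous g := h.smooth.continuous
      have h3 : Continuous (bendCurve g m B xL) := continuous_iff_continuousAt.2 fun t =>
        (hasDerivAt_bendCurve (xL := xL) h.smooth h.cont hB.cont t).continuousAt
      have h4 : Continuous fun t => rot (bendAngle m B t) :=
        continuous_rot.comp (continuous_bendAngle h.cont hB.cont)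
      have h5 : ContinuousOn (fun t => ((G t - g t : ℝ) : ℂ)) (Icc xL xR) :=
        Complex.continuous_ofReal.comp_continuousOn (h1.sub h2.continuousOn)
      exact h3.continuousOn.add ((h4.continuousOn.mul h5).mul continuousOn_const)
    have hFc : ContinuousOn F (Icc xL xR) :=
      Complex.continuous_im.comp_continuousOn ((hΓc.sub continuousOn_const).mul continuousOn_const)
    have hFd : ∀ t ∈ Ioo xL xR, HasDerivAt F (Real.sqrt (1 + m t ^ 2) * Real.sqrt (1 + m k ^ 2) *
        Real.sin ((Real.arctan (m t) + bendAngle m B t) -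
          (Real.arctan (m k) + bendAngle m B k))) t := fun t ht => by
      rw [← im_tangent_mul_conj, hmk]
      exact Complex.imCLM.hasFDerivAt.comp_hasDerivAt t
        (((h.hasDerivAt_upper hB ht).sub_const (Γ k)).mul_const ((starRingEnd ℂ) τ))
    have hang : ∀ t, |(Real.arctan (m t) + bendAngle m B t) -
        (Real.arctan (m k) + bendAngle m B k)| ≤ Real.pi := fun t => by
      have h1 := _root_.abs_le.1 (arctan_sub_arctan_bounds (h.bound t) (h.bound k))
      have h2 := _root_.abs_le.1 (hB.abs_le (Real.arctan (m t)))
      have h3 := _root_.abs_le.1 (hB.abs_le (Real.arctan (m k)))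
      have h4 := Real.pi_gt_three
      unfold bendAngle
      rw [_root_.abs_le]
      constructor <;> linarith
    have hmono : ∀ s t, s ≤ t → Real.arctan (m t) + bendAngle m B t ≤
        Real.arctan (m s) + bendAngle m B s := fun s t hst =>
      hB.mono (Real.arctan_mono (h.anti hst))
    have hFx : F x ≤ 0 := by
      have hFk : F k = 0 := by simp [hF]
      rw [← hFk]
      rcases le_total k x with hkx | hkx
      · refine antitoneOn_of_deriv_nonpos (convex_Icc k xR)
          (hFc.mono (Icc_subset_Icc_left hk.1)) (fun t ht => ?_) (fun t ht => ?_)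
          ⟨le_rfl, hk.2⟩ ⟨hkx, hx.2⟩ hkx
        · rw [interior_Icc] at ht
          exact (hFd t ⟨hk.1.trans_lt ht.1, ht.2⟩).differentiableAt.differentiableWithinAt
        · rw [interior_Icc] at ht
          rw [(hFd t ⟨hk.1.trans_lt ht.1, ht.2⟩).deriv]
          refine mul_nonpos_of_nonneg_of_nonpos (by positivity)
            (Real.sin_nonpos_of_nonpos_of_neg_pi_le ?_ (_root_.abs_le.1 (hang t)).1)
          linarith [hmono k t ht.1.le]
      · refine monotoneOn_of_deriv_nonneg (convex_Icc xL k)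
          (hFc.mono (Icc_subset_Icc_right hk.2)) (fun t ht => ?_) (fun t ht => ?_)
          ⟨hx.1, hkx⟩ ⟨hk.1, le_rfl⟩ hkx
        · rw [interior_Icc] at ht
          exact (hFd t ⟨ht.1, ht.2.trans_le hk.2⟩).differentiableAt.differentiableWithinAt
        · rw [interior_Icc] at ht
          rw [(hFd t ⟨ht.1, ht.2.trans_le hk.2⟩).deriv]
          refine mul_nonneg (by positivity)
            (Real.sin_nonneg_of_nonneg_of_le_pi ?_ (_root_.abs_le.1 (hang t)).2)
          linarith [hmono t k ht.2.le]
    have e : (bendCurve g m B xL x - bendCurve g m B xL k) * (starRingEnd ℂ) τ =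
        (Γ x - Γ k) * (starRingEnd ℂ) τ - ((G x - g x : ℝ) : ℂ) *
          (rot (bendAngle m B x - bendAngle m B k) * Complex.I *
            (starRingEnd ℂ) (1 + (deriv g k : ℝ) * Complex.I)) := by
      rw [hτ, map_mul, ← rot_mul_conj_rot]
      simp only [hΓ, hgk, sub_self, Complex.ofReal_zero]
      ring
    have hnn : 0 ≤ (rot (bendAngle m B x - bendAngle m B k) * Complex.I *
            (starRingEnd ℂ) (1 + (deriv g k : ℝ) * Complex.I)).im := by
      have e2 : (rot (bendAngle m B x - bendAngle m B k) * Complex.I *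
            (starRingEnd ℂ) (1 + (deriv g k : ℝ) * Complex.I)).im =
          Real.cos (bendAngle m B x - bendAngle m B k) +
            deriv g k * Real.sin (bendAngle m B x - bendAngle m B k) := by
        simp [rot_re, rot_im]
        ring
      rw [e2]
      set δ := bendAngle m B x - bendAngle m B k with hδ
      have h1 : |δ| ≤ 1 / 5 := by
        have h2 := _root_.abs_le.1 (hB.abs_le (Real.arctan (m x)))
        have h3 := _root_.abs_le.1 (hB.abs_le (Real.arctan (m k)))
        rw [hδ, _root_.abs_le]
        unfold bendAngle
        constructor <;> linarith
      have h2 := Real.one_sub_sq_div_two_le_cos (x := δ)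
      have h3 : δ ^ 2 ≤ (1/5) ^ 2 := sq_le_sq' (by linarith [(_root_.abs_le.1 h1).1])
        (_root_.abs_le.1 h1).2
      have h4 : |deriv g k * Real.sin δ| ≤ 1 / 10 * 1 := by
        rw [abs_mul]
        exact mul_le_mul (h.slope k) (Real.abs_sin_le_one δ) (abs_nonneg _) (by norm_num)
      have := (_root_.abs_le.1 h4).1
      linarith
    rw [e, Complex.sub_im, Complex.im_ofReal_mul]
    have := mul_nonneg (sub_nonneg.2 (h.le x hx)) hnn
    have hFx' : ((Γ x - Γ k) * (starRingEnd ℂ) τ).im ≤ 0 := hFx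
    linarith

/-- The closing condition for a bending profile. -/
def Closes (m B : ℝ → ℝ) (xL xR : ℝ) : Prop :=
  ∫ t in xL..xR, (rot (bendAngle m B t) - 1) * (1 + m t * Complex.I) = 0

theorem continuous_shift_integrand {s : ℝ → ℝ} (hs : Continuous s) (hm : Continuous m)
    (hB : Continuous B) :
    Continuous fun t => (rot (bendAngle m B t) - 1) * (1 + (s t : ℝ) * Complex.I) := by
  have := continuous_rot.comp (continuous_bendAngle hm hB)
  simp only [Function.comp_def] at this
  fun_prop

theorem Envelope.bendShift_right (h : Envelope g G m xL xR) (hB : Profile m xL xR B)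
    (hc : Closes m B xL xR) : bendShift g m B xL xR = 0 := by
  obtain ⟨xl, xr, hxl, -, hxr, h0⟩ := h.mem_iff hB
  have hlt := h.lt
  have e1 : bendAngle m B xL = 0 := h0 _ fun hx => by linarith [hx.1]
  have e2 : bendAngle m B xR = 0 := h0 _ fun hx => by linarith [hx.2]
  have hGc : ContinuousOn G (Icc xL xR) := fun t ht =>
    (h.hasDerivAt t ht).continuousAt.continuousWithinAt
  have hcc : Continuous (bendCurve g m B xL) := continuous_iff_continuousAt.2 fun t =>
    (hasDerivAt_bendCurve (xL := xL) h.smooth h.cont hB.cont t).continuousAt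
  have hα : Continuous fun t => rot (bendAngle m B t) :=
    continuous_rot.comp (continuous_bendAngle h.cont hB.cont)
  have hm := h.cont
  have i1 := intervalIntegral.integral_eq_sub_of_hasDerivAt_of_le hlt.le
    (f := fun t => bendCurve g m B xL t + rot (bendAngle m B t) * ((G t - g t : ℝ) : ℂ) *
      Complex.I)
    (hcc.continuousOn.add ((hα.continuousOn.mul (Complex.continuous_ofReal.comp_continuousOn
      (hGc.sub h.smooth.continuous.continuousOn))).mul continuousOn_const))
    (fun t ht => h.hasDerivAt_upper hB ht)
    (Continuous.intervalIntegrable (by fun_prop) _ _)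
  have i2 := intervalIntegral.integral_eq_sub_of_hasDerivAt_of_le hlt.le
    (f := fun t : ℝ => (t : ℂ) + G t * Complex.I) (f' := fun t => 1 + m t * Complex.I)
    (Complex.continuous_ofReal.continuousOn.add
      ((Complex.continuous_ofReal.comp_continuousOn hGc).mul continuousOn_const))
    (fun t ht => (Complex.ofRealCLM.hasDerivAt (x := t)).add
      ((h.hasDerivAt t (Ioo_subset_Icc_self ht)).ofReal_comp.mul_const Complex.I))
    (Continuous.intervalIntegrable (by fun_prop) _ _)
  have hL : bendShift g m B xL xL = 0 := intervalIntegral.integral_same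
  have i3 : ∫ t in xL..xR, (rot (bendAngle m B t) - 1) * (1 + m t * Complex.I) =
      (∫ t in xL..xR, rot (bendAngle m B t) * (1 + m t * Complex.I)) -
        ∫ t in xL..xR, (1 + m t * Complex.I) := by
    rw [← intervalIntegral.integral_sub (Continuous.intervalIntegrable (by fun_prop) _ _)
      (Continuous.intervalIntegrable (by fun_prop) _ _)]
    simp only [sub_mul, one_mul]
  unfold Closes at hc
  rw [i3, i1, i2, e1, e2, rot_zero] at hc
  simp only [bendCurve, hL] at hc
  push_cast at hc
  linear_combination hc

theorem bendShift_zero_of_notMem (h : Envelope g G m xL xR) (hB : Profile m xL xR B)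
    (hc : Closes m B xL xR) {xl xr : ℝ} (hxl : xL < xl) (hxr : xr < xR)
    (h0 : ∀ x, x ∉ Icc xl xr → bendAngle m B x = 0) {x : ℝ} (hx : x ∉ Icc xl xr) :
    bendShift g m B xL x = 0 := by
  have hint := continuous_shift_integrand (h.smooth.continuous_deriv le_rfl) h.cont hB.cont
  have hz : ∀ p q : ℝ, (∀ t ∈ uIcc p q, t ∉ Icc xl xr) → ∫ t in p..q,
      (rot (bendAngle m B t) - 1) * (1 + (deriv g t : ℝ) * Complex.I) = 0 := fun p q hpq => by
    rw [intervalIntegral.integral_congr (g := fun _ => (0:ℂ)) fun t ht => by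
      simp only; rw [h0 t (hpq t ht), rot_zero, sub_self, zero_mul]]
    simp
  rw [mem_Icc, not_and_or, not_le, not_le] at hx
  rcases hx with hx | hx
  · refine hz _ _ fun t ht ht' => ?_
    have := ht.2.trans_lt (max_lt hxl hx)
    linarith [ht'.1]
  · have e := intervalIntegral.integral_add_adjacent_intervals
      (hint.intervalIntegrable (μ := MeasureTheory.volume) xL xR) (hint.intervalIntegrable xR x)
    have e1 : ∫ t in xL..xR, (rot (bendAngle m B t) - 1) * (1 + (deriv g t : ℝ) * Complex.I) = 0 :=
      h.bendShift_right hB hc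
    rw [e1, zero_add, hz _ _ fun t ht ht' => ?_] at e
    · exact e.symm
    · have := (lt_min hxr hx).trans_le ht.1
      linarith [ht'.2]

theorem norm_rot_sub_one_le (θ : ℝ) : ‖rot θ - 1‖ ≤ |θ| := by
  simpa [rot_zero] using norm_rot_sub_le θ 0

theorem norm_bendShift_integrand_le {s : ℝ → ℝ} (hs : ∀ t, |s t| ≤ 1 / 10) {ε : ℝ}
    (hε : ∀ θ, |B θ| ≤ ε) (t : ℝ) :
    ‖(rot (bendAngle m B t) - 1) * (1 + (s t : ℝ) * Complex.I)‖ ≤ 2 * ε := by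
  have h1 := (norm_rot_sub_one_le (bendAngle m B t)).trans (hε _)
  have h2 := norm_one_add_mul_I_le (hs t)
  rw [norm_mul]
  have h3 : 0 ≤ ε := (abs_nonneg _).trans (hε 0)
  calc _ ≤ ε * (11 / 10) := mul_le_mul h1 h2 (norm_nonneg _) h3
    _ ≤ 2 * ε := by linarith

theorem lipschitz_bendShift (h : Envelope g G m xL xR) (hB : Profile m xL xR B) {ε : ℝ}
    (hε : ∀ θ, |B θ| ≤ ε) (x y : ℝ) :
    ‖bendShift g m B xL x - bendShift g m B xL y‖ ≤ 2 * ε * |x - y| := by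
  have := Convex.norm_image_sub_le_of_norm_hasDerivWithin_le (f := bendShift g m B xL) (s := univ)
    (C := 2 * ε) (x := y) (y := x)
    (fun t _ => (hasDerivAt_bendShift h.smooth h.cont hB.cont t).hasDerivWithinAt)
    (fun t _ => norm_bendShift_integrand_le h.slope hε t) convex_univ trivial trivial
  simpa using this

theorem norm_bendShift_le (h : Envelope g G m xL xR) (hB : Profile m xL xR B)
    (hc : Closes m B xL xR) {ε : ℝ} (hε : ∀ θ, |B θ| ≤ ε) (x : ℝ) :
    ‖bendShift g m B xL x‖ ≤ 2 * ε * (xR - xL) := by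
  obtain ⟨xl, xr, hxl, hlr, hxr, h0⟩ := h.mem_iff hB
  have hε0 : 0 ≤ ε := (abs_nonneg _).trans (hε 0)
  have hlt := h.lt
  by_cases hx : x ∈ Icc xl xr
  · have := lipschitz_bendShift h hB hε x xL
    rw [show bendShift g m B xL xL = 0 from intervalIntegral.integral_same, sub_zero,
      abs_of_nonneg (by linarith [hx.1])] at this
    refine this.trans ?_
    gcongr
    linarith [hx.2]
  · rw [bendShift_zero_of_notMem h hB hc hxl hxr h0 hx, norm_zero]
    have : 0 ≤ xR - xL := by linarith
    positivity

theorem contDiff_bendShift (h : Envelope g G m xL xR) (hB : Profile m xL xR B) :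
    ContDiff ℝ 1 (bendShift g m B xL) := by
  have hd := hasDerivAt_bendShift (xL := xL) h.smooth h.cont hB.cont
  rw [contDiff_one_iff_deriv]
  refine ⟨fun x => (hd x).differentiableAt, ?_⟩
  rw [show deriv (bendShift g m B xL) = _ from funext fun x => (hd x).deriv]
  exact continuous_shift_integrand (h.smooth.continuous_deriv le_rfl) h.cont hB.cont

theorem profile_zero (h : Envelope g G m xL xR) : Profile m xL xR 0 where
  cont := continuous_const
  mono x y hxy := by simpa using hxy
  abs_le θ := by simp
  supp := by
    have := Real.arctan_strictMono h.drop
    refine ⟨(Real.arctan (m xR) + Real.arctan (m xL)) / 2,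
      (Real.arctan (m xR) + Real.arctan (m xL)) / 2, ?_, ?_, fun θ _ => rfl⟩ <;> linarith

theorem bendCurve_zero (x : ℝ) : bendCurve g m 0 xL x = x + g x * Complex.I := by
  simp [bendCurve, bendShift, bendAngle, rot_zero]

/-- A small closed bending of the boundary is induced by a diffeomorphism of the plane, supported
near the bent arc. -/
theorem exists_bend_diffeo {a : ℝ} (ha : 0 < a) (h : Envelope g G m xL xR) :
    ∃ ε₀ > 0, ∀ B, Profile m xL xR B → (∀ θ, |B θ| ≤ ε₀) → Closes m B xL xR →
      ∃ Φ : ℂ ≃ₜ ℂ, ContDiff ℝ 1 Φ ∧ ContDiff ℝ 1 Φ.symm ∧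
        (∀ z : ℂ, a / 2 ≤ |z.im| → Φ z = z) ∧ (∀ z : ℂ, bendShift g m B xL z.re = 0 → Φ z = z) ∧
        ∀ z : ℂ, |z.im| ≤ a / 4 → Φ z = bendCurve g m B xL z.re + (z.im - g z.re : ℝ) * Complex.I := by
  set χ : ContDiffBump (0:ℝ) := ⟨a / 4, a / 2, by positivity, by linarith⟩ with hχ
  have hχs : ContDiff ℝ 1 χ := χ.contDiff
  obtain ⟨C, hC⟩ := hχs.lipschitzWith_of_hasCompactSupport χ.hasCompactSupport one_ne_zero
  have hlt := h.lt
  set M : ℝ := 2 + C * (2 * (xR - xL)) with hM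
  have hM0 : 0 < M := by have : 0 ≤ xR - xL := by linarith
                         positivity
  refine ⟨1 / (2 * M), by positivity, fun B hB hε hc => ?_⟩
  set D := bendShift g m B xL with hD
  set N : ℂ → ℂ := fun z => (χ z.im : ℝ) * D z.re with hN
  have hNs : ContDiff ℝ 1 N := by
    have h1 : ContDiff ℝ 1 fun z : ℂ => ((χ z.im : ℝ) : ℂ) :=
      Complex.ofRealCLM.contDiff.comp (hχs.comp Complex.imCLM.contDiff)
    exact h1.mul ((contDiff_bendShift h hB).comp Complex.reCLM.contDiff)
  have hNL : ∀ z w, ‖N z - N w‖ ≤ 1 / 2 * ‖z - w‖ := fun z w => by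
    have e : N z - N w = (χ z.im : ℝ) * (D z.re - D w.re) + ((χ z.im - χ w.im : ℝ) : ℂ) * D w.re := by
      simp only [hN]; push_cast; ring
    have h1 : ‖(χ z.im : ℝ) * (D z.re - D w.re)‖ ≤ 1 * (2 * (1 / (2 * M)) * ‖z - w‖) := by
      rw [norm_mul, Complex.norm_real, Real.norm_eq_abs, abs_of_nonneg χ.nonneg]
      refine mul_le_mul χ.le_one ((lipschitz_bendShift h hB hε _ _).trans ?_) (norm_nonneg _)
        zero_le_one
      gcongr
      simpa using Complex.abs_re_le_norm (z - w)
    have h2 : ‖((χ z.im - χ w.im : ℝ) : ℂ) * D w.re‖ ≤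
        C * ‖z - w‖ * (2 * (1 / (2 * M)) * (xR - xL)) := by
      rw [norm_mul, Complex.norm_real]
      refine mul_le_mul ?_ (norm_bendShift_le h hB hc hε _) (norm_nonneg _) (by positivity)
      refine (hC.norm_sub_le _ _).trans ?_
      gcongr
      simpa using Complex.abs_im_le_norm (z - w)
    rw [e]
    refine (norm_add_le _ _).trans ((add_le_add h1 h2).trans (le_of_eq ?_))
    have hk : M * (1 / (2 * M)) = 1 / 2 := by field_simp
    linear_combination ‖z - w‖ * hk - ‖z - w‖ * (1 / (2 * M)) * hM
  obtain ⟨Φ, hΦ, hΦ1, hΦ2⟩ := exists_diffeo_of_perturbation hNs fun z => by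
    have hl : LipschitzWith (1/2) N := LipschitzWith.of_dist_le_mul fun z w => by
      rw [dist_eq_norm, dist_eq_norm]; simpa using hNL z w
    simpa using norm_fderiv_le_of_lipschitz ℝ hl (x₀ := z)
  refine ⟨Φ, hΦ1, hΦ2, fun z hz => ?_, fun z hz => ?_, fun z hz => ?_⟩
  · rw [hΦ, hN]
    simp only
    rw [χ.zero_of_le_dist (by simpa [Real.dist_eq] using hz)]
    simp
  · rw [hΦ, hN]
    simp only
    rw [hz, mul_zero, add_zero]
  · rw [hΦ, hN]
    simp only
    rw [χ.one_of_mem_closedBall (by simpa [Real.dist_eq] using hz)]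
    simp only [bendCurve, hD]
    apply Complex.ext <;> simp
    ring

/-- A tight bending of a boundary arc preserves boundary distances locally. -/
theorem preservesNear_bend {κ a : ℝ} {V : Set ℂ} (hVo : IsOpen V) (hV : LocalGraph κ V g a)
    (hκ : κ ≤ 1 / 10) (hbelow : ∀ z : ℂ, |z.re| < a → |z.im| < a → z.im < g z.re → z ∉ V)
    (h : Envelope g G m xL xR) (hL : -(a / 2) < xL) (hR : xR < a / 2) (hB : Profile m xL xR B)
    (hc : Closes m B xL xR) {Φ : ℂ ≃ₜ ℂ} (h1 : ∀ z : ℂ, a / 2 ≤ |z.im| → Φ z = z)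
    (h2 : ∀ z : ℂ, bendShift g m B xL z.re = 0 → Φ z = z)
    (h3 : ∀ z : ℂ, |z.im| ≤ a / 4 →
      Φ z = bendCurve g m B xL z.re + (z.im - g z.re : ℝ) * Complex.I)
    (y : ℂ) : PreservesNear V (Φ '' V) Φ y := by
  have ha := hV.pos
  obtain ⟨xl, xr, hxl, -, hxr, h0⟩ := h.mem_iff hB
  set S : Set ℂ := {z | z.re ∈ Icc xl xr ∧ |z.im| ≤ a / 2} with hS
  have hScl : IsClosed S := (isClosed_Icc.preimage Complex.continuous_re).inter
    (isClosed_le (Complex.continuous_im.abs) continuous_const)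
  have hΦS : ∀ z ∉ S, Φ z = z := fun z hz => by
    by_cases hre : z.re ∈ Icc xl xr
    · refine h1 z ?_
      by_contra! hlt
      exact hz ⟨hre, hlt.le⟩
    · exact h2 z (bendShift_zero_of_notMem h hB hc hxl hxr h0 hre)
  by_cases hyS : y ∈ S
  swap
  · obtain ⟨s, hs, hsS⟩ := Metric.isOpen_iff.1 hScl.isOpen_compl y hyS
    refine preservesNear_of_isometry (IsometryEquiv.refl ℂ) hs (fun z hz hzV => ?_)
      (fun z hz hzV => ?_) fun z hz => hΦS z (hsS hz)
    · exact ⟨z, hzV, hΦS z (hsS hz)⟩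
    · obtain ⟨w, hw, rfl⟩ := hzV
      have e : Φ (Φ w) = Φ w := hΦS _ (hsS hz)
      have e' : Φ w = w := Φ.injective e
      change Φ w ∈ V
      rwa [e']
  have hxI : y.re ∈ Ioo xL xR := ⟨hxl.trans_le hyS.1.1, hyS.1.2.trans_lt hxr⟩
  have hsmall : ∀ x ∈ Ioo xL xR, |x| < a / 2 ∧ |g x| ≤ a / 20 := fun x hx => by
    have h4 : |x| < a / 2 := _root_.abs_lt.2 ⟨by linarith [hx.1], by linarith [hx.2]⟩
    refine ⟨h4, (hV.abs_le x).trans ?_⟩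
    calc κ * |x| ≤ 1 / 10 * (a / 2) := mul_le_mul hκ h4.le (abs_nonneg _) (by norm_num)
      _ = a / 20 := by ring
  have hmem : ∀ x ∈ Ioo xL xR, ∀ v : ℝ, |v| < a / 8 →
      ((x + g x * Complex.I + v * Complex.I ∈ V) ↔ 0 < v) := fun x hx v hv => by
    obtain ⟨h4, h5⟩ := hsmall x hx
    have hre : (x + g x * Complex.I + v * Complex.I : ℂ).re = x := by simp
    have him : (x + g x * Complex.I + v * Complex.I : ℂ).im = g x + v := by simp
    have hb1 : |(x + g x * Complex.I + v * Complex.I : ℂ).re| < a := by rw [hre]; linarith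
    have hb2 : |(x + g x * Complex.I + v * Complex.I : ℂ).im| < a := by
      rw [him]; have := _root_.abs_add_le (g x) v; linarith
    constructor
    · intro hz
      rcases lt_trichotomy v 0 with hv0 | hv0 | hv0
      · exact absurd hz (hbelow _ hb1 hb2 (by rw [hre, him]; linarith))
      · have := (hV.frontier_iff _ hb1 hb2).2 (by rw [hre, him, hv0, add_zero])
        rw [hVo.frontier_eq] at this
        exact absurd hz this.2
      · exact hv0
    · intro hv0
      exact hV.above _ hb1 hb2 (by rw [hre, him]; linarith)
  have hΦc : ∀ x ∈ Ioo xL xR, ∀ v : ℝ, |v| < a / 8 →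
      Φ (x + g x * Complex.I + v * Complex.I) = bendCurve g m B xL x + v * Complex.I :=
    fun x hx v hv => by
    rw [h3 _ (by
      have := _root_.abs_add_le (g x) v
      have := (hsmall x hx).2
      have e : (x + g x * Complex.I + v * Complex.I : ℂ).im = g x + v := by simp
      rw [e]
      linarith)]
    simp
  have hmem' : ∀ x ∈ Ioo xL xR, ∀ v : ℝ, |v| < a / 8 →
      ((bendCurve g m B xL x + v * Complex.I ∈ Φ '' V) ↔ 0 < v) := fun x hx v hv => by
    rw [← hΦc x hx v hv, Φ.injective.mem_set_image, hmem x hx v hv]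
  have t0 := h.tightBend (profile_zero h)
  have tB := h.tightBend hB
  obtain ⟨r₁, hr₁, hb₁⟩ := bdryDist_le_of_tightBend t0 tB (U := V) (V := Φ '' V) hxI
    (r₀ := a / 8) (by positivity) (fun x hx v hv hz => (hmem x hx v hv).1 (by
      rwa [bendCurve_zero] at hz)) (fun x hx v hv hv' => (hmem' x hx v (by
      rwa [abs_of_pos hv])).2 hv)
  obtain ⟨r₂, hr₂, hb₂⟩ := bdryDist_le_of_tightBend tB t0 (U := Φ '' V) (V := V) hxI
    (r₀ := a / 8) (by positivity) (fun x hx v hv hz => (hmem' x hx v hv).1 hz)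
    (fun x hx v hv hv' => by
      rw [bendCurve_zero]
      exact (hmem x hx v (by rwa [abs_of_pos hv])).2 hv)
  obtain ⟨d, hd, hdI⟩ := Metric.isOpen_iff.1 isOpen_Ioo y.re hxI
  have hpt : ∀ p ∈ frontier V, dist p y < min (min r₁ r₂) (min d (a / 2)) →
      |p.re - y.re| < r₁ ∧ |p.re - y.re| < r₂ ∧ p = bendCurve g m 0 xL p.re ∧
        Φ p = bendCurve g m B xL p.re := fun p hp hpy => by
    have e1 : |p.re - y.re| ≤ dist p y := by
      rw [dist_eq_norm]; simpa using Complex.abs_re_le_norm (p - y)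
    have e2 : |p.im - y.im| ≤ dist p y := by
      rw [dist_eq_norm]; simpa using Complex.abs_im_le_norm (p - y)
    obtain ⟨e3, e4⟩ := lt_min_iff.1 hpy
    obtain ⟨e5, e6⟩ := lt_min_iff.1 e3
    obtain ⟨e7, e8⟩ := lt_min_iff.1 e4
    have hpI : p.re ∈ Ioo xL xR := hdI (by rw [mem_ball, Real.dist_eq]; linarith)
    have him : |p.im| < a := by
      have := _root_.abs_add_le (p.im - y.im) y.im
      rw [sub_add_cancel] at this
      linarith [hyS.2]
    have hgr := (hV.frontier_iff p (by linarith [(hsmall _ hpI).1]) him).1 hp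
    have hp' : p = p.re + g p.re * Complex.I + (0:ℝ) * Complex.I := by
      apply Complex.ext <;> simp [hgr]
    refine ⟨by linarith, by linarith, ?_, ?_⟩
    · rw [bendCurve_zero]
      simpa using hp'
    · have := hΦc p.re hpI 0 (by rw [abs_zero]; positivity)
      rw [← hp'] at this
      simpa using this
  refine ⟨min (min r₁ r₂) (min d (a / 2)), by positivity, fun p hp q hq hpy hqy => ?_⟩
  obtain ⟨p1, p2, p3, p4⟩ := hpt p hp hpy
  obtain ⟨q1, q2, q3, q4⟩ := hpt q hq hqy
  have hr1 : ENNReal.ofReal (min (min r₁ r₂) (min d (a / 2))) ≤ ENNReal.ofReal r₁ :=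
    ENNReal.ofReal_le_ofReal ((min_le_left _ _).trans (min_le_left _ _))
  have hr2 : ENNReal.ofReal (min (min r₁ r₂) (min d (a / 2))) ≤ ENNReal.ofReal r₂ :=
    ENNReal.ofReal_le_ofReal ((min_le_left _ _).trans (min_le_right _ _))
  rw [p4, q4]
  constructor
  · intro hlt
    have := hb₁ p.re q.re p1 q1
    rw [← p3, ← q3] at this
    exact this (hlt.trans_le hr1)
  · intro hlt
    have := hb₂ p.re q.re p2 q2
    rw [← p3, ← q3] at this
    exact this (hlt.trans_le hr2)

end Bending

section Closing

theorem norm_rot_sub_sub_le (u v : ℝ) :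
    ‖rot u - rot v - ((u - v : ℝ) : ℂ) * Complex.I‖ ≤ (|u| + |v|) * |u - v| := by
  have hd : ∀ t ∈ uIcc u v, HasDerivWithinAt (fun t : ℝ => rot t - t * Complex.I)
      (rot t * Complex.I - Complex.I) (uIcc u v) t := fun t _ => by
    have := (hasDerivAt_rot t).sub ((Complex.ofRealCLM.hasDerivAt (x := t)).mul_const Complex.I)
    exact (this.congr_deriv (by simp)).hasDerivWithinAt
  have hb : ∀ t ∈ uIcc u v, ‖rot t * Complex.I - Complex.I‖ ≤ |u| + |v| := fun t ht => by
    have e : rot t * Complex.I - Complex.I = (rot t - 1) * Complex.I := by ring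
    rw [e, norm_mul, Complex.norm_I, mul_one]
    refine (norm_rot_sub_one_le t).trans ?_
    rcases mem_uIcc.1 ht with h | h <;> rw [_root_.abs_le] <;>
      constructor <;> linarith [neg_abs_le u, neg_abs_le v, le_abs_self u, le_abs_self v,
        abs_nonneg u, abs_nonneg v]
  have := Convex.norm_image_sub_le_of_norm_hasDerivWithin_le hd hb (convex_uIcc u v)
    right_mem_uIcc left_mem_uIcc
  refine le_trans (le_of_eq ?_) this
  congr 1
  push_cast
  ring

/-- The displacement produced by bending by the angle `s φ`. -/
def bendDefect (m φ : ℝ → ℝ) (xL xR s : ℝ) : ℂ :=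
  ∫ t in xL..xR, (rot (s * φ t) - 1) * (1 + m t * Complex.I)

variable {m φ : ℝ → ℝ} {xL xR : ℝ}

theorem continuous_rot_comp (hφ : Continuous φ) : Continuous fun t => rot (φ t) :=
  continuous_rot.comp hφ

theorem hasStrictDerivAt_bendDefect (hm : Continuous m) (hφ : Continuous φ)
    (hm1 : ∀ t, |m t| ≤ 1 / 10) (hφ1 : ∀ t, |φ t| ≤ 1) :
    HasStrictDerivAt (bendDefect m φ xL xR)
      ((∫ t in xL..xR, φ t) * Complex.I - ((∫ t in xL..xR, φ t * m t : ℝ) : ℂ)) 0 := by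
  have hw : ∀ s : ℝ, Continuous fun t => (rot (s * φ t) - 1) * (1 + m t * Complex.I) := fun s => by
    have := continuous_rot_comp (hφ.const_mul s)
    fun_prop
  have e : ((∫ t in xL..xR, φ t) * Complex.I - ((∫ t in xL..xR, φ t * m t : ℝ) : ℂ)) =
      ∫ t in xL..xR, (φ t * Complex.I * (1 + m t * Complex.I) : ℂ) := by
    rw [← intervalIntegral.integral_ofReal, ← intervalIntegral.integral_ofReal,
      ← intervalIntegral.integral_mul_const, ← intervalIntegral.integral_sub
        (Continuous.intervalIntegrable (by fun_prop) _ _)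
        (Continuous.intervalIntegrable (by fun_prop) _ _)]
    congr 1
    ext t
    push_cast
    linear_combination (-(φ t * m t : ℂ)) * Complex.I_mul_I
  rw [e]
  refine HasStrictFDerivAt.of_isLittleO (Asymptotics.isLittleO_iff.2 fun ε hε => ?_)
  set C : ℝ := 2 * |xR - xL| + 1 with hC
  have hC0 : 0 < C := by positivity
  have hball : ball (0:ℝ) (ε / (2 * C)) ×ˢ ball (0:ℝ) (ε / (2 * C)) ∈ 𝓝 ((0:ℝ), (0:ℝ)) :=
    prod_mem_nhds (ball_mem_nhds _ (by positivity)) (ball_mem_nhds _ (by positivity))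
  filter_upwards [hball] with p hp
  have h1 : |p.1| < ε / (2 * C) := by simpa [Real.dist_eq] using hp.1
  have h2 : |p.2| < ε / (2 * C) := by simpa [Real.dist_eq] using hp.2
  have e2 : bendDefect m φ xL xR p.1 - bendDefect m φ xL xR p.2 -
      (p.1 - p.2) • (∫ t in xL..xR, (φ t * Complex.I * (1 + m t * Complex.I) : ℂ)) =
      ∫ t in xL..xR, (rot (p.1 * φ t) - rot (p.2 * φ t) -
        ((p.1 * φ t - p.2 * φ t : ℝ) : ℂ) * Complex.I) * (1 + m t * Complex.I) := by
    have hsub : Continuous fun t => (rot (p.1 * φ t) - 1) * (1 + m t * Complex.I) -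
        (rot (p.2 * φ t) - 1) * (1 + m t * Complex.I) := (hw p.1).sub (hw p.2)
    have hlin : Continuous fun t => (p.1 - p.2) •
        (φ t * Complex.I * (1 + m t * Complex.I) : ℂ) := by fun_prop
    rw [bendDefect, bendDefect, ← intervalIntegral.integral_smul,
      ← intervalIntegral.integral_sub ((hw p.1).intervalIntegrable _ _)
        ((hw p.2).intervalIntegrable _ _), ← intervalIntegral.integral_sub
        (hsub.intervalIntegrable _ _) (hlin.intervalIntegrable _ _)]
    congr 1
    ext t
    rw [Complex.real_smul]
    push_cast
    ring
  change ‖bendDefect m φ xL xR p.1 - bendDefect m φ xL xR p.2 -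
      (p.1 - p.2) • (∫ t in xL..xR, (φ t * Complex.I * (1 + m t * Complex.I) : ℂ))‖ ≤ _
  rw [e2]
  have hb : ∀ t ∈ uIoc xL xR, ‖(rot (p.1 * φ t) - rot (p.2 * φ t) -
        ((p.1 * φ t - p.2 * φ t : ℝ) : ℂ) * Complex.I) * (1 + m t * Complex.I)‖ ≤
        2 * ((|p.1| + |p.2|) * |p.1 - p.2|) := fun t _ => by
    rw [norm_mul]
    have h3 := norm_rot_sub_sub_le (p.1 * φ t) (p.2 * φ t)
    have h4 : (|p.1 * φ t| + |p.2 * φ t|) * |p.1 * φ t - p.2 * φ t| ≤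
        (|p.1| + |p.2|) * |p.1 - p.2| := by
      rw [← sub_mul, abs_mul, abs_mul, abs_mul]
      have := hφ1 t
      have h5 : ∀ q : ℝ, |q| * |φ t| ≤ |q| := fun q => mul_le_of_le_one_right (abs_nonneg _) this
      gcongr <;> exact h5 _
    have h6 := norm_one_add_mul_I_le (hm1 t)
    calc _ ≤ ((|p.1| + |p.2|) * |p.1 - p.2|) * (11 / 10) :=
          mul_le_mul (h3.trans h4) h6 (norm_nonneg _) (by positivity)
      _ ≤ _ := by
        have : 0 ≤ (|p.1| + |p.2|) * |p.1 - p.2| := by positivity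
        linarith
  refine (intervalIntegral.norm_integral_le_of_norm_le_const hb).trans ?_
  rw [Real.norm_eq_abs]
  have h7 : (|p.1| + |p.2|) * C ≤ ε := by
    have : |p.1| + |p.2| ≤ ε / C := by
      have : ε / (2 * C) + ε / (2 * C) = ε / C := by field_simp; ring
      linarith
    calc (|p.1| + |p.2|) * C ≤ ε / C * C := by gcongr
      _ = ε := by field_simp
  calc 2 * ((|p.1| + |p.2|) * |p.1 - p.2|) * |xR - xL|
      = (|p.1| + |p.2|) * (2 * |xR - xL|) * |p.1 - p.2| := by ring
    _ ≤ (|p.1| + |p.2|) * C * |p.1 - p.2| := by rw [hC]; gcongr; linarith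
    _ ≤ ε * |p.1 - p.2| := by gcongr

theorem bendDefect_zero : bendDefect m φ xL xR 0 = 0 := by
  simp [bendDefect, rot_zero]

/-- Two bendings at different slopes produce all small displacements. -/
theorem exists_bendDefect_add_eq {φ₂ φ₃ : ℝ → ℝ} (hm : Continuous m) (hm1 : ∀ t, |m t| ≤ 1 / 10)
    (h₂ : Continuous φ₂) (h₂' : ∀ t, |φ₂ t| ≤ 1) (h₃ : Continuous φ₃) (h₃' : ∀ t, |φ₃ t| ≤ 1)
    {s₀ : ℝ} (hA₂ : 0 < ∫ t in xL..xR, φ₂ t) (hA₃ : 0 < ∫ t in xL..xR, φ₃ t)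
    (hM₂ : ∫ t in xL..xR, φ₂ t * m t < s₀ * ∫ t in xL..xR, φ₂ t)
    (hM₃ : s₀ * ∫ t in xL..xR, φ₃ t < ∫ t in xL..xR, φ₃ t * m t) {r : ℝ} (hr : 0 < r) :
    ∃ e > 0, ∀ z : ℂ, ‖z‖ < e → ∃ s₂ s₃, |s₂| ≤ r ∧ |s₃| ≤ r ∧
      bendDefect m φ₂ xL xR s₂ + bendDefect m φ₃ xL xR s₃ = z := by
  set A₂ := ∫ t in xL..xR, φ₂ t
  set A₃ := ∫ t in xL..xR, φ₃ t
  set M₂ := ∫ t in xL..xR, φ₂ t * m t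
  set M₃ := ∫ t in xL..xR, φ₃ t * m t
  set v₂ : ℂ := A₂ * Complex.I - (M₂ : ℂ)
  set v₃ : ℂ := A₃ * Complex.I - (M₃ : ℂ)
  have d₂ := (hasStrictDerivAt_bendDefect (xL := xL) (xR := xR) hm h₂ hm1 h₂').hasStrictFDerivAt
  have d₃ := (hasStrictDerivAt_bendDefect (xL := xL) (xR := xR) hm h₃ hm1 h₃').hasStrictFDerivAt
  set F : ℝ × ℝ → ℂ := fun p => bendDefect m φ₂ xL xR p.1 + bendDefect m φ₃ xL xR p.2
  set F' : ℝ × ℝ →L[ℝ] ℂ := (ContinuousLinearMap.toSpanSingleton ℝ v₂).comp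
      (ContinuousLinearMap.fst ℝ ℝ ℝ) + (ContinuousLinearMap.toSpanSingleton ℝ v₃).comp
      (ContinuousLinearMap.snd ℝ ℝ ℝ) with hF'
  have hF : HasStrictFDerivAt F F' ((0:ℝ), (0:ℝ)) := by
    exact (HasStrictFDerivAt.comp ((0:ℝ), (0:ℝ)) (g := bendDefect m φ₂ xL xR) d₂
      (hasStrictFDerivAt_fst)).add
      (HasStrictFDerivAt.comp ((0:ℝ), (0:ℝ)) (g := bendDefect m φ₃ xL xR) d₃
      (hasStrictFDerivAt_snd))
  have hdet : 0 < A₂ * M₃ - A₃ * M₂ := by nlinarith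
  have hne : A₂ * M₃ - A₃ * M₂ ≠ 0 := hdet.ne'
  have hsurj : F'.range = ⊤ := by
    rw [LinearMap.range_eq_top]
    intro z
    obtain ⟨q₂, hq₂⟩ : ∃ q, q * (A₂ * M₃ - A₃ * M₂) = M₃ * z.im + A₃ * z.re :=
      ⟨_, div_mul_cancel₀ _ hne⟩
    obtain ⟨q₃, hq₃⟩ : ∃ q, q * (A₂ * M₃ - A₃ * M₂) = -(M₂ * z.im) - A₂ * z.re :=
      ⟨_, div_mul_cancel₀ _ hne⟩
    have e₁ : -(q₂ * M₂) - q₃ * M₃ = z.re := by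
      apply mul_right_cancel₀ hne
      linear_combination (-M₂) * hq₂ - M₃ * hq₃
    have e₂ : q₂ * A₂ + q₃ * A₃ = z.im := by
      apply mul_right_cancel₀ hne
      linear_combination A₂ * hq₂ + A₃ * hq₃
    have e : F' (q₂, q₃) = (q₂ : ℂ) * v₂ + q₃ * v₃ := by simp [hF']
    refine ⟨(q₂, q₃), e.trans (Complex.ext ?_ ?_)⟩
    · simp [v₂, v₃]
      linarith
    · simp [v₂, v₃]
      linarith
  have hmap := hF.map_nhds_eq_of_surj hsurj
  have hF0 : F (0, 0) = 0 := by simp [F, bendDefect_zero]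
  have hbox : closedBall (0:ℝ) r ×ˢ closedBall (0:ℝ) r ∈ 𝓝 ((0:ℝ), (0:ℝ)) :=
    prod_mem_nhds (closedBall_mem_nhds _ hr) (closedBall_mem_nhds _ hr)
  have himg := image_mem_map (m := F) hbox
  rw [hmap, hF0] at himg
  obtain ⟨e, he, hsub⟩ := Metric.mem_nhds_iff.1 himg
  refine ⟨e, he, fun z hz => ?_⟩
  obtain ⟨p, hp, hpz⟩ := hsub (mem_ball_zero_iff.2 hz)
  exact ⟨p.1, p.2, by simpa using hp.1, by simpa using hp.2, hpz⟩

end Closing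

section Closing

/-- The tent function of center `c` and radius `d`. -/
def tent (c d θ : ℝ) : ℝ := max 0 (d - |θ - c|)

theorem continuous_tent (c d : ℝ) : Continuous (tent c d) := by
  unfold tent
  fun_prop

theorem tent_nonneg (c d θ : ℝ) : 0 ≤ tent c d θ := le_max_left _ _

theorem tent_le {c d : ℝ} (hd : 0 ≤ d) (θ : ℝ) : tent c d θ ≤ d :=
  max_le hd (by linarith [abs_nonneg (θ - c)])

theorem tent_eq_zero {c d θ : ℝ} (h : d ≤ |θ - c|) : tent c d θ = 0 :=
  max_eq_left (by linarith)

theorem abs_sub_lt_of_tent_pos {c d θ : ℝ} (h : 0 < tent c d θ) : |θ - c| < d := by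
  by_contra hc
  rw [tent_eq_zero (not_lt.1 hc)] at h
  exact lt_irrefl _ h

theorem tent_self_pos {c d : ℝ} (hd : 0 < d) : 0 < tent c d c := by
  simp [tent, hd]

theorem abs_tent_sub_le (c d s t : ℝ) : |tent c d s - tent c d t| ≤ |s - t| := by
  have h := abs_max_sub_max_le_abs (d - |s - c|) (d - |t - c|) 0
  rw [max_comm, max_comm (d - |t - c|)] at h
  refine h.trans ?_
  have h2 := abs_abs_sub_abs_le (t - c) (s - c)
  rw [show d - |s - c| - (d - |t - c|) = |t - c| - |s - c| by ring, abs_sub_comm s t]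
  simpa using h2

variable {g G m : ℝ → ℝ} {xL xR : ℝ}

theorem Envelope.exists_arctan_eq (h : Envelope g G m xL xR) {c : ℝ}
    (h1 : Real.arctan (m xR) ≤ c) (h2 : c ≤ Real.arctan (m xL)) :
    ∃ x ∈ Icc xL xR, Real.arctan (m x) = c :=
  intermediate_value_Icc' h.lt.le (Real.continuous_arctan.comp h.cont).continuousOn ⟨h1, h2⟩

theorem Envelope.integral_tent_mul_pos (h : Envelope g G m xL xR) {c d : ℝ} (hd : 0 < d)
    (h1 : Real.arctan (m xR) ≤ c) (h2 : c ≤ Real.arctan (m xL)) {w : ℝ → ℝ} (hw : Continuous w)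
    (hpos : ∀ t, |Real.arctan (m t) - c| < d → 0 < w t) :
    0 < ∫ t in xL..xR, tent c d (Real.arctan (m t)) * w t := by
  obtain ⟨x, hx, hxc⟩ := h.exists_arctan_eq h1 h2
  have hc : Continuous fun t => tent c d (Real.arctan (m t)) * w t :=
    ((continuous_tent c d).comp (Real.continuous_arctan.comp h.cont)).mul hw
  refine intervalIntegral.integral_pos h.lt hc.continuousOn (fun t _ => ?_) ⟨x, hx, ?_⟩
  · rcases (tent_nonneg c d (Real.arctan (m t))).eq_or_lt with h0 | h0
    · rw [← h0, zero_mul]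
    · exact (mul_pos h0 (hpos t (abs_sub_lt_of_tent_pos h0))).le
  · rw [hxc]
    exact mul_pos (tent_self_pos hd) (hpos x (by rw [hxc, sub_self, abs_zero]; exact hd))

theorem Envelope.exists_closing (h : Envelope g G m xL xR) {ε₀ : ℝ} (hε₀ : 0 < ε₀)
    (hε₀' : ε₀ ≤ 1 / 10) :
    ∃ ε₁ > 0, ∃ t₀ t₁, Real.arctan (m xR) < t₀ ∧ t₀ < t₁ ∧ t₁ < Real.arctan (m xL) ∧
      ∀ B₁ : ℝ → ℝ, Continuous B₁ → (∀ s t, s ≤ t → B₁ s - B₁ t ≤ (t - s) / 3) →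
        (∀ θ, |B₁ θ| ≤ ε₁) → (∀ θ, θ < t₀ ∨ t₁ < θ → B₁ θ = 0) →
        ∃ B, Profile m xL xR B ∧ (∀ θ, |B θ| ≤ ε₀) ∧ Closes m B xL xR ∧
          ∀ θ ∈ Icc t₀ t₁, B θ = B₁ θ := by
  set ΘL := Real.arctan (m xL) with hΘL
  set ΘR := Real.arctan (m xR) with hΘR
  have hΘ : ΘR < ΘL := Real.arctan_strictMono h.drop
  have hL2 : ΘL < Real.pi / 2 := Real.arctan_lt_pi_div_two _
  have hR2 : -(Real.pi / 2) < ΘR := Real.neg_pi_div_two_lt_arctan _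
  have hpi := Real.pi_le_four
  obtain ⟨d, hd⟩ : ∃ d, d = (ΘL - ΘR) / 8 := ⟨_, rfl⟩
  have hd0 : 0 < d := by linarith
  have hd1 : d ≤ 1 := by linarith
  set b₂ := tent (ΘR + 4 * d) d with hb₂
  set b₃ := tent (ΘR + 6 * d) d with hb₃
  have hb₂c : Continuous b₂ := continuous_tent _ _
  have hb₃c : Continuous b₃ := continuous_tent _ _
  have hA : Continuous fun t => Real.arctan (m t) := Real.continuous_arctan.comp h.cont
  set s₀ := Real.tan (ΘR + 5 * d) with hs₀
  have hs₀' : Real.arctan s₀ = ΘR + 5 * d := Real.arctan_tan (by linarith) (by linarith)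
  have hm := h.cont
  have hA₂ := h.integral_tent_mul_pos (c := ΘR + 4 * d) hd0 (by linarith) (by linarith)
    (continuous_const (y := (1:ℝ))) fun _ _ => one_pos
  have hA₃ := h.integral_tent_mul_pos (c := ΘR + 6 * d) hd0 (by linarith) (by linarith)
    (continuous_const (y := (1:ℝ))) fun _ _ => one_pos
  have hM₂ := h.integral_tent_mul_pos (c := ΘR + 4 * d) hd0 (by linarith) (by linarith)
    (w := fun t => s₀ - m t) (by fun_prop) fun t ht => by
      have := (abs_lt.1 ht).2
      exact sub_pos.2 (Real.arctan_strictMono.lt_iff_lt.1 (by rw [hs₀']; linarith))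
  have hM₃ := h.integral_tent_mul_pos (c := ΘR + 6 * d) hd0 (by linarith) (by linarith)
    (w := fun t => m t - s₀) (by fun_prop) fun t ht => by
      have := (abs_lt.1 ht).1
      exact sub_pos.2 (Real.arctan_strictMono.lt_iff_lt.1 (by rw [hs₀']; linarith))
  rw [← hb₂] at hA₂ hM₂
  rw [← hb₃] at hA₃ hM₃
  have hc₂ : Continuous fun t => b₂ (Real.arctan (m t)) := hb₂c.comp hA
  have hc₃ : Continuous fun t => b₃ (Real.arctan (m t)) := hb₃c.comp hA
  have hp₂ : Continuous fun t => b₂ (Real.arctan (m t)) * m t := hc₂.mul hm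
  have hp₃ : Continuous fun t => b₃ (Real.arctan (m t)) * m t := hc₃.mul hm
  simp only [mul_one] at hA₂ hA₃
  have hM₂' : ∫ t in xL..xR, b₂ (Real.arctan (m t)) * m t <
      s₀ * ∫ t in xL..xR, b₂ (Real.arctan (m t)) := by
    have e : ∀ t, b₂ (Real.arctan (m t)) * (s₀ - m t) =
      s₀ * b₂ (Real.arctan (m t)) - b₂ (Real.arctan (m t)) * m t := fun t => by ring
    simp only [e] at hM₂
    rw [intervalIntegral.integral_sub ((hc₂.const_mul s₀).intervalIntegrable _ _)
      (hp₂.intervalIntegrable _ _), intervalIntegral.integral_const_mul] at hM₂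
    linarith
  have hM₃' : s₀ * ∫ t in xL..xR, b₃ (Real.arctan (m t)) <
      ∫ t in xL..xR, b₃ (Real.arctan (m t)) * m t := by
    have e : ∀ t, b₃ (Real.arctan (m t)) * (m t - s₀) =
      b₃ (Real.arctan (m t)) * m t - s₀ * b₃ (Real.arctan (m t)) := fun t => by ring
    simp only [e] at hM₃
    rw [intervalIntegral.integral_sub (hp₃.intervalIntegrable _ _)
      ((hc₃.const_mul s₀).intervalIntegrable _ _), intervalIntegral.integral_const_mul] at hM₃
    linarith
  have hb₂1 : ∀ θ, |b₂ θ| ≤ 1 := fun θ => by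
    rw [abs_of_nonneg (tent_nonneg _ _ _)]; exact (tent_le hd0.le θ).trans hd1
  have hb₃1 : ∀ θ, |b₃ θ| ≤ 1 := fun θ => by
    rw [abs_of_nonneg (tent_nonneg _ _ _)]; exact (tent_le hd0.le θ).trans hd1
  obtain ⟨e, he, hsolve⟩ := exists_bendDefect_add_eq hm h.bound hc₂ (fun t => hb₂1 _) hc₃
    (fun t => hb₃1 _) hA₂ hA₃ hM₂' hM₃' (r := ε₀ / 3) (by positivity)
  have hlt := h.lt
  have hl0 : 0 < xR - xL := by linarith
  set ε₁ := min (ε₀ / 3) (e / (4 * (xR - xL))) with hε₁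
  have hε₁0 : 0 < ε₁ := lt_min (by positivity) (by positivity)
  refine ⟨ε₁, hε₁0, ΘR + d, ΘR + 2 * d, by linarith, by linarith, by linarith,
    fun B₁ hB₁ hmono hB₁ε hsupp => ?_⟩
  have hw₁ := continuous_shift_integrand hm hm hB₁
  obtain ⟨s₂, s₃, hs₂, hs₃, hsum⟩ := hsolve
    (-∫ t in xL..xR, (rot (bendAngle m B₁ t) - 1) * (1 + (m t : ℝ) * Complex.I)) (by
      rw [norm_neg]
      refine (intervalIntegral.norm_integral_le_of_norm_le_const (C := ε₁ * (11 / 10))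
        fun t _ => ?_).trans_lt ?_
      · rw [norm_mul]
        exact mul_le_mul ((norm_rot_sub_one_le _).trans (hB₁ε _)) (norm_one_add_mul_I_le (h.bound t))
          (norm_nonneg _) hε₁0.le
      · rw [abs_of_pos hl0]
        have : ε₁ * (xR - xL) ≤ e / 4 := by
          calc ε₁ * (xR - xL) ≤ e / (4 * (xR - xL)) * (xR - xL) := by
                gcongr; exact min_le_right _ _
            _ = e / 4 := by field_simp
        nlinarith)
  have hz₂ : ∀ θ, θ ≤ ΘR + 3 * d ∨ ΘR + 5 * d ≤ θ → b₂ θ = 0 := fun θ hθ => by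
    apply tent_eq_zero
    rcases hθ with hθ | hθ
    · rw [le_abs]; right; linarith
    · rw [le_abs]; left; linarith
  have hz₃ : ∀ θ, θ ≤ ΘR + 5 * d ∨ ΘR + 7 * d ≤ θ → b₃ θ = 0 := fun θ hθ => by
    apply tent_eq_zero
    rcases hθ with hθ | hθ
    · rw [le_abs]; right; linarith
    · rw [le_abs]; left; linarith
  have hbd : ∀ θ, |B₁ θ + s₂ * b₂ θ + s₃ * b₃ θ| ≤ ε₀ := fun θ => by
    have h1 := (hB₁ε θ).trans (min_le_left _ _)
    have h2 : |s₂ * b₂ θ| ≤ ε₀ / 3 := by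
      rw [abs_mul]; exact (mul_le_of_le_one_right (abs_nonneg _) (hb₂1 θ)).trans hs₂
    have h3 : |s₃ * b₃ θ| ≤ ε₀ / 3 := by
      rw [abs_mul]; exact (mul_le_of_le_one_right (abs_nonneg _) (hb₃1 θ)).trans hs₃
    have := abs_add_three (B₁ θ) (s₂ * b₂ θ) (s₃ * b₃ θ)
    linarith
  refine ⟨fun θ => B₁ θ + s₂ * b₂ θ + s₃ * b₃ θ, ⟨by fun_prop, fun s t hst => ?_,
    fun θ => (hbd θ).trans hε₀', ΘR + d, ΘR + 7 * d, by linarith, by linarith, fun θ hθ => ?_⟩,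
    hbd, ?_, fun θ hθ => ?_⟩
  · have h1 := hmono s t hst
    have key : ∀ (r c : ℝ), |r| ≤ ε₀ / 3 → r * tent c d s - r * tent c d t ≤ (t - s) / 3 := by
      intro r c hr
      have h4 := abs_tent_sub_le c d s t
      rw [abs_sub_comm s t, abs_of_nonneg (by linarith : 0 ≤ t - s)] at h4
      calc r * tent c d s - r * tent c d t = r * (tent c d s - tent c d t) := by ring
        _ ≤ |r * (tent c d s - tent c d t)| := le_abs_self _
        _ = |r| * |tent c d s - tent c d t| := abs_mul _ _
        _ ≤ 1 / 3 * (t - s) := by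
          gcongr
          · linarith
        _ = _ := by ring
    have h2 := key s₂ (ΘR + 4 * d) hs₂
    have h3 := key s₃ (ΘR + 6 * d) hs₃
    rw [← hb₂] at h2
    rw [← hb₃] at h3
    show s + (B₁ s + s₂ * b₂ s + s₃ * b₃ s) ≤ t + (B₁ t + s₂ * b₂ t + s₃ * b₃ t)
    linarith
  · rcases hθ with hθ | hθ
    · rw [hsupp θ (by left; linarith), hz₂ θ (by left; linarith), hz₃ θ (by left; linarith)]
      ring
    · rw [hsupp θ (by right; linarith), hz₂ θ (by right; linarith), hz₃ θ (by right; linarith)]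
      ring
  · have hsplit : ∀ θ, rot (B₁ θ + s₂ * b₂ θ + s₃ * b₃ θ) - 1 =
        (rot (B₁ θ) - 1) + ((rot (s₂ * b₂ θ) - 1) + (rot (s₃ * b₃ θ) - 1)) := fun θ => by
      rcases le_or_gt θ (ΘR + 2 * d) with h1 | h1
      · rw [hz₂ θ (by left; linarith), hz₃ θ (by left; linarith)]
        simp [rot_zero]
      · rw [hsupp θ (by right; exact h1)]
        rcases le_or_gt θ (ΘR + 5 * d) with h2 | h2
        · rw [hz₃ θ (by left; exact h2)]
          simp [rot_zero]
        · rw [hz₂ θ (by right; exact h2.le)]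
          simp [rot_zero]
    have hw₂ := continuous_shift_integrand hm hm (hb₂c.const_mul s₂)
    have hw₃ := continuous_shift_integrand hm hm (hb₃c.const_mul s₃)
    have hw₂₃ : Continuous fun t =>
        (rot (bendAngle m (fun θ => s₂ * b₂ θ) t) - 1) * (1 + (m t : ℝ) * Complex.I) +
        (rot (bendAngle m (fun θ => s₃ * b₃ θ) t) - 1) * (1 + (m t : ℝ) * Complex.I) :=
      hw₂.add hw₃
    have e1 : (∫ t in xL..xR, (rot (bendAngle m (fun θ => B₁ θ + s₂ * b₂ θ + s₃ * b₃ θ) t) - 1) *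
        (1 + (m t : ℝ) * Complex.I)) =
        (∫ t in xL..xR, (rot (bendAngle m B₁ t) - 1) * (1 + (m t : ℝ) * Complex.I)) +
        ((∫ t in xL..xR, (rot (bendAngle m (fun θ => s₂ * b₂ θ) t) - 1) *
          (1 + (m t : ℝ) * Complex.I)) +
        ∫ t in xL..xR, (rot (bendAngle m (fun θ => s₃ * b₃ θ) t) - 1) *
          (1 + (m t : ℝ) * Complex.I)) := by
      rw [← intervalIntegral.integral_add (hw₂.intervalIntegrable _ _)
        (hw₃.intervalIntegrable _ _), ← intervalIntegral.integral_add
        (hw₁.intervalIntegrable _ _) (hw₂₃.intervalIntegrable _ _)]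
      congr 1
      ext t
      simp only [bendAngle]
      rw [hsplit]
      ring
    have e2 : (∫ t in xL..xR, (rot (bendAngle m (fun θ => s₂ * b₂ θ) t) - 1) *
          (1 + (m t : ℝ) * Complex.I)) +
        (∫ t in xL..xR, (rot (bendAngle m (fun θ => s₃ * b₃ θ) t) - 1) *
          (1 + (m t : ℝ) * Complex.I)) =
      -∫ t in xL..xR, (rot (bendAngle m B₁ t) - 1) * (1 + (m t : ℝ) * Complex.I) := hsum
    rw [Closes, e1, e2, add_neg_cancel]
  · simp only
    rw [hz₂ θ (by left; linarith [hθ.2]), hz₃ θ (by left; linarith [hθ.2])]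
    ring

end Closing

section Flatness

/-- All chords of `S` are nearly orthogonal to a fixed direction. -/
def FlatSet (ε : ℝ) (S : Set ℂ) : Prop :=
  ∃ v : ℂ, ‖v‖ = 1 ∧ ∀ q ∈ S, ∀ r ∈ S, |inner ℝ v (q - r)| ≤ ε * ‖q - r‖

theorem FlatSet.mono {ε : ℝ} {S S' : Set ℂ} (h : FlatSet ε S) (hS : S' ⊆ S) : FlatSet ε S' := by
  obtain ⟨v, hv, h⟩ := h
  exact ⟨v, hv, fun q hq r hr => h q (hS hq) r (hS hr)⟩

theorem FlatSet.image_isometry {ε : ℝ} {S : Set ℂ} (h : FlatSet ε S) (J : ℂ ≃ᵢ ℂ) :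
    FlatSet ε (J '' S) := by
  obtain ⟨v, hv, h⟩ := h
  set A := J.toRealAffineIsometryEquiv
  have hA : ∀ q r, J q - J r = A.linearIsometryEquiv (q - r) := fun q r =>
    (A.map_vsub q r).symm
  refine ⟨A.linearIsometryEquiv v, by rw [LinearIsometryEquiv.norm_map, hv], ?_⟩
  rintro _ ⟨q, hq, rfl⟩ _ ⟨r, hr, rfl⟩
  rw [hA, LinearIsometryEquiv.inner_map_map, LinearIsometryEquiv.norm_map]
  exact h q hq r hr

theorem LocalGraph.flatSet {κ a : ℝ} {V : Set ℂ} {g : ℝ → ℝ} (h : LocalGraph κ V g a)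
    (hκ : 0 ≤ κ) : FlatSet κ (frontier V ∩ ball 0 a) := by
  refine ⟨Complex.I, Complex.norm_I, ?_⟩
  have key : ∀ q ∈ frontier V ∩ ball (0:ℂ) a, q.im = g q.re := fun q hq => by
    have hn : ‖q‖ < a := mem_ball_zero_iff.1 hq.2
    exact (h.frontier_iff q ((Complex.abs_re_le_norm q).trans_lt hn)
      ((Complex.abs_im_le_norm q).trans_lt hn)).1 hq.1
  intro q hq r hr
  have e : inner ℝ Complex.I (q - r) = g q.re - g r.re := by
    rw [Complex.inner, ← key q hq, ← key r hr]
    simp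
  rw [e]
  refine (abs_sub_le_of_deriv_le h.smooth h.deriv_le _ _).trans ?_
  have := Complex.abs_re_le_norm (q - r)
  rw [Complex.sub_re] at this
  gcongr

theorem exists_uniform_flatSet {Z : Type*} [NormedAddCommGroup Z] [NormedSpace ℝ Z] {U : Set ℂ}
    (hU : IsOpen U) (hbd : Bornology.IsBounded U) (hb : HasSmoothBdry Z U) {ε : ℝ} (hε : 0 < ε) :
    ∃ δ > 0, ∀ p ∈ frontier U, FlatSet ε (frontier U ∩ ball p δ) := by
  have hloc : ∀ p ∈ frontier U, ∃ a > 0, FlatSet ε (frontier U ∩ ball p a) := fun p hp => by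
    obtain ⟨T, g, a, hT, hg⟩ := exists_localGraph hU hb hp (κ := min ε (1 / 2))
      (lt_min hε (by norm_num)) ((min_le_right _ _).trans_lt (by norm_num))
    refine ⟨a, hg.pos, ?_⟩
    have hf := (hg.flatSet (le_min hε.le (by norm_num))).image_isometry T.symm
    have hf' : FlatSet ε (T.symm '' (frontier (T '' U) ∩ ball 0 a)) := by
      obtain ⟨v, hv, h⟩ := hf
      exact ⟨v, hv, fun q hq r hr => (h q hq r hr).trans
        (mul_le_mul_of_nonneg_right (min_le_left _ _) (norm_nonneg _))⟩
    refine hf'.mono fun q hq => ⟨T q, ⟨?_, ?_⟩, T.symm_apply_apply q⟩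
    · rw [frontier_image_isometry]
      exact mem_image_of_mem _ hq.1
    · rw [mem_ball, ← hT, T.dist_eq]
      exact hq.2
  choose! a ha hflat using hloc
  have hcomp : IsCompact (frontier U) :=
    hbd.isCompact_closure.of_isClosed_subset isClosed_frontier frontier_subset_closure
  obtain ⟨δ, hδ, h⟩ := lebesgue_number_lemma_of_metric hcomp
    (c := fun p : frontier U => ball (p : ℂ) (a p)) (fun _ => isOpen_ball)
    (fun p hp => mem_iUnion.2 ⟨⟨p, hp⟩, mem_ball_self (ha p hp)⟩)
  refine ⟨δ, hδ, fun p hp => ?_⟩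
  obtain ⟨i, hi⟩ := h p hp
  exact (hflat i i.2).mono (inter_subset_inter_right _ hi)

theorem abs_inner_hasDerivAt_le {c : ℝ → ℂ} {τ v : ℂ} {x ε : ℝ} {S : Set ℂ}
    (hc : HasDerivAt c τ x) (hS : ∀ᶠ t in 𝓝 x, c t ∈ S)
    (h : ∀ q ∈ S, ∀ r ∈ S, |inner ℝ v (q - r)| ≤ ε * ‖q - r‖) :
    |inner ℝ v τ| ≤ ε * ‖τ‖ := by
  have ht := hasDerivAt_iff_tendsto_slope.1 hc
  have h1 : Tendsto (fun t => |inner ℝ v (slope c x t)|) (𝓝[≠] x) (𝓝 |inner ℝ v τ|) :=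
    ((tendsto_const_nhds (x := v)).inner ht).abs
  have h2 : Tendsto (fun t => ε * ‖slope c x t‖) (𝓝[≠] x) (𝓝 (ε * ‖τ‖)) := ht.norm.const_mul ε
  refine le_of_tendsto_of_tendsto h1 h2 ?_
  filter_upwards [nhdsWithin_le_nhds hS] with t ht
  rw [slope_def_module, real_inner_smul_right, abs_mul, norm_smul, Real.norm_eq_abs]
  have := h _ ht _ hS.self_of_nhds
  calc |(t - x)⁻¹| * |inner ℝ v (c t - c x)| ≤ |(t - x)⁻¹| * (ε * ‖c t - c x‖) := by gcongr
    _ = _ := by ring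

theorem abs_sin_le_of_inner {v : ℂ} (hv : ‖v‖ = 1) {ε a b : ℝ} (hε : ε ≤ 1 / 2)
    (ha : |inner ℝ v (rot a)| ≤ ε) (hb : |inner ℝ v (rot b)| ≤ ε) : |Real.sin (b - a)| ≤ 4 * ε := by
  rw [Complex.inner] at ha hb
  simp only [Complex.mul_re, Complex.conj_re, Complex.conj_im, rot_re, rot_im] at ha hb
  have hv2 : v.re ^ 2 + v.im ^ 2 = 1 := by
    have := Complex.sq_norm v
    rw [hv, Complex.normSq_apply] at this
    linarith
  set p := Real.cos a * v.re - Real.sin a * -v.im with hp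
  set q := Real.cos b * v.re - Real.sin b * -v.im with hq
  set n := v.im * Real.cos a - v.re * Real.sin a with hn
  have h1 : q = Real.cos (b - a) * p + Real.sin (b - a) * n := by
    rw [Real.cos_sub, Real.sin_sub, hp, hn, hq]
    have := Real.sin_sq_add_cos_sq a
    linear_combination (-(v.re * Real.cos b + v.im * Real.sin b)) * this
  have h2 : p ^ 2 + n ^ 2 = 1 := by
    rw [hp, hn]
    have := Real.sin_sq_add_cos_sq a
    linear_combination (v.re ^ 2 + v.im ^ 2) * this + hv2
  have h3 : 1 / 2 ≤ |n| := by
    have : p ^ 2 ≤ (1 / 2) ^ 2 := sq_le_sq.2 (by rw [abs_of_nonneg (by norm_num : (0:ℝ) ≤ 1 / 2)]; linarith)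
    have h4 : (1 / 2 : ℝ) ^ 2 ≤ n ^ 2 := by linarith
    simpa using sq_le_sq.1 h4
  have h4 : |Real.sin (b - a)| * |n| ≤ 2 * ε := by
    rw [← abs_mul]
    have e : Real.sin (b - a) * n = q - Real.cos (b - a) * p := by linarith
    rw [e]
    have h5 : |Real.cos (b - a) * p| ≤ ε := by
      rw [abs_mul]
      exact (mul_le_of_le_one_left (abs_nonneg _) (Real.abs_cos_le_one _)).trans ha
    have := abs_sub q (Real.cos (b - a) * p)
    linarith
  nlinarith [abs_nonneg (Real.sin (b - a))]

end Flatness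

section Noncongruence

variable {g G m B : ℝ → ℝ} {xL xR : ℝ}

/-- There are two nearby contact points where the tangent angle descends to a given value and is
slightly above it. -/
theorem Envelope.exists_contact_pair (h : Envelope g G m xL xR) {θ : ℝ}
    (h1 : Real.arctan (m xR) < θ) (h2 : θ < Real.arctan (m xL)) {δ ε : ℝ} (hδ : 0 < δ)
    (hε : 0 < ε) :
    ∃ x₁ ∈ Icc xL xR, ∃ x₂ ∈ Icc xL xR, |x₁ - x₂| < δ ∧ g x₁ = G x₁ ∧ g x₂ = G x₂ ∧
      Real.arctan (m x₂) = θ ∧ θ < Real.arctan (m x₁) ∧ Real.arctan (m x₁) < θ + ε := by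
  have hlt := h.lt
  have hA : Continuous fun t => Real.arctan (m t) := Real.continuous_arctan.comp h.cont
  have hanti : ∀ {s t}, s ≤ t → Real.arctan (m t) ≤ Real.arctan (m s) := fun hst =>
    Real.arctan_strictMono.monotone (h.anti hst)
  set S := {x | Real.arctan (m x) = θ} ∩ Icc xL xR with hS
  have hSne : S.Nonempty := by
    obtain ⟨x, hx, hxθ⟩ := h.exists_arctan_eq h1.le h2.le
    exact ⟨x, hxθ, hx⟩
  have hScl : IsCompact S := isCompact_Icc.inter_left (isClosed_eq hA continuous_const)
  obtain ⟨x, ⟨hxθ, hxI⟩, hmin⟩ := hScl.exists_isLeast hSne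
  have hxθ' : Real.arctan (m x) = θ := hxθ
  have hxL : xL < x := lt_of_le_of_ne hxI.1 fun he => by
    rw [← he] at hxθ'
    exact h2.ne' hxθ'
  have hgt : ∀ t, xL ≤ t → t < x → θ < Real.arctan (m t) := fun t ht htx => by
    refine lt_of_le_of_ne (hxθ' ▸ hanti htx.le) fun he => ?_
    exact (hmin ⟨he.symm, ht, htx.le.trans hxI.2⟩).not_gt htx
  obtain ⟨ρ, hρ, hball⟩ := Metric.isOpen_iff.1 (isOpen_lt hA continuous_const :
    IsOpen {t | Real.arctan (m t) < θ + ε}) x (by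
      show Real.arctan (m x) < θ + ε
      linarith)
  have hcon : ∀ y, xL ≤ y → y < x → ∃ s, y ≤ s ∧ s < x ∧ g s = G s := fun y hy hyx => by
    by_contra! hc
    have hI : ∀ t ∈ Ico y x, t ∈ Icc xL xR := fun t ht =>
      ⟨hy.trans ht.1, ht.2.le.trans hxI.2⟩
    have hconst : ∀ t ∈ Ico y x, m t = m y := fun t ht =>
      (h.gap y (hI y ⟨le_rfl, hyx⟩) t (hI t ht) ht.1 fun s hs =>
        have hs' : s ∈ Ico y x := ⟨hs.1, hs.2.trans_lt ht.2⟩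
        lt_of_le_of_ne (h.le s (hI s hs')) (hc s hs'.1 hs'.2)).symm
    have hx : m x = m y := by
      have hcl : x ∈ closure (Ico y x) := by
        rw [closure_Ico hyx.ne]
        exact ⟨hyx.le, le_rfl⟩
      exact (isClosed_eq h.cont continuous_const :
        IsClosed {t | m t = m y}).closure_subset_iff.2 hconst hcl
    have h3 := hgt y hy hyx
    rw [← hx, hxθ'] at h3
    exact lt_irrefl _ h3
  have hxG : g x = G x := by
    by_contra hne
    have hltG : g x < G x := lt_of_le_of_ne (h.le x hxI) hne
    obtain ⟨l, hl, hsub⟩ := exists_Ioc_subset_of_mem_nhds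
      (h.smooth.continuous.continuousAt.eventually_lt (h.hasDerivAt x hxI).continuousAt hltG)
      ⟨xL, hxL⟩
    obtain ⟨s, hs1, hs2, hs3⟩ := hcon (max xL ((l + x) / 2)) (le_max_left _ _)
      (max_lt hxL (by linarith))
    have h4 : l < s := lt_of_lt_of_le (by linarith) ((le_max_right _ _).trans hs1)
    have h5 : g s < G s := hsub ⟨h4, hs2.le⟩
    exact h5.ne hs3
  have hδρ : 0 < min δ ρ := lt_min hδ hρ
  obtain ⟨s, hs1, hs2, hs3⟩ := hcon (max xL (x - min δ ρ / 2)) (le_max_left _ _)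
      (max_lt hxL (by linarith))
  have hsL : xL ≤ s := (le_max_left _ _).trans hs1
  have hsd : x - min δ ρ / 2 ≤ s := (le_max_right _ _).trans hs1
  have habs : |s - x| < min δ ρ := by
    rw [_root_.abs_lt]
    constructor <;> linarith
  exact ⟨s, ⟨hsL, hs2.le.trans hxI.2⟩, x, hxI, habs.trans_le (min_le_left _ _), hs3, hxG, hxθ',
    hgt s hsL hs2, hball (by rw [mem_ball, Real.dist_eq]; exact habs.trans_le (min_le_right _ _))⟩

theorem one_add_mul_I_eq (s : ℝ) :
    (1 + s * Complex.I : ℂ) = (Real.sqrt (1 + s ^ 2) : ℂ) * rot (Real.arctan s) := by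
  have h0 : Real.sqrt (1 + s ^ 2) ≠ 0 := (Real.sqrt_pos.2 (by positivity)).ne'
  apply Complex.ext
  · simp [rot_re, rot_im, Real.cos_arctan, h0]
  · simp [rot_re, rot_im, Real.sin_arctan]
    field_simp

theorem abs_inner_rot_le {v : ℂ} {α s ε : ℝ}
    (h : |inner ℝ v (rot α * (1 + s * Complex.I))| ≤ ε * ‖rot α * (1 + s * Complex.I)‖) :
    |inner ℝ v (rot (α + Real.arctan s))| ≤ ε := by
  have h0 : 0 < Real.sqrt (1 + s ^ 2) := Real.sqrt_pos.2 (by positivity)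
  have e : rot α * (1 + s * Complex.I) = Real.sqrt (1 + s ^ 2) • rot (α + Real.arctan s) := by
    rw [one_add_mul_I_eq, rot_add, Complex.real_smul]
    ring
  rw [e, real_inner_smul_right, norm_smul, norm_rot, abs_mul, Real.norm_eq_abs, abs_of_pos h0,
    mul_one, mul_comm ε] at h
  exact le_of_mul_le_mul_left h h0

/-- A ramp of height about `ε`, rising quickly over `[0, η]` and decaying at slope `-1/3`. -/
def ramp (ε η t : ℝ) : ℝ := max 0 (min (ε * (t / η)) (ε - t / 3))

theorem continuous_ramp (ε η : ℝ) : Continuous (ramp ε η) := by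
  unfold ramp
  fun_prop

theorem ramp_sub_le {ε η : ℝ} (hε : 0 < ε) (hη : 0 < η) {s t : ℝ} (hst : s ≤ t) :
    ramp ε η s - ramp ε η t ≤ (t - s) / 3 := by
  have h1 : ε * (s / η) ≤ ε * (t / η) := by gcongr
  unfold ramp
  rw [sub_le_iff_le_add]
  refine max_le ?_ ?_
  · have := le_max_left 0 (min (ε * (t / η)) (ε - t / 3))
    linarith
  · have h2 := le_max_right 0 (min (ε * (t / η)) (ε - t / 3))
    rcases min_cases (ε * (t / η)) (ε - t / 3) with ⟨h3, -⟩ | ⟨h3, -⟩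
    · have := min_le_left (ε * (s / η)) (ε - s / 3)
      linarith
    · have := min_le_right (ε * (s / η)) (ε - s / 3)
      linarith

theorem abs_ramp_le {ε η : ℝ} (hε : 0 < ε) (hη : 0 < η) (t : ℝ) : |ramp ε η t| ≤ ε := by
  rw [abs_of_nonneg (le_max_left _ _)]
  refine max_le hε.le ?_
  rcases le_total t 0 with ht | ht
  · exact (min_le_left _ _).trans ((mul_nonpos_of_nonneg_of_nonpos hε.le
      (div_nonpos_of_nonpos_of_nonneg ht hη.le)).trans hε.le)
  · exact (min_le_right _ _).trans (by linarith)

theorem ramp_eq_zero {ε η : ℝ} (hε : 0 < ε) (hη : 0 < η) {t : ℝ} (ht : t ≤ 0 ∨ 3 * ε ≤ t) :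
    ramp ε η t = 0 := by
  refine max_eq_left ?_
  rcases ht with ht | ht
  · exact (min_le_left _ _).trans (mul_nonpos_of_nonneg_of_nonpos hε.le
      (div_nonpos_of_nonpos_of_nonneg ht hη.le))
  · exact (min_le_right _ _).trans (by linarith)

theorem ramp_self {ε η : ℝ} (hη : 0 < η) (hηε : η < ε) : ramp ε η η = ε - η / 3 := by
  rw [ramp, div_self hη.ne', mul_one, min_eq_right (by linarith), max_eq_right (by linarith)]

theorem hasDeformation_of_envelope {Z : Type*} [NormedAddCommGroup Z] [NormedSpace ℝ Z]
    {κ a : ℝ} {V : Set ℂ} (hVo : IsOpen V) (hbd : Bornology.IsBounded V) (hb : HasSmoothBdry Z V)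
    (hV : LocalGraph κ V g a) (hκ : κ ≤ 1 / 10)
    (hbelow : ∀ z : ℂ, |z.re| < a → |z.im| < a → z.im < g z.re → z ∉ V)
    (h : Envelope g G m xL xR) (hL : -(a / 2) < xL) (hR : xR < a / 2) : HasDeformation V := by
  have ha := hV.pos
  obtain ⟨ε₀, hε₀, hdiffeo⟩ := exists_bend_diffeo ha h
  obtain ⟨ε₁, hε₁, t₀, t₁, ht₀, ht₀₁, ht₁, hclose⟩ := h.exists_closing
    (lt_min hε₀ (by norm_num : (0:ℝ) < 1 / 10)) (min_le_right _ _)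
  obtain ⟨ε, hε, hεε₁, hεt, hε1⟩ : ∃ ε > 0, ε ≤ ε₁ ∧ 3 * ε ≤ t₁ - t₀ ∧ ε ≤ 1 / 4 := by
    refine ⟨min ε₁ (min ((t₁ - t₀) / 3) (1 / 4)),
      lt_min hε₁ (lt_min (by linarith) (by norm_num)), min_le_left _ _, ?_,
      (min_le_right _ _).trans (min_le_right _ _)⟩
    have := (min_le_right ε₁ (min ((t₁ - t₀) / 3) (1 / 4))).trans (min_le_left _ _)
    linarith
  obtain ⟨δ, hδ, hflat⟩ := exists_uniform_flatSet hVo hbd hb (show 0 < ε / 100 by positivity)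
  obtain ⟨x₁, hx₁, x₂, hx₂, hd, hg₁, hg₂, hθ₂, hθ₁, hθ₁'⟩ :=
    h.exists_contact_pair ht₀ (ht₀₁.trans ht₁) (half_pos hδ) hε
  set η := Real.arctan (m x₁) - t₀ with hη
  have hη0 : 0 < η := by linarith
  have hηε : η < ε := by linarith
  obtain ⟨B, hB, hBε, hBc, hBeq⟩ := hclose (fun θ => ramp ε η (θ - t₀))
    ((continuous_ramp ε η).comp (by fun_prop))
    (fun s t hst => (ramp_sub_le hε hη0 (by linarith)).trans_eq (by ring))
    (fun θ => (abs_ramp_le hε hη0 _).trans hεε₁)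
    (fun θ hθ => ramp_eq_zero hε hη0 (hθ.imp (fun _ => by linarith) fun _ => by linarith))
  obtain ⟨Φ, hΦ1, hΦ2, hΦim, hΦ0, hΦc⟩ := hdiffeo B hB
    (fun θ => (hBε θ).trans (min_le_left _ _)) hBc
  refine ⟨Φ, hΦ1, hΦ2, fun y _ => preservesNear_bend hVo hV hκ hbelow h hL hR hB hBc hΦim hΦ0 hΦc y,
    ?_⟩
  rintro ⟨J, hJ⟩
  set c := bendCurve g m B xL with hc
  have hcd := hasDerivAt_bendCurve (xL := xL) h.smooth h.cont hB.cont
  have hfr : ∀ x, |x| < a / 2 → ∃ q ∈ frontier V, J q = c x := fun x hx => by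
    have hgx : |g x| ≤ a / 4 := by
      have h1 := hV.abs_le x
      nlinarith [abs_nonneg x]
    have hmem : (x + g x * Complex.I : ℂ) ∈ frontier V := by
      refine (hV.frontier_iff _ ?_ ?_).2 ?_
      · simpa using hx.trans (by linarith)
      · simpa using hgx.trans_lt (by linarith)
      · simp
    have e : Φ (x + g x * Complex.I) = c x := by
      rw [hΦc _ (by simpa using hgx)]
      simp [hc]
    have h2 : c x ∈ frontier (Φ '' V) := by
      rw [← e, ← Φ.image_frontier]
      exact mem_image_of_mem _ hmem
    rw [← hJ, frontier_image_isometry] at h2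
    exact h2
  have habs : ∀ x ∈ Icc xL xR, |x| < a / 2 := fun x hx =>
    _root_.abs_lt.2 ⟨hL.trans_le hx.1, hx.2.trans_lt hR⟩
  obtain ⟨p, hp, hpc⟩ := hfr x₂ (habs x₂ hx₂)
  obtain ⟨v, hv, hvS⟩ := (hflat p hp).image_isometry J
  have hev : ∀ x ∈ Icc xL xR, dist (c x) (c x₂) < δ →
      ∀ᶠ t in 𝓝 x, c t ∈ J '' (frontier V ∩ ball p δ) := fun x hx hxd => by
    have h1 : ∀ᶠ t in 𝓝 x, |t| < a / 2 :=
      continuous_abs.continuousAt.eventually_lt continuousAt_const (habs x hx)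
    have h2 : ∀ᶠ t in 𝓝 x, dist (c t) (c x₂) < δ :=
      ((hcd x).continuousAt.dist continuousAt_const).eventually_lt continuousAt_const hxd
    filter_upwards [h1, h2] with t ht1 ht2
    obtain ⟨q, hq, hqc⟩ := hfr t ht1
    exact ⟨q, ⟨hq, by rw [mem_ball, ← J.dist_eq, hqc, hpc]; exact ht2⟩, hqc⟩
  have hd' : dist (c x₁) (c x₂) < δ := by
    rw [dist_eq_norm]
    have := (h.tightBend hB).toBentCurve.norm_sub_le x₁ x₂
    linarith
  have key : ∀ x ∈ Icc xL xR, dist (c x) (c x₂) < δ → g x = G x →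
      |inner ℝ v (rot (bendAngle m B x + Real.arctan (m x)))| ≤ ε / 100 := fun x hx hxd hgx => by
    rw [h.contact x hx hgx]
    exact abs_inner_rot_le (abs_inner_hasDerivAt_le (hcd x) (hev x hx hxd) hvS)
  have k₁ := key x₁ hx₁ hd' hg₁
  have k₂ := key x₂ hx₂ (by rw [dist_self]; exact hδ) hg₂
  have hsin := abs_sin_le_of_inner hv (by linarith) k₂ k₁
  have hB₁ : bendAngle m B x₁ = ε - η / 3 := by
    rw [bendAngle, hBeq _ ⟨hθ₁.le, by linarith⟩, ← hη, ramp_self hη0 hηε]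
  have hB₂ : bendAngle m B x₂ = 0 := by
    rw [bendAngle, hθ₂, hBeq _ ⟨le_rfl, ht₀₁.le⟩, sub_self, ramp_eq_zero hε hη0 (Or.inl le_rfl)]
  rw [hB₁, hB₂, hθ₂] at hsin
  have hν : ε - η / 3 + Real.arctan (m x₁) - (0 + t₀) = ε + 2 / 3 * η := by
    rw [hη]; ring
  rw [hν] at hsin
  have hν0 : 0 < ε + 2 / 3 * η := by linarith
  have hν1 : ε + 2 / 3 * η ≤ 1 := by linarith
  have h3 := Real.sin_gt_sub_cube hν0
  have h4 := le_abs_self (Real.sin (ε + 2 / 3 * η))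
  have h5 := pow_le_of_le_one hν0.le hν1 three_ne_zero
  linarith

end Noncongruence

section Nonconvex

variable {Z : Type*} [NormedAddCommGroup Z] [NormedSpace ℝ Z]

/-- An open set lying above the graph of a convex function is locally convex. -/
theorem LocalGraph.convex_inter_ball {κ a : ℝ} {V : Set ℂ} {g : ℝ → ℝ} (h : LocalGraph κ V g a)
    (hVo : IsOpen V) (hbelow : ∀ z : ℂ, |z.re| < a → |z.im| < a → z.im < g z.re → z ∉ V)
    (hg : ConvexOn ℝ (Ioo (-(a / 2)) (a / 2)) g) : Convex ℝ (V ∩ ball 0 (a / 2)) := by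
  have ha := h.pos
  have heq : V ∩ ball 0 (a / 2) =
      {z : ℂ | z.re ∈ Ioo (-(a / 2)) (a / 2) ∧ g z.re < z.im} ∩ ball 0 (a / 2) := by
    ext z
    simp only [mem_inter_iff, mem_ofPred_eq, and_congr_left_iff, mem_ball_zero_iff]
    intro hz
    have h1 := (Complex.abs_re_le_norm z).trans_lt hz
    have h2 := (Complex.abs_im_le_norm z).trans_lt hz
    have h1' : |z.re| < a := by linarith
    have h2' : |z.im| < a := by linarith
    refine ⟨fun hzV => ⟨_root_.abs_lt.1 h1, ?_⟩, fun hz => h.above z h1' h2' hz.2⟩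
    rcases lt_trichotomy z.im (g z.re) with h' | h' | h'
    · exact absurd hzV (hbelow z h1' h2' h')
    · have := (h.frontier_iff z h1' h2').2 h'
      exact absurd hzV (hVo.frontier_eq ▸ this).2
    · exact h'
  rw [heq]
  refine Convex.inter ?_ (convex_ball 0 _)
  rintro z ⟨hz1, hz2⟩ w ⟨hw1, hw2⟩ s t hs ht hst
  have h1 := hg.1 hz1 hw1 hs ht hst
  have h2 := hg.2 hz1 hw1 hs ht hst
  simp only [smul_eq_mul] at h1 h2
  refine ⟨by simpa using h1, ?_⟩
  have e1 : (s • z + t • w).re = s * z.re + t * w.re := by simp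
  have e2 : (s • z + t • w).im = s * z.im + t * w.im := by simp
  rw [e1, e2]
  refine h2.trans_lt ?_
  rcases hs.eq_or_lt with rfl | hs'
  · have : t = 1 := by linarith
    subst this; simpa using hw2
  · nlinarith [mul_lt_mul_of_pos_left hz2 hs', mul_le_mul_of_nonneg_left hw2.le ht]

theorem convex_of_convex_image_isometry (T : ℂ ≃ᵢ ℂ) {S : Set ℂ} (h : Convex ℝ (T '' S)) :
    Convex ℝ S := by
  have := h.affine_preimage T.toRealAffineIsometryEquiv.toAffineEquiv.toAffineMap
  have e : (T.toRealAffineIsometryEquiv.toAffineEquiv.toAffineMap : ℂ → ℂ) = T := by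
    ext z; simp
  rwa [e, preimage_image_eq _ T.injective] at this

theorem hasDeformation_of_not_convex {U : Set ℂ} (hU : IsOpen U) (hc : IsConnected U)
    (hbd : Bornology.IsBounded U) (hb : HasSmoothBdry Z U) (hnc : ¬ Convex ℝ U) :
    HasDeformation U := by
  by_cases hin : (innerBdry U).Nonempty
  · exact hasDeformation_of_innerBdry hU hc.nonempty hbd hb hin
  obtain ⟨q, hq, hqr⟩ : ∃ q ∈ frontier U, ∀ r > 0, ¬ Convex ℝ (U ∩ ball q r) := by
    by_contra! H
    exact hnc (convex_of_locally_convex hU hc.isPreconnected H)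
  obtain ⟨T, g, a, hT, hV⟩ := exists_localGraph hU hb hq (κ := 1 / 10) (by norm_num) (by norm_num)
  have ha := hV.pos
  have hVo : IsOpen (T '' U) := T.toHomeomorph.isOpenMap _ hU
  have hbelow : ∀ z : ℂ, |z.re| < a → |z.im| < a → z.im < g z.re → z ∉ T '' U := by
    refine hV.below.resolve_left fun hbl => hin ?_
    have h0 : (0:ℂ) ∈ innerBdry (T '' U) := by
      refine ⟨(frontier_image_isometry T U).symm ▸ ⟨q, hq, hT⟩, mem_interior.2
        ⟨_, hV.subset_closure hbl, isOpen_square a, by simp [ha]⟩⟩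
    rw [show innerBdry (T '' U) = T '' innerBdry U from innerBdry_image T.toHomeomorph U] at h0
    obtain ⟨p, hp, -⟩ := h0
    exact ⟨p, hp⟩
  refine HasDeformation.of_image T ?_
  obtain ⟨x₀, z, x₁, h0, hx₁, h01, h02, hs⟩ : ∃ x₀ z x₁ : ℝ, -(a / 2) < x₀ ∧ x₁ < a / 2 ∧
      x₀ < z ∧ z < x₁ ∧ (g x₁ - g z) * (z - x₀) < (g z - g x₀) * (x₁ - z) := by
    by_contra! H
    refine hqr (a / 2) (by positivity) (convex_of_convex_image_isometry T ?_)
    rw [image_inter T.injective, T.image_ball, hT]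
    refine hV.convex_inter_ball hVo hbelow (convexOn_of_slope_mono_adjacent (convex_Ioo _ _) ?_)
    intro x y z hx hz hxy hyz
    rw [div_le_div_iff₀ (by linarith) (by linarith)]
    exact H x y z hx.1 hz.2 hxy hyz
  obtain ⟨xL, xR, G, m, hL, hR, hE⟩ := exists_envelope hV.smooth hV.deriv_le le_rfl h01 h02 hs
  have hbd' : Bornology.IsBounded (T '' U) := by
    exact ((hbd.isCompact_closure).image T.continuous).isBounded.subset
      (image_mono subset_closure)
  exact hasDeformation_of_envelope hVo hbd' (hb.image_isometry T) hV le_rfl hbelow hE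
    (h0.trans hL) (hR.trans hx₁)

end Nonconvex

/-- a bounded nonconvex plane domain with smooth boundary is not
uniquely determined, in the class of all bounded plane domains with smooth
boundaries, by the condition of local isometry of boundaries in the relative
metrics. -/
theorem bounded_nonconvex_not_uniquely_determined
    (U : Set (EuclideanSpace ℝ (Fin 2)))
    (hU : IsDomainSet U) (hUbd : Bornology.IsBounded U)
    (hUnconv : ¬ Convex ℝ U) (hUb : HasC1Boundary U) :
    ∃ V : Set (EuclideanSpace ℝ (Fin 2)), IsDomainSet V ∧
      Bornology.IsBounded V ∧ HasC1Boundary V ∧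
      (∃ f : EuclideanSpace ℝ (Fin 2) → EuclideanSpace ℝ (Fin 2),
        IsBoundaryLocalIsometry U V f) ∧
      ¬ ∃ J : EuclideanSpace ℝ (Fin 2) ≃ᵢ EuclideanSpace ℝ (Fin 2), J '' U = V := by
  set L : EuclideanSpace ℝ (Fin 2) ≃ₗᵢ[ℝ] ℂ := Complex.orthonormalBasisOneI.repr.symm
  set E : EuclideanSpace ℝ (Fin 2) ≃ᵢ ℂ := L.toIsometryEquiv
  have hW : IsOpen (E '' U) := E.toHomeomorph.isOpenMap _ hU.1
  have hWc : IsConnected (E '' U) := hU.2.image _ E.continuous.continuousOn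
  have hWbd : Bornology.IsBounded (E '' U) := E.isometry.lipschitz.isBounded_image hUbd
  have hWb : HasSmoothBdry (EuclideanSpace ℝ (Fin 2)) (E '' U) :=
    HasSmoothBdry.image_isometry ((hasC1Boundary_iff U).1 hUb) E
  have hWn : ¬ Convex ℝ (E '' U) := fun h => hUnconv <| by
    have := h.linear_preimage L.toLinearEquiv.toLinearMap
    rwa [show (L.toLinearEquiv.toLinearMap : EuclideanSpace ℝ (Fin 2) → ℂ) = E from rfl,
      preimage_image_eq _ E.injective] at this
  obtain ⟨Φ, h1, h2, h3, h4⟩ := hasDeformation_of_not_convex hW hWc hWbd hWb hWn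
  obtain ⟨hD, hDc, hDbd, hDb, hbij⟩ := diffeo_image hW hWc hWbd hWb Φ h1 h2
  have hfr : frontier (E '' U) = E '' frontier U := (E.toHomeomorph.image_frontier U).symm
  refine ⟨E.symm '' (Φ '' (E '' U)), ⟨E.symm.toHomeomorph.isOpenMap _ hD,
    hDc.image _ E.symm.continuous.continuousOn⟩, E.symm.isometry.lipschitz.isBounded_image hDbd,
    (hasC1Boundary_iff _).2 (hDb.image_isometry E.symm),
    ⟨fun x => E.symm (Φ (E x)), ?_, fun y hy => ?_⟩, ?_⟩
  · have hfr' : frontier (E.symm '' (Φ '' (E '' U))) = E.symm '' frontier (Φ '' (E '' U)) :=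
      (E.symm.toHomeomorph.image_frontier _).symm
    rw [hfr']
    refine (E.symm.injective.injOn.bijOn_image).comp (hbij.comp ?_)
    rw [hfr]
    exact E.injective.injOn.bijOn_image
  · have hy' : E y ∈ frontier (E '' U) := hfr ▸ mem_image_of_mem E hy
    obtain ⟨ε, hε, h⟩ := (h3 (E y) hy').exists_eq hW hWb hD hDb hbij.mapsTo
      Φ.continuous.continuousOn hy'
    refine ⟨ε, hε, fun a ha b hb hay hby => ?_⟩
    simp only [relDist_eq_bdryDist] at hay hby ⊢
    rw [← bdryDist_image E] at hay hby
    rw [bdryDist_image E.symm, ← bdryDist_image E]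
    exact h _ (hfr ▸ mem_image_of_mem E ha) _ (hfr ▸ mem_image_of_mem E hb) hay hby
  · rintro ⟨J, hJ⟩
    refine h4 ⟨(E.symm.trans J).trans E, ?_⟩
    have : (fun z => E (J (E.symm z))) '' (E '' U) = E '' (J '' U) := by
      simp [image_image]
    refine (show _ = (fun z => E (J (E.symm z))) '' (E '' U) from rfl).trans (this.trans ?_)
    rw [hJ, image_image (g := E)]
    simp

end
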